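/- Let G be a 3-edge-connected graph with |V(G)| ≥ 4 and two root vertices. Then G has no rooted immersion of D_3 if and only if either G is a doubled cycle, or G has a segmentation of width 3 relative to some (X_0, X_1) with the property that for each i = 0,1, if |X_i| ≥ 3 then X_i contains no root vertex. -/

import Mathlib

open scoped Classical

noncomputable section

namespace PaperW4

/-- A finite loopless undirected multigraph on ambient vertex type `V`:
a finite vertex set together with a multiset of (non-loop) edges supported on it. -/
structure MG (V : Type) where
  verts : Finset V
  edges : Multiset (Sym2 V)
  edge_support : ∀ e ∈ edges, ∀ v ∈ e, v ∈ verts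
  loopless : ∀ e ∈ edges, ¬ e.IsDiag

variable {V : Type} {W : Type}

/-- `δ_G(X)`: the edges of `G` with exactly one endpoint in `X`. -/
def cutEdges (G : MG V) (X : Finset V) : Multiset (Sym2 V) :=
  G.edges.filter fun e => ∃ u v, e = s(u, v) ∧ u ∈ X ∧ v ∉ X

/-- `d_G(X) = |δ_G(X)|`. -/
def dcut (G : MG V) (X : Finset V) : ℕ := (cutEdges G X).card

/-- The degree of a vertex: the number of edges incident with it. -/
def deg (G : MG V) (v : V) : ℕ := (G.edges.filter fun e => v ∈ e).card

/-- `e_G(u,v)`: the number of edges joining `u` and `v`. -/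
def emult (G : MG V) (u v : V) : ℕ := G.edges.count s(u, v)

/-- `G` is `k`-edge-connected: every edge-cut `δ(X)` with `∅ ≠ X ⊊ V(G)` has size `≥ k`. -/
def EdgeConn (G : MG V) (k : ℕ) : Prop :=
  ∀ X : Finset V, X ⊆ G.verts → X.Nonempty → X ≠ G.verts → k ≤ dcut G X

/-- `G` is internally `k`-edge-connected: every edge-cut with at least two vertices
on each side has size `≥ k`. -/
def InternallyEdgeConn (G : MG V) (k : ℕ) : Prop :=
  ∀ X : Finset V, X ⊆ G.verts → 2 ≤ X.card → 2 ≤ (G.verts \ X).card → k ≤ dcut G X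

/-- Every vertex has degree three. -/
def Cubic (G : MG V) : Prop := ∀ v ∈ G.verts, deg G v = 3

/-- The multiset of edges traversed by a walk, given as its list of vertices. -/
def walkEdges (l : List V) : Multiset (Sym2 V) :=
  (↑((l.zip l.tail).map fun p => s(p.1, p.2)) : Multiset (Sym2 V))

/-- `l` is (the vertex sequence of) a walk from `u` to `v`. -/
def IsWalk (l : List V) (u v : V) : Prop :=
  l.head? = some u ∧ l.getLast? = some v

/-- `G` is connected: any two of its vertices are joined by a trail in `G`. -/
def Connected (G : MG V) : Prop :=
  ∀ u ∈ G.verts, ∀ v ∈ G.verts,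
    ∃ l : List V, IsWalk l u v ∧ walkEdges l ≤ G.edges ∧ ∀ w ∈ l, w ∈ G.verts

/-- An immersion of the loopless multigraph with vertex type `W` and edge multiset `H`
into `G`, with terminal map `φ`: `φ` is injective, and to each edge `uv` of `H` is
assigned a walk in `G` from `φ u` to `φ v`, these walks being globally edge-disjoint. -/
def ImmersionVia (G : MG V) (H : Multiset (Sym2 W)) (φ : W → V) : Prop :=
  Function.Injective φ ∧ (∀ w : W, φ w ∈ G.verts) ∧
  ∃ P : Multiset (Sym2 W × List V),
    P.map Prod.fst = H ∧
    (∀ p ∈ P, ∃ u v : W, p.1 = s(u, v) ∧ IsWalk p.2 (φ u) (φ v)) ∧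
    (P.map fun p => walkEdges p.2).sum ≤ G.edges

/-- The edges of the wheel `W₄`: vertex `0` is the center, `1,2,3,4` the rim cycle. -/
def w4Edges : Multiset (Sym2 (Fin 5)) :=
  {s(0, 1), s(0, 2), s(0, 3), s(0, 4), s(1, 2), s(2, 3), s(3, 4), s(4, 1)}

/-- `G` has an immersion of `W₄`. -/
def HasW4Immersion (G : MG V) : Prop :=
  ∃ φ : Fin 5 → V, ImmersionVia G w4Edges φ

/-- `G` (rooted at `x`) has a rooted immersion of `W₄`: one in which the
center of `W₄` corresponds to `x`. -/
def HasRootedW4Immersion (G : MG V) (x : V) : Prop :=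
  ∃ φ : Fin 5 → V, φ 0 = x ∧ ImmersionVia G w4Edges φ

/-- The edges of `D_m`: roots are `0, 1`; vertices `2, 3` play the role of `y₀, y₁`;
there are `m - 2` parallel edges between the two roots. -/
def dmEdges (m : ℕ) : Multiset (Sym2 (Fin 4)) :=
  Multiset.replicate (m - 2) s(0, 1) + {s(0, 2), s(0, 3), s(1, 2), s(1, 3), s(2, 3)}

/-- `G` with roots `x0, x1` has a rooted immersion of `D_m`. -/
def HasRootedDmImmersion (G : MG V) (m : ℕ) (x0 x1 : V) : Prop :=
  ∃ φ : Fin 4 → V, φ 0 = x0 ∧ φ 1 = x1 ∧ ImmersionVia G (dmEdges m) φ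

/-- The edges of `K₄`. -/
def k4Edges : Multiset (Sym2 (Fin 4)) :=
  {s(0, 1), s(0, 2), s(0, 3), s(1, 2), s(1, 3), s(2, 3)}

/-- A nested chain of vertex sets `C 0 ⊂ C 1 ⊂ ⋯`, each obtained from the previous
by adding one vertex, all cuts having size exactly `k`. -/
def SegChain (G : MG V) (n : ℕ) (C : Fin (n + 1) → Finset V) (k : ℕ) : Prop :=
  (∀ i, C i ⊆ G.verts) ∧
  (∀ i : Fin n, C i.castSucc ⊆ C i.succ ∧ (C i.succ \ C i.castSucc).card = 1) ∧
  (∀ i, dcut G (C i) = k)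

/-- `G` has a segmentation of width `k` relative to `(X, Y)`. -/
def HasSegmentation (G : MG V) (X Y : Finset V) (k : ℕ) : Prop :=
  ∃ (n : ℕ) (C : Fin (n + 1) → Finset V),
    SegChain G n C k ∧ C 0 = X ∧ G.verts \ C (Fin.last n) = Y

/-- `λ_s(G) ≥ m`: every edge-cut separating `x0` from `x1` has size `≥ m`. -/
def LamSGe (G : MG V) (x0 x1 : V) (m : ℕ) : Prop :=
  ∀ X : Finset V, X ⊆ G.verts → x0 ∈ X → x1 ∉ X → m ≤ dcut G X

/-- `λ_n(G) ≥ m`: every edge-cut not separating `x0` from `x1` has size `≥ m`. -/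
def LamNGe (G : MG V) (x0 x1 : V) (m : ℕ) : Prop :=
  ∀ X : Finset V, X ⊆ G.verts → X.Nonempty → X ≠ G.verts →
    (x0 ∈ X ↔ x1 ∈ X) → m ≤ dcut G X

/-- `λ_n^i(G) ≥ m`: every internal edge-cut not separating `x0` from `x1` has size `≥ m`. -/
def LamNiGe (G : MG V) (x0 x1 : V) (m : ℕ) : Prop :=
  ∀ X : Finset V, X ⊆ G.verts → 2 ≤ X.card → 2 ≤ (G.verts \ X).card →
    (x0 ∈ X ↔ x1 ∈ X) → m ≤ dcut G X

/-- The subgraph of `G` induced on `S`. -/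
def induce (G : MG V) (S : Finset V) : MG V where
  verts := G.verts ∩ S
  edges := G.edges.filter fun e => ∀ v ∈ e, v ∈ S
  edge_support := by
    intro e he v hv
    rw [Multiset.mem_filter] at he
    exact Finset.mem_inter.mpr ⟨G.edge_support e he.1 v hv, he.2 v hv⟩
  loopless := fun e he => G.loopless e (Multiset.mem_of_mem_filter he)

/-- `G` with the vertices of `S` (and all incident edges) deleted. -/
def deleteVerts (G : MG V) (S : Finset V) : MG V := induce G (G.verts \ S)

/-- `C` is (the vertex set of) a connected component of `G`. -/
def IsComponent (G : MG V) (C : Finset V) : Prop :=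
  C ⊆ G.verts ∧ C.Nonempty ∧ Connected (induce G C) ∧
  ∀ e ∈ G.edges, (∃ v ∈ e, v ∈ C) → ∀ v ∈ e, v ∈ C

/-- `G` has type `A_m` with respect to roots `x0, x1`. -/
def TypeA (G : MG V) (m : ℕ) (x0 x1 : V) : Prop :=
  ∃ X0 X1 : Finset V, x0 ∈ X0 ∧ x1 ∈ X1 ∧ X0.card ≤ 2 ∧ X1.card ≤ 2 ∧
    HasSegmentation G X0 X1 m

/-- The edges of the lobe of `G` (with roots `x0, x1`) corresponding to the
component `C` of `G ∖ {x0, x1}`: edges inside `C ∪ {x0, x1}` other than `x0x1`-edges. -/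
def lobeEdges (G : MG V) (C : Finset V) (x0 x1 : V) : Multiset (Sym2 V) :=
  G.edges.filter fun e => (∀ v ∈ e, v ∈ insert x0 (insert x1 C)) ∧ e ≠ s(x0, x1)

/-- `G` has type `B_m` with respect to roots `x0, x1`. -/
def TypeB (G : MG V) (m : ℕ) (x0 x1 : V) : Prop :=
  ∃ (k : ℕ) (C : Fin k → Finset V) (nL : Fin k → ℕ),
    Function.Injective C ∧
    (∀ D : Finset V, IsComponent (deleteVerts G {x0, x1}) D ↔ ∃ i, C i = D) ∧
    (∀ i : Fin k, 2 ≤ nL i ∧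
      ∃ l : List V, l.Nodup ∧ IsWalk l x0 x1 ∧
        l.toFinset = insert x0 (insert x1 (C i)) ∧
        (2 ≤ (C i).card → nL i = 2) ∧
        lobeEdges G (C i) x0 x1 = nL i • walkEdges l) ∧
    emult G x0 x1 + ∑ i, nL i = m + 1

/-- The edge multiset of a cycle of length `n` on the vertices `f 0, f 1, …`. -/
def cycleEdges (n : ℕ) (f : Fin n → V) : Multiset (Sym2 V) :=
  (Finset.univ.val : Multiset (Fin n)).map fun i =>
    s(f i, f ⟨(i.val + 1) % n, Nat.mod_lt _ i.pos⟩)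

/-- `G` is a doubled cycle of length `n`. -/
def IsDoubledCycleLen (G : MG V) (n : ℕ) : Prop :=
  ∃ f : Fin n → V, Function.Injective f ∧ Finset.univ.image f = G.verts ∧
    G.edges = 2 • cycleEdges n f

/-- `G` is a doubled cycle. -/
def IsDoubledCycle (G : MG V) : Prop := ∃ n, 3 ≤ n ∧ IsDoubledCycleLen G n

/-- The map collapsing all of `Y` to the vertex `y0` and fixing everything else. -/
def collapseFun (Y : Finset V) (y0 : V) : V → V := fun v => if v ∈ Y then y0 else v

/-- The image multigraph of `G` under a vertex map `f` (identification of vertices),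
with any created loops deleted. -/
def mapGraph (f : V → V) (G : MG V) : MG V where
  verts := G.verts.image f
  edges := (G.edges.map (Sym2.map f)).filter fun e => ¬e.IsDiag
  edge_support := by
    intro e he v hv
    rw [Multiset.mem_filter] at he
    obtain ⟨he, -⟩ := he
    rw [Multiset.mem_map] at he
    obtain ⟨e', he', rfl⟩ := he
    rw [Sym2.mem_map] at hv
    obtain ⟨u, hu, rfl⟩ := hv
    exact Finset.mem_image_of_mem f (G.edge_support e' he' u hu)
  loopless := by
    intro e he
    rw [Multiset.mem_filter] at he
    exact he.2

/-- `G[X]` is a chain of sausages of order `k` in `G`: identifying `V(G) ∖ X` to a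
single vertex yields a doubled cycle of length `k + 1`. -/
def ChainOfSausages (G : MG V) (X : Finset V) (k : ℕ) : Prop :=
  X ⊆ G.verts ∧ X.card = k ∧ 2 ≤ k ∧
  ∃ y0 ∈ G.verts \ X,
    IsDoubledCycleLen (mapGraph (collapseFun (G.verts \ X) y0) G) (k + 1)

/-- `G` is sausage reduced: it has no chain of sausages of order at least `3`. -/
def SausageReduced (G : MG V) : Prop :=
  ¬ ∃ (X : Finset V) (k : ℕ), 3 ≤ k ∧ ChainOfSausages G X k

/-- One sausage shortening step of a rooted graph: two adjacent vertices of a chain of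
sausages of order at least three are identified, carrying the root along. -/
def RootedShortStep (p q : MG V × V) : Prop :=
  ∃ (X : Finset V) (k : ℕ) (a b : V),
    3 ≤ k ∧ ChainOfSausages p.1 X k ∧ a ∈ X ∧ b ∈ X ∧ a ≠ b ∧ s(a, b) ∈ p.1.edges ∧
    q.1 = mapGraph (fun v => if v = b then a else v) p.1 ∧
    q.2 = (if p.2 = b then a else p.2)

/-- Deleting a single copy of the edge `e` from `G`. -/
def deleteEdge (G : MG V) (e : Sym2 V) : MG V where
  verts := G.verts
  edges := G.edges.erase e
  edge_support := fun e' he' => G.edge_support e' (Multiset.mem_of_mem_erase he')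
  loopless := fun e' he' => G.loopless e' (Multiset.mem_of_mem_erase he')

/-- `G` has a tree-decomposition of width at most `k`. -/
def HasTreeDecomp (G : MG V) (k : ℕ) : Prop :=
  ∃ (ι : Type) (T : SimpleGraph ι) (B : ι → Finset V),
    T.IsTree ∧
    (∀ t, B t ⊆ G.verts) ∧
    (∀ v ∈ G.verts, ∃ t, v ∈ B t) ∧
    (∀ e ∈ G.edges, ∃ t, ∀ v ∈ e, v ∈ B t) ∧
    (∀ v ∈ G.verts, (SimpleGraph.induce {t | v ∈ B t} T).Connected) ∧
    ∀ t, (B t).card ≤ k + 1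

/-- The tree-width of `G`. -/
def treewidth (G : MG V) : ℕ := sInf { k | HasTreeDecomp G k }

/-- One subdivision step: an edge `uv` is replaced by a path `u - w - v`
through a new vertex `w`. -/
def SubdivStep (G H : MG V) : Prop :=
  ∃ u v w : V, s(u, v) ∈ G.edges ∧ w ∉ G.verts ∧
    H.verts = insert w G.verts ∧
    H.edges = (G.edges.erase s(u, v)) + {s(u, w), s(w, v)}

/-- `H` is a subdivision of `G`. -/
def IsSubdivision (G H : MG V) : Prop := Relation.ReflTransGen SubdivStep G H

/-- `G`, rooted at `u`, has type 2 (for the rooted `W₄` theorem). -/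
def TypeTwo (G : MG V) (u : V) : Prop :=
  ∃ W0 : Finset V, W0 ⊆ G.verts ∧ u ∉ W0 ∧ 1 ≤ W0.card ∧ W0.card ≤ 2 ∧
    ∃ w0 ∈ W0,
      ∃ n : ℕ, 3 ≤ n ∧
        ∃ f : Fin n → V,
          Function.Injective f ∧
          Finset.univ.image f = (mapGraph (collapseFun W0 w0) G).verts ∧
          (∃ i, f i = u) ∧ (∃ j, f j = w0) ∧
          ((s(u, w0) ∉ cycleEdges n f ∧
              (mapGraph (collapseFun W0 w0) G).edges =
                2 • cycleEdges n f + {s(u, w0)}) ∨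
           (∃ v : V, s(u, v) ∈ cycleEdges n f ∧ s(v, w0) ∈ cycleEdges n f ∧
              (mapGraph (collapseFun W0 w0) G).edges =
                2 • cycleEdges n f + {s(u, v), s(v, w0)}) ∨
           (s(u, w0) ∈ cycleEdges n f ∧
              (mapGraph (collapseFun W0 w0) G).edges =
                2 • cycleEdges n f + {s(u, w0)}))

/-- The edge `e` has exactly one endpoint in `X`. -/
def Crosses (X : Finset V) (e : Sym2 V) : Prop := ∃ u v, e = s(u, v) ∧ u ∈ X ∧ v ∉ X

lemma crosses_mk (X : Finset V) (a b : V) : Crosses X s(a, b) ↔ ¬(a ∈ X ↔ b ∈ X) := by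
  constructor
  · rintro ⟨u, v, h, hu, hv⟩
    rcases Sym2.eq_iff.1 h with ⟨rfl, rfl⟩ | ⟨rfl, rfl⟩ <;> tauto
  · intro h
    by_cases ha : a ∈ X
    · exact ⟨a, b, rfl, ha, by tauto⟩
    · exact ⟨b, a, Sym2.eq_swap, by tauto, ha⟩

/-- The number of edges of `E` with exactly one endpoint in `X`. -/
def cutSize (E : Multiset (Sym2 V)) (X : Finset V) : ℕ := E.countP (Crosses X)

lemma dcut_eq_cutSize (G : MG V) (X : Finset V) : dcut G X = cutSize G.edges X := by
  unfold dcut cutEdges cutSize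
  rw [Multiset.countP_eq_card_filter]
  rfl

lemma cutSize_zero (X : Finset V) : cutSize (0 : Multiset (Sym2 V)) X = 0 := rfl

lemma cutSize_empty (E : Multiset (Sym2 V)) : cutSize E ∅ = 0 := by
  unfold cutSize
  rw [Multiset.countP_eq_zero]
  rintro e - ⟨u, v, -, h, -⟩
  simp at h

lemma cutSize_cons (E : Multiset (Sym2 V)) (X : Finset V) (a b : V) :
    cutSize (s(a, b) ::ₘ E) X = cutSize E X + if (a ∈ X ↔ b ∈ X) then 0 else 1 := by
  unfold cutSize
  rw [Multiset.countP_cons]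
  simp only [crosses_mk]
  split_ifs <;> simp_all

lemma cutSize_add (E F : Multiset (Sym2 V)) (X : Finset V) :
    cutSize (E + F) X = cutSize E X + cutSize F X := Multiset.countP_add _ _ _

lemma cutSize_mono {E F : Multiset (Sym2 V)} (h : E ≤ F) (X : Finset V) :
    cutSize E X ≤ cutSize F X := Multiset.countP_le_of_le _ h

/-- Cuts of an edge multiset supported on `S` are unchanged under complementation in `S`. -/
lemma cutSize_compl {E : Multiset (Sym2 V)} {S : Finset V} (hE : ∀ e ∈ E, ∀ v ∈ e, v ∈ S)
    (X : Finset V) : cutSize E (S \ X) = cutSize E X := by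
  unfold cutSize
  apply Multiset.countP_congr rfl
  intro e he
  induction e with
  | _ a b =>
    have ha := hE _ he a (Sym2.mem_mk_left a b)
    have hb := hE _ he b (Sym2.mem_mk_right a b)
    simp only [crosses_mk, Finset.mem_sdiff, ha, hb, true_and, eq_iff_iff]
    tauto

lemma sum_ite_mk_eq {C : Finset V} {a : V} (ha : a ∉ C) (x y : V) :
    (∑ c ∈ C, if s(a, c) = s(x, y) then 1 else 0) =
      if (x = a ∧ y ∈ C) ∨ (y = a ∧ x ∈ C) then 1 else 0 := by
  by_cases hx : x = a
  · subst hx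
    have : ∀ c ∈ C, (if s(x, c) = s(x, y) then 1 else 0) = if c = y then 1 else 0 := by
      intro c hc
      have : c ≠ x := fun h => ha (h ▸ hc)
      simp [this]
    rw [Finset.sum_congr rfl this, Finset.sum_ite_eq']
    by_cases hy : y ∈ C <;> simp [hy, ha]
  · by_cases hy : y = a
    · subst hy
      have : ∀ c ∈ C, (if s(y, c) = s(x, y) then 1 else 0) = if c = x then 1 else 0 := by
        intro c hc
        have : c ≠ y := fun h => ha (h ▸ hc)
        rw [Sym2.eq_swap (a := x)]
        simp [this]
      rw [Finset.sum_congr rfl this, Finset.sum_ite_eq']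
      by_cases hy : x ∈ C <;> simp [hy, ha]
    · simp only [hx, hy, false_and, or_self, if_false]
      apply Finset.sum_eq_zero
      intro c hc
      rw [if_neg]
      intro h
      rcases Sym2.eq_iff.1 h with ⟨h1, h2⟩ | ⟨h1, h2⟩
      · exact hx h1.symm
      · exact hy h1.symm

lemma cutSize_insert (E : Multiset (Sym2 V)) {C : Finset V} {a : V} (ha : a ∉ C) :
    cutSize E (insert a C) + 2 * ∑ c ∈ C, E.count s(a, c) = cutSize E C + cutSize E {a} := by
  induction E using Multiset.induction with
  | empty => simp [cutSize_zero]
  | cons e E ih =>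
    induction e with
    | _ x y =>
      simp only [cutSize_cons, Multiset.count_cons, Finset.sum_add_distrib, Finset.mem_insert,
        Finset.mem_singleton, sum_ite_mk_eq ha]
      by_cases hx : x = a
      · subst hx
        by_cases hy : y = x
        · subst hy
          simp [ha]; omega
        · by_cases hyC : y ∈ C <;> simp [ha, hy, hyC] <;> omega
      · by_cases hy : y = a
        · subst hy
          by_cases hxC : x ∈ C <;> simp [ha, hx, hxC] <;> omega
        · simp only [hx, hy, false_and, or_self, if_false, false_or]
          by_cases hxC : x ∈ C <;> by_cases hyC : y ∈ C <;> simp [hxC, hyC] <;> omega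

lemma sum_count_le_cutSize (E : Multiset (Sym2 V)) {C : Finset V} {a : V} (ha : a ∉ C) :
    ∑ c ∈ C, E.count s(a, c) ≤ cutSize E {a} := by
  induction E using Multiset.induction with
  | empty => simp [cutSize_zero]
  | cons e E ih =>
    induction e with
    | _ x y =>
      simp only [cutSize_cons, Multiset.count_cons, Finset.sum_add_distrib,
        Finset.mem_singleton, sum_ite_mk_eq ha]
      by_cases hx : x = a
      · subst hx
        by_cases hy : y = x
        · subst hy
          simpa [ha] using ih
        · by_cases hyC : y ∈ C <;> simp [ha, hy, hyC] <;> omega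
      · by_cases hy : y = a
        · subst hy
          by_cases hxC : x ∈ C <;> simp [ha, hx, hxC] <;> omega
        · simpa only [hx, hy, false_and, or_self, if_false, iff_self, if_true, Nat.add_zero] using ih

lemma sum_count_eq_cutSize {E : Multiset (Sym2 V)} {S : Finset V} {a : V}
    (hE : ∀ e ∈ E, ∀ v ∈ e, v ∈ S) (ha : a ∈ S) :
    ∑ c ∈ S.erase a, E.count s(a, c) = cutSize E {a} := by
  have h1 := cutSize_insert E (Finset.notMem_erase a S)
  rw [Finset.insert_erase ha] at h1
  have h2 := cutSize_compl hE {a}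
  have h3 := cutSize_compl hE S
  rw [Finset.sdiff_self, cutSize_empty] at h3
  rw [Finset.sdiff_singleton_eq_erase] at h2
  omega

/-- Elementary immersion operations on edge multisets: deleting edges, or splitting off
the pair `xy`, `yz` at `y`. -/
inductive Step : Multiset (Sym2 V) → Multiset (Sym2 V) → Prop
  | del {E F : Multiset (Sym2 V)} (h : F ≤ E) : Step E F
  | split (x y z : V) (R : Multiset (Sym2 V)) :
      Step (s(x, y) ::ₘ s(y, z) ::ₘ R) (s(x, z) ::ₘ R)

/-- `F` arises from `E` by deletions and splittings. -/
def Emb : Multiset (Sym2 V) → Multiset (Sym2 V) → Prop := Relation.ReflTransGen Step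

lemma Emb.refl (E : Multiset (Sym2 V)) : Emb E E := Relation.ReflTransGen.refl

lemma Emb.trans {E F K : Multiset (Sym2 V)} (h : Emb E F) (h' : Emb F K) : Emb E K :=
  Relation.ReflTransGen.trans h h'

lemma Emb.of_le {E F : Multiset (Sym2 V)} (h : F ≤ E) : Emb E F :=
  Relation.ReflTransGen.single (Step.del h)

lemma Emb.split (x y z : V) (R : Multiset (Sym2 V)) :
    Emb (s(x, y) ::ₘ s(y, z) ::ₘ R) (s(x, z) ::ₘ R) :=
  Relation.ReflTransGen.single (Step.split x y z R)

lemma walkEdges_cons_cons (a b : V) (l : List V) :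
    walkEdges (a :: b :: l) = s(a, b) ::ₘ walkEdges (b :: l) := rfl

lemma walkEdges_singleton (a : V) : walkEdges [a] = 0 := rfl

lemma walkEdges_nil : walkEdges ([] : List V) = 0 := rfl

/-- A walk through the edge `xz` can be rerouted through `y`. -/
lemma exists_reroute (x y z : V) : ∀ l : List V, s(x, z) ∈ walkEdges l →
    ∃ l' : List V, l'.head? = l.head? ∧ l'.getLast? = l.getLast? ∧
      s(x, z) ::ₘ walkEdges l' = s(x, y) ::ₘ s(y, z) ::ₘ walkEdges l
  | [], h => by simp [walkEdges_nil] at h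
  | [a], h => by simp [walkEdges_singleton] at h
  | a :: b :: t, h => by
    rw [walkEdges_cons_cons] at h
    by_cases hab : s(a, b) = s(x, z)
    · refine ⟨a :: y :: b :: t, rfl, by simp, ?_⟩
      simp only [walkEdges_cons_cons]
      rcases Sym2.eq_iff.1 hab with ⟨rfl, rfl⟩ | ⟨rfl, rfl⟩
      · rw [Multiset.cons_swap, Multiset.cons_swap s(a, b) s(y, b)]
      · rw [Sym2.eq_swap (a := a) (b := y), Sym2.eq_swap (a := y) (b := b),
          Sym2.eq_swap (a := a) (b := b), Multiset.cons_swap, Multiset.cons_swap s(b, a) s(b, y),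
          Multiset.cons_swap s(y, a)]
    · have h' : s(x, z) ∈ walkEdges (b :: t) := by
        rcases Multiset.mem_cons.1 h with h | h
        · exact absurd h.symm hab
        · exact h
      obtain ⟨l', h1, h2, h3⟩ := exists_reroute x y z (b :: t) h'
      match l', h1, h2, h3 with
      | [], h1, _, _ => simp at h1
      | c :: l', h1, h2, h3 =>
        simp only [List.head?_cons, Option.some.injEq] at h1
        subst h1
        refine ⟨a :: c :: l', rfl, by simpa using h2, ?_⟩
        simp only [walkEdges_cons_cons]
        rw [Multiset.cons_swap, h3, Multiset.cons_swap s(a, c), Multiset.cons_swap s(a, c)]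

/-- Edge-disjoint walks in `E` realising the edges of `H` between terminals `φ`. -/
def Routes (E : Multiset (Sym2 V)) (H : Multiset (Sym2 W)) (φ : W → V) : Prop :=
  ∃ P : Multiset (Sym2 W × List V),
    P.map Prod.fst = H ∧
    (∀ p ∈ P, ∃ u v : W, p.1 = s(u, v) ∧ IsWalk p.2 (φ u) (φ v)) ∧
    (P.map fun p => walkEdges p.2).sum ≤ E

lemma Routes.of_step {E F : Multiset (Sym2 V)} {H : Multiset (Sym2 W)} {φ : W → V}
    (h : Step E F) (hF : Routes F H φ) : Routes E H φ := by
  obtain ⟨P, hP1, hP2, hP3⟩ := hF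
  cases h with
  | del h => exact ⟨P, hP1, hP2, hP3.trans h⟩
  | split x y z R =>
    by_cases hm : s(x, z) ∈ (P.map fun p => walkEdges p.2).sum
    · obtain ⟨q, hq, hxz⟩ := Multiset.mem_join.1 hm
      rw [Multiset.mem_map] at hq
      obtain ⟨p, hp, rfl⟩ := hq
      obtain ⟨l', h1, h2, h3⟩ := exists_reroute x y z p.2 hxz
      obtain ⟨P0, rfl⟩ := Multiset.exists_cons_of_mem hp
      refine ⟨(p.1, l') ::ₘ P0, ?_, ?_, ?_⟩
      · simpa using hP1
      · intro q hq
        rcases Multiset.mem_cons.1 hq with rfl | hq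
        · obtain ⟨u, v, hu, hv⟩ := hP2 p hp
          exact ⟨u, v, hu, h1.trans hv.1, h2.trans hv.2⟩
        · exact hP2 q (Multiset.mem_cons_of_mem hq)
      · simp only [Multiset.map_cons, Multiset.sum_cons] at hP3 ⊢
        rw [← Multiset.cons_le_cons_iff s(x, z), ← Multiset.cons_add, h3,
          Multiset.cons_add, Multiset.cons_add]
        rw [Multiset.cons_swap s(x, z), Multiset.cons_swap s(x, z)]
        exact (Multiset.cons_le_cons_iff _).2 ((Multiset.cons_le_cons_iff _).2 hP3)
    · refine ⟨P, hP1, hP2, ?_⟩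
      have := (Multiset.le_cons_of_notMem hm).1 hP3
      exact this.trans ((Multiset.le_cons_self _ _).trans (Multiset.le_cons_self _ _))

lemma Routes.of_emb {E F : Multiset (Sym2 V)} {H : Multiset (Sym2 W)} {φ : W → V}
    (h : Emb E F) (hF : Routes F H φ) : Routes E H φ := by
  induction h using Relation.ReflTransGen.head_induction_on with
  | refl => exact hF
  | head h _ ih => exact ih.of_step h

lemma HasRootedDmImmersion.of_emb {G H : MG V} {m : ℕ} {x0 x1 : V} (hv : H.verts ⊆ G.verts)
    (he : Emb G.edges H.edges) (h : HasRootedDmImmersion H m x0 x1) :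
    HasRootedDmImmersion G m x0 x1 := by
  obtain ⟨φ, h0, h1, hinj, hmem, hr⟩ := h
  exact ⟨φ, h0, h1, hinj, fun w => hv (hmem w), Routes.of_emb (E := G.edges) he hr⟩

/-- The edges of the graph obtained by identifying `Y` to `y0` and removing loops. -/
def coll (Y : Finset V) (y0 : V) (E : Multiset (Sym2 V)) : Multiset (Sym2 V) :=
  (E.map (Sym2.map (collapseFun Y y0))).filter fun e => ¬e.IsDiag

lemma mapGraph_collapseFun_edges (G : MG V) (Y : Finset V) (y0 : V) :
    (mapGraph (collapseFun Y y0) G).edges = coll Y y0 G.edges := rfl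

lemma collapseFun_of_mem {Y : Finset V} {y0 v : V} (h : v ∈ Y) : collapseFun Y y0 v = y0 :=
  if_pos h

lemma collapseFun_of_notMem {Y : Finset V} {y0 v : V} (h : v ∉ Y) : collapseFun Y y0 v = v :=
  if_neg h

lemma coll_cons (Y : Finset V) (y0 a b : V) (E : Multiset (Sym2 V)) :
    coll Y y0 (s(a, b) ::ₘ E) =
      if collapseFun Y y0 a = collapseFun Y y0 b then coll Y y0 E
      else s(collapseFun Y y0 a, collapseFun Y y0 b) ::ₘ coll Y y0 E := by
  unfold coll
  rw [Multiset.map_cons, Sym2.map_mk]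
  split_ifs with h
  · rw [Multiset.filter_cons_of_neg]
    simpa using h
  · rw [Multiset.filter_cons_of_pos]
    simpa using h

lemma card_coll_le (Y : Finset V) (y0 : V) (E : Multiset (Sym2 V)) :
    (coll Y y0 E).card ≤ E.card := by
  unfold coll
  exact (Multiset.card_le_card (Multiset.filter_le _ _)).trans (by simp)

lemma cutSize_coll_of_iff {Y : Finset V} {y0 : V} {X X' : Finset V}
    (h : ∀ v, v ∈ X' ↔ collapseFun Y y0 v ∈ X) (E : Multiset (Sym2 V)) :
    cutSize (coll Y y0 E) X = cutSize E X' := by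
  induction E using Multiset.induction with
  | empty => rfl
  | cons e E ih =>
    induction e with
    | _ a b =>
      rw [coll_cons, cutSize_cons]
      split_ifs with h1 h2 h2
      · rw [ih]; rfl
      · exact absurd (by rw [h, h, h1]) h2
      · rw [cutSize_cons, ih, if_pos (by rwa [← h, ← h])]
      · rw [cutSize_cons, ih, if_neg (by rwa [← h, ← h])]

lemma cutSize_coll (Y : Finset V) (y0 : V) (E : Multiset (Sym2 V)) (X : Finset V) :
    cutSize (coll Y y0 E) X = cutSize E ((X \ Y) ∪ if y0 ∈ X then Y else ∅) := by
  apply cutSize_coll_of_iff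
  intro v
  by_cases hv : v ∈ Y <;> by_cases hy : y0 ∈ X <;> simp [collapseFun, hv, hy]

lemma cutSize_coll_of_mem {Y : Finset V} {y0 : V} {X : Finset V} (h : y0 ∈ X)
    (E : Multiset (Sym2 V)) : cutSize (coll Y y0 E) X = cutSize E (X ∪ Y) := by
  rw [cutSize_coll, if_pos h, Finset.sdiff_union_self_eq_union]

lemma cutSize_coll_of_disjoint {Y : Finset V} {y0 : V} {X : Finset V} (hy : y0 ∈ Y)
    (h : Disjoint X Y) (E : Multiset (Sym2 V)) : cutSize (coll Y y0 E) X = cutSize E X := by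
  rw [cutSize_coll, if_neg (Finset.disjoint_right.1 h hy), Finset.union_empty,
    Finset.sdiff_eq_self_of_disjoint h]

lemma coll_coll {Y Z : Finset V} {y0 : V} (hy : y0 ∈ Z) (hZ : Z ⊆ Y) (E : Multiset (Sym2 V)) :
    coll (insert y0 (Y \ Z)) y0 (coll Z y0 E) = coll Y y0 E := by
  have key : ∀ v, collapseFun (insert y0 (Y \ Z)) y0 (collapseFun Z y0 v) =
      collapseFun Y y0 v := by
    intro v
    by_cases hv : v ∈ Z
    · simp [collapseFun, hv, hZ hv]
    · by_cases hvY : v ∈ Y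
      · simp [collapseFun, hv, hvY]
      · have : v ≠ y0 := fun h => hv (h ▸ hy)
        simp [collapseFun, hv, hvY, this]
  induction E using Multiset.induction with
  | empty => rfl
  | cons e E ih =>
    induction e with
    | _ a b =>
      rw [coll_cons, coll_cons]
      split_ifs with h1 h2 h2
      · exact ih
      · exact absurd (by rw [← key, ← key b, h1]) h2
      · rw [coll_cons, key, key, if_pos h2, ih]
      · rw [coll_cons, key, key, if_neg h2, ih]

lemma coll_le_self {Y : Finset V} {y0 : V} {E : Multiset (Sym2 V)}
    (h : ∀ u v, s(u, v) ∈ E → u ∈ Y → u ≠ y0 → v ∈ Y) : coll Y y0 E ≤ E := by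
  induction E using Multiset.induction with
  | empty => exact le_rfl
  | cons e E ih =>
    have ih' := ih fun u v huv => h u v (Multiset.mem_cons_of_mem huv)
    induction e with
    | _ a b =>
      rw [coll_cons]
      split_ifs with h1
      · exact ih'.trans (Multiset.le_cons_self _ _)
      · have hab := h a b (Multiset.mem_cons_self _ _)
        have hba := h b a (by rw [Sym2.eq_swap]; exact Multiset.mem_cons_self _ _)
        have ha : collapseFun Y y0 a = a := by
          by_contra hne
          have haY : a ∈ Y := by
            by_contra haY
            exact hne (collapseFun_of_notMem haY)
          rw [collapseFun_of_mem haY] at hne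
          exact h1 (by rw [collapseFun_of_mem haY, collapseFun_of_mem (hab haY (Ne.symm hne))])
        have hb : collapseFun Y y0 b = b := by
          by_contra hne
          have hbY : b ∈ Y := by
            by_contra hbY
            exact hne (collapseFun_of_notMem hbY)
          rw [collapseFun_of_mem hbY] at hne
          exact h1 (by rw [collapseFun_of_mem hbY, collapseFun_of_mem (hba hbY (Ne.symm hne))])
        rw [ha, hb]
        exact (Multiset.cons_le_cons_iff _).2 ih'

/-- If `{y0}` cannot be separated from the outside of `Y` by a cut smaller than that of `Y`,
then the identification of `Y` to `y0` is obtained by splittings and deletions. -/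
lemma emb_coll {Y : Finset V} {y0 : V} {E : Multiset (Sym2 V)} (hy : y0 ∈ Y)
    (hmin : ∀ Z ⊆ Y, y0 ∈ Z → cutSize E Y ≤ cutSize E Z) : Emb E (coll Y y0 E) := by
  induction hN : E.card + Y.card using Nat.strong_induction_on generalizing E Y with
  | _ N ih =>
  subst hN
  by_cases c1 : ∃ u v E0, u ∈ Y ∧ v ∈ Y ∧ E = s(u, v) ::ₘ E0 ∧
      ∀ Z ⊆ Y, y0 ∈ Z → cutSize E0 Y ≤ cutSize E0 Z
  · obtain ⟨u, v, E0, hu, hv, rfl, h0⟩ := c1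
    have := ih _ (by simp) hy h0 rfl
    rw [coll_cons, if_pos (by rw [collapseFun_of_mem hu, collapseFun_of_mem hv])]
    exact (Emb.of_le (Multiset.le_cons_self _ _)).trans this
  by_cases c2 : ∃ Z ⊆ Y, y0 ∈ Z ∧ Z ≠ {y0} ∧ Z ≠ Y ∧ cutSize E Z ≤ cutSize E Y
  · obtain ⟨Z, hZ, hyZ, hZ1, hZY, hcut⟩ := c2
    have hZlt : Z.card < Y.card := Finset.card_lt_card (hZ.ssubset_of_ne hZY)
    have hZ2 : 1 < Z.card := by
      rw [Finset.one_lt_card_iff_nontrivial]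
      exact (Finset.nontrivial_iff_ne_singleton hyZ).2 hZ1
    have e1 := ih _ (by omega) hyZ (fun Z' hZ' h' => hcut.trans (hmin Z' (hZ'.trans hZ) h')) rfl
    have hc : (insert y0 (Y \ Z)).card < Y.card := by
      have := Finset.card_insert_le y0 (Y \ Z)
      rw [Finset.card_sdiff_of_subset hZ] at this
      omega
    have hY : insert y0 (Y \ Z) ∪ Z = Y := by
      ext v
      have := @hZ v
      simp only [Finset.mem_union, Finset.mem_insert, Finset.mem_sdiff]
      constructor
      · rintro ((rfl | h) | h) <;> tauto
      · tauto
    have e2 := ih _ (lt_of_lt_of_le (Nat.add_lt_add_left hc _)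
        (Nat.add_le_add_right (card_coll_le Z y0 E) _)) (E := coll Z y0 E)
        (Finset.mem_insert_self _ _) (by
          intro Z' hZ' h'
          rw [cutSize_coll_of_mem (Finset.mem_insert_self _ _), cutSize_coll_of_mem h', hY]
          apply hmin _ _ (Finset.mem_union_left _ h')
          apply Finset.union_subset (hZ'.trans _) hZ
          exact Finset.insert_subset hy Finset.sdiff_subset) rfl
    rw [coll_coll hyZ hZ] at e2
    exact e1.trans e2
  by_cases c3 : ∃ u v, s(u, v) ∈ E ∧ u ∈ Y ∧ u ≠ y0 ∧ v ∉ Y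
  · obtain ⟨u, v, huv, hu, huy, hv⟩ := c3
    have hyu : y0 ∈ Y.erase u := Finset.mem_erase.2 ⟨huy.symm, hy⟩
    have huvne : v ≠ u := fun h => hv (h ▸ hu)
    obtain ⟨c, hc, hcE⟩ : ∃ c ∈ Y.erase u, s(u, c) ∈ E := by
      by_contra hcon
      push Not at hcon
      have h1 := cutSize_insert E (Finset.notMem_erase u Y)
      rw [Finset.insert_erase hu, Finset.sum_eq_zero fun c hc =>
        Multiset.count_eq_zero.2 (hcon c hc)] at h1
      have h2 := hmin _ (Finset.erase_subset u Y) hyu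
      have h3 : 0 < cutSize E {u} := by
        unfold cutSize
        rw [Multiset.countP_pos]
        exact ⟨_, huv, by simp [crosses_mk, huvne]⟩
      omega
    have hcY := Finset.mem_of_mem_erase hc
    have hcy : c = y0 := by
      obtain ⟨E0, rfl⟩ := Multiset.exists_cons_of_mem hcE
      by_contra hcy
      push Not at c1
      obtain ⟨Z, hZ, hyZ, hlt⟩ := c1 u c E0 hu hcY rfl
      have hYc := cutSize_cons E0 Y u c
      rw [if_pos (by tauto)] at hYc
      have hZc := cutSize_cons E0 Z u c
      have hZle := hmin Z hZ hyZ
      have hcross : ¬(u ∈ Z ↔ c ∈ Z) := by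
        intro h
        rw [if_pos h] at hZc
        omega
      rw [if_neg hcross] at hZc
      refine c2 ⟨Z, hZ, hyZ, ?_, ?_, by omega⟩
      · rintro rfl
        simp [hcy, huy] at hcross
      · rintro rfl
        tauto
    subst hcy
    obtain ⟨E0, rfl⟩ := Multiset.exists_cons_of_mem hcE
    have hmem : s(v, u) ∈ E0 := by
      rcases Multiset.mem_cons.1 huv with h | h
      · rcases Sym2.eq_iff.1 h with ⟨_, rfl⟩ | ⟨rfl, _⟩ <;> tauto
      · rwa [Sym2.eq_swap]
    obtain ⟨R, rfl⟩ := Multiset.exists_cons_of_mem hmem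
    have hcuts : ∀ Z ⊆ Y, c ∈ Z → cutSize (s(v, c) ::ₘ R) Z =
        cutSize (s(u, c) ::ₘ s(v, u) ::ₘ R) Z := by
      intro Z hZ hcZ
      have hvZ : v ∉ Z := fun h => hv (hZ h)
      rw [cutSize_cons, cutSize_cons, cutSize_cons]
      by_cases huZ : u ∈ Z <;> simp [huZ, hcZ, hvZ]
    have e1 := ih _ (by simp) (E := s(v, c) ::ₘ R) hy (by
      intro Z hZ hcZ
      rw [hcuts Z hZ hcZ, hcuts Y subset_rfl hy]
      exact hmin Z hZ hcZ) rfl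
    have e2 : coll Y c (s(u, c) ::ₘ s(v, u) ::ₘ R) = coll Y c (s(v, c) ::ₘ R) := by
      rw [coll_cons, coll_cons, coll_cons]
      simp only [collapseFun_of_mem hu, collapseFun_of_mem hcY, if_true]
    rw [e2, Multiset.cons_swap]
    exact (Emb.split v u c R).trans e1
  · push Not at c3
    exact Emb.of_le (coll_le_self c3)

/-- Identifying the vertices of `Y ⊆ V(G)` to the vertex `y0 ∈ Y`. -/
lemma mapGraph_collapseFun_verts {G : MG V} {Y : Finset V} {y0 : V} (hy : y0 ∈ Y)
    (hY : Y ⊆ G.verts) :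
    (mapGraph (collapseFun Y y0) G).verts = insert y0 (G.verts \ Y) := by
  ext v
  simp only [mapGraph, Finset.mem_image, Finset.mem_insert, Finset.mem_sdiff]
  constructor
  · rintro ⟨u, hu, rfl⟩
    by_cases huY : u ∈ Y
    · left; exact collapseFun_of_mem huY
    · right; rw [collapseFun_of_notMem huY]; exact ⟨hu, huY⟩
  · rintro (rfl | ⟨h1, h2⟩)
    · exact ⟨v, hY hy, collapseFun_of_mem hy⟩
    · exact ⟨v, h1, collapseFun_of_notMem h2⟩

section

lemma dcut_compl (G : MG V) (X : Finset V) : dcut G (G.verts \ X) = dcut G X := by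
  simp only [dcut_eq_cutSize]
  exact cutSize_compl G.edge_support X

lemma dcut_insert (G : MG V) {C : Finset V} {a : V} (ha : a ∉ C) :
    dcut G (insert a C) + 2 * ∑ c ∈ C, emult G a c = dcut G C + dcut G {a} := by
  simp only [dcut_eq_cutSize]
  exact cutSize_insert G.edges ha

lemma sum_emult_le (G : MG V) {C : Finset V} {a : V} (ha : a ∉ C) :
    ∑ c ∈ C, emult G a c ≤ dcut G {a} := by
  simp only [dcut_eq_cutSize]
  exact sum_count_le_cutSize G.edges ha

lemma sum_emult_eq (G : MG V) {a : V} (ha : a ∈ G.verts) :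
    ∑ c ∈ G.verts.erase a, emult G a c = dcut G {a} := by
  simp only [dcut_eq_cutSize]
  exact sum_count_eq_cutSize G.edge_support ha

lemma emult_comm (G : MG V) (a b : V) : emult G a b = emult G b a := by
  unfold emult
  rw [Sym2.eq_swap]

lemma dcut_pair (G : MG V) {a b : V} (h : a ≠ b) :
    dcut G {a, b} + 2 * emult G a b = dcut G {b} + dcut G {a} := by
  have := dcut_insert G (C := {b}) (a := a) (by simpa using h)
  simpa using this

lemma emult_le_dcut (G : MG V) {a b : V} (h : a ≠ b) : emult G a b ≤ dcut G {a} := by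
  have := sum_emult_le G (C := {b}) (a := a) (by simpa using h)
  simpa using this

lemma emult_pos_mem {G : MG V} {a b : V} (h : 0 < emult G a b) :
    a ∈ G.verts ∧ b ∈ G.verts ∧ a ≠ b := by
  have hm := Multiset.count_pos.1 h
  refine ⟨G.edge_support _ hm a (Sym2.mem_mk_left a b),
    G.edge_support _ hm b (Sym2.mem_mk_right a b), ?_⟩
  intro hab
  exact G.loopless _ hm (by simpa using hab)

lemma dcut_empty (G : MG V) : dcut G ∅ = 0 := by
  rw [dcut_eq_cutSize, cutSize_empty]

/-- `G` with the vertices of `Y` identified to `y`. -/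
abbrev contract (G : MG V) (Y : Finset V) (y : V) : MG V := mapGraph (collapseFun Y y) G

section Contract

variable {G : MG V} {Y : Finset V} {y : V}

lemma dcut_contract_of_mem {X : Finset V} (h : y ∈ X) :
    dcut (contract G Y y) X = dcut G (X ∪ Y) := by
  rw [dcut_eq_cutSize, dcut_eq_cutSize, mapGraph_collapseFun_edges, cutSize_coll_of_mem h]

lemma dcut_contract_of_disjoint {X : Finset V} (hy : y ∈ Y) (h : Disjoint X Y) :
    dcut (contract G Y y) X = dcut G X := by
  rw [dcut_eq_cutSize, dcut_eq_cutSize, mapGraph_collapseFun_edges,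
    cutSize_coll_of_disjoint hy h]

lemma mem_contract_verts (hy : y ∈ Y) (hY : Y ⊆ G.verts) {v : V} :
    v ∈ (contract G Y y).verts ↔ v = y ∨ (v ∈ G.verts ∧ v ∉ Y) := by
  rw [mapGraph_collapseFun_verts hy hY]
  simp

lemma contract_verts_subset (hy : y ∈ Y) (hY : Y ⊆ G.verts) :
    (contract G Y y).verts ⊆ G.verts := by
  intro v hv
  rcases (mem_contract_verts hy hY).1 hv with rfl | h
  · exact hY hy
  · exact h.1

lemma card_contract_verts (hy : y ∈ Y) (hY : Y ⊆ G.verts) :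
    (contract G Y y).verts.card + Y.card = G.verts.card + 1 := by
  rw [mapGraph_collapseFun_verts hy hY, Finset.card_insert_of_notMem (by simp [hy]),
    Finset.card_sdiff_of_subset hY]
  have := Finset.card_le_card hY
  omega

lemma card_contract_edges_le : (contract G Y y).edges.card ≤ G.edges.card :=
  card_coll_le _ _ _

lemma EdgeConn.contract {k : ℕ} (h : EdgeConn G k) (hy : y ∈ Y) (hY : Y ⊆ G.verts) :
    EdgeConn (contract G Y y) k := by
  intro X hX hne hX'
  by_cases hyX : y ∈ X
  · rw [dcut_contract_of_mem hyX]
    apply h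
    · exact Finset.union_subset (hX.trans (contract_verts_subset hy hY)) hY
    · exact ⟨y, Finset.mem_union_left _ hyX⟩
    · intro heq
      apply hX'
      refine Finset.Subset.antisymm hX fun v hv => ?_
      rcases (mem_contract_verts hy hY).1 hv with rfl | ⟨hv1, hv2⟩
      · exact hyX
      · rw [← heq] at hv1
        simpa [hv2] using hv1
  · have hdisj : Disjoint X Y := by
      rw [Finset.disjoint_left]
      intro v hv hvY
      rcases (mem_contract_verts hy hY).1 (hX hv) with rfl | ⟨hv1, hv2⟩
      · exact hyX hv
      · exact hv2 hvY
    rw [dcut_contract_of_disjoint hy hdisj]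
    refine h X (hX.trans (contract_verts_subset hy hY)) hne ?_
    rintro rfl
    exact Finset.disjoint_left.1 hdisj (hY hy) hy

lemma emb_contract (hy : y ∈ Y) (hmin : ∀ Z ⊆ Y, y ∈ Z → dcut G Y ≤ dcut G Z) :
    Emb G.edges (contract G Y y).edges := by
  rw [mapGraph_collapseFun_edges]
  apply emb_coll hy
  simpa only [dcut_eq_cutSize] using hmin

lemma emult_contract {u v : V} (hy : y ∈ Y) (hu : u ∉ Y) (hv : v ∉ Y) :
    emult (contract G Y y) u v = emult G u v := by
  by_cases huv : u = v
  · subst huv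
    have h1 : emult (contract G Y y) u u = 0 := by
      by_contra h
      exact (emult_pos_mem (Nat.pos_of_ne_zero h)).2.2 rfl
    have h2 : emult G u u = 0 := by
      by_contra h
      exact (emult_pos_mem (Nat.pos_of_ne_zero h)).2.2 rfl
    rw [h1, h2]
  have h1 := dcut_pair (contract G Y y) huv
  have h2 := dcut_pair G huv
  rw [dcut_contract_of_disjoint hy (by simp [hu, hv]),
    dcut_contract_of_disjoint hy (by simp [hv]), dcut_contract_of_disjoint hy (by simp [hu])] at h1
  omega

lemma emult_contract_right {u : V} (hy : y ∈ Y) (hu : u ∉ Y) :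
    emult (contract G Y y) u y = ∑ c ∈ Y, emult G u c := by
  have huy : u ≠ y := fun h => hu (h ▸ hy)
  have h1 := dcut_pair (contract G Y y) huy
  have h2 := dcut_insert G hu
  rw [dcut_contract_of_mem (by simp), dcut_contract_of_mem (by simp),
    dcut_contract_of_disjoint hy (by simp [hu])] at h1
  have e1 : ({u, y} : Finset V) ∪ Y = insert u Y := by
    ext v; simp only [Finset.mem_union, Finset.mem_insert, Finset.mem_singleton]
    constructor
    · rintro ((h | rfl) | h) <;> tauto
    · tauto
  have e2 : ({y} : Finset V) ∪ Y = Y := by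
    simpa using hy
  rw [e1, e2] at h1
  omega

end Contract

/-- A part of size at least three contains no root. -/
def RootFree (x0 x1 : V) (T : Finset V) : Prop := 3 ≤ T.card → x0 ∉ T ∧ x1 ∉ T

/-- `D` is obtained from `C` by adding one vertex, and has cut size three. -/
def ChainStep (G : MG V) (C D : Finset V) : Prop :=
  D ⊆ G.verts ∧ dcut G D = 3 ∧ ∃ v, v ∉ C ∧ D = insert v C

/-- A chain of cuts of size three leading from `X` to `Z`. -/
def Chain (G : MG V) : Finset V → Finset V → Prop := Relation.ReflTransGen (ChainStep G)

/-- `G` has a segmentation of width three both of whose ends are `RootFree`. -/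
def Segmented (G : MG V) (x0 x1 : V) : Prop :=
  ∃ X Z : Finset V, X ⊆ G.verts ∧ dcut G X = 3 ∧ Chain G X Z ∧
    RootFree x0 x1 X ∧ RootFree x0 x1 (G.verts \ Z)

section ChainLemmas

variable {G : MG V} {X Z : Finset V}

lemma Chain.subset_verts (h : Chain G X Z) (hX : X ⊆ G.verts) : Z ⊆ G.verts := by
  induction h with
  | refl => exact hX
  | tail _ h _ => exact h.1

lemma Chain.dcut_eq (h : Chain G X Z) (hX : dcut G X = 3) : dcut G Z = 3 := by
  induction h with
  | refl => exact hX
  | tail _ h _ => exact h.2.1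

lemma Chain.subset (h : Chain G X Z) : X ⊆ Z := by
  induction h with
  | refl => exact subset_rfl
  | tail _ h ih =>
    obtain ⟨-, -, v, -, rfl⟩ := h
    exact ih.trans (Finset.subset_insert _ _)

lemma Chain.compl (h : Chain G X Z) (hd : dcut G X = 3) :
    Chain G (G.verts \ Z) (G.verts \ X) := by
  induction h with
  | refl => exact Relation.ReflTransGen.refl
  | @tail C D hC h ih =>
    refine Relation.ReflTransGen.head ?_ ih
    obtain ⟨hD, -, v, hv, rfl⟩ := h
    refine ⟨Finset.sdiff_subset, ?_, v, by simp, ?_⟩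
    · rw [dcut_compl]
      exact Chain.dcut_eq hC hd
    · ext w
      have := @hD v (Finset.mem_insert_self _ _)
      simp only [Finset.mem_sdiff, Finset.mem_insert]
      by_cases hw : w = v
      · subst hw; tauto
      · tauto

/-- Vertices of degree three are never added along a chain. -/
lemma Chain.mem_iff (h : Chain G X Z) (hX : dcut G X = 3) {y : V} (hy : dcut G {y} = 3) :
    y ∈ Z ↔ y ∈ X := by
  induction h with
  | refl => rfl
  | @tail C D hC h ih =>
    obtain ⟨-, hd, v, hv, rfl⟩ := h
    have h1 := dcut_insert G hv
    have h2 := Chain.dcut_eq hC hX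
    have hne : y ≠ v := by
      rintro rfl
      omega
    rw [Finset.mem_insert, ih]
    tauto

lemma Segmented.exists_hasSegmentation {x0 x1 : V} (h : Segmented G x0 x1) :
    ∃ X0 X1 : Finset V, HasSegmentation G X0 X1 3 ∧
      (3 ≤ X0.card → x0 ∉ X0 ∧ x1 ∉ X0) ∧ (3 ≤ X1.card → x0 ∉ X1 ∧ x1 ∉ X1) := by
  obtain ⟨X, Z, hX, hd, hc, h0, h1⟩ := h
  refine ⟨X, G.verts \ Z, ?_, h0, h1⟩
  suffices h : ∃ (n : ℕ) (f : ℕ → Finset V), f 0 = X ∧ f n = Z ∧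
      (∀ i ≤ n, f i ⊆ G.verts ∧ dcut G (f i) = 3) ∧
      ∀ i < n, ∃ v, v ∉ f i ∧ f (i + 1) = insert v (f i) by
    obtain ⟨n, f, hf0, hfn, hf, hs⟩ := h
    refine ⟨n, fun i => f i, ⟨fun i => (hf i (by omega)).1, fun i => ?_,
      fun i => (hf i (by omega)).2⟩, hf0, by rw [← hfn]; rfl⟩
    obtain ⟨v, hv, he⟩ := hs i i.2
    simp only [Fin.val_succ, Fin.val_castSucc, he]
    refine ⟨Finset.subset_insert _ _, ?_⟩
    rw [Finset.card_eq_one]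
    refine ⟨v, ?_⟩
    ext w
    simp only [Finset.mem_sdiff, Finset.mem_insert, Finset.mem_singleton]
    constructor
    · tauto
    · rintro rfl
      tauto
  clear h1
  induction hc with
  | refl =>
    exact ⟨0, fun _ => X, rfl, rfl, fun i _ => ⟨hX, hd⟩, fun i hi => absurd hi (by omega)⟩
  | @tail C D hC h ih =>
    obtain ⟨n, f, hf0, hfn, hf, hs⟩ := ih
    obtain ⟨hD, hdD, v, hv, rfl⟩ := h
    refine ⟨n + 1, fun i => if i ≤ n then f i else insert v C, by simp [hf0], by simp, ?_, ?_⟩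
    · intro i hi
      by_cases h : i ≤ n
      · simpa [h] using hf i h
      · simp [h, hD, hdD]
    · intro i hi
      by_cases h : i + 1 ≤ n
      · have h' : i ≤ n := by omega
        simpa [h, h'] using hs i (by omega)
      · obtain rfl : i = n := by omega
        refine ⟨v, ?_⟩
        simp [hfn, hv]

lemma HasSegmentation.exists_chain {X0 X1 : Finset V} (h : HasSegmentation G X0 X1 3) :
    ∃ Z, X0 ⊆ G.verts ∧ dcut G X0 = 3 ∧ Chain G X0 Z ∧ G.verts \ Z = X1 := by
  obtain ⟨n, C, ⟨h1, h2, h3⟩, rfl, h5⟩ := h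
  refine ⟨C (Fin.last n), h1 0, h3 0, ?_, h5⟩
  have : ∀ i, Chain G (C 0) (C i) := by
    intro i
    induction i using Fin.induction with
    | zero => exact Relation.ReflTransGen.refl
    | succ i ih =>
      refine Relation.ReflTransGen.tail ih ⟨h1 _, h3 _, ?_⟩
      obtain ⟨hs, hc⟩ := h2 i
      obtain ⟨v, hv⟩ := Finset.card_eq_one.1 hc
      have hv' : v ∈ C i.succ \ C i.castSucc := by rw [hv]; simp
      refine ⟨v, (Finset.mem_sdiff.1 hv').2, ?_⟩
      rw [← Finset.sdiff_union_of_subset hs, hv]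
      rfl
  exact this _

end ChainLemmas

end

section

/-- Every edge has multiplicity zero or two and every vertex has degree four. -/
def DoubledRegular (G : MG V) : Prop :=
  (∀ u ∈ G.verts, ∀ v ∈ G.verts, u ≠ v → emult G u v = 0 ∨ emult G u v = 2) ∧
    ∀ v ∈ G.verts, dcut G {v} = 4

/-- One of the possible outcomes of the structure theorem holds. -/
def Resolved (G : MG V) (x0 x1 : V) : Prop :=
  HasRootedDmImmersion G 3 x0 x1 ∨ DoubledRegular G ∨ Segmented G x0 x1

lemma Segmented.exists_notMem {G : MG V} {p q y : V} (h : Segmented G p q)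
    (hd : dcut G {y} = 3) :
    ∃ X Z : Finset V, X ⊆ G.verts ∧ dcut G X = 3 ∧ Chain G X Z ∧
      RootFree p q X ∧ RootFree p q (G.verts \ Z) ∧ y ∉ Z := by
  obtain ⟨X, Z, hX, hdX, hc, h0, h1⟩ := h
  by_cases hyZ : y ∈ Z
  · have hyX := (Chain.mem_iff hc hdX hd).1 hyZ
    refine ⟨G.verts \ Z, G.verts \ X, Finset.sdiff_subset, ?_, Chain.compl hc hdX, h1, ?_, ?_⟩
    · rw [dcut_compl]; exact Chain.dcut_eq hc hdX
    · rwa [Finset.sdiff_sdiff_eq_self hX]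
    · simp [hyX]
  · exact ⟨X, Z, hX, hdX, hc, h0, h1, hyZ⟩

section

variable {G : MG V} {Y : Finset V} {y : V}

lemma disjoint_of_subset_contract_verts {X : Finset V} (hy : y ∈ Y) (hY : Y ⊆ G.verts)
    (hX : X ⊆ (contract G Y y).verts) (hyX : y ∉ X) : Disjoint X Y := by
  rw [Finset.disjoint_left]
  intro v hv hvY
  rcases (mem_contract_verts hy hY).1 (hX hv) with rfl | ⟨hv1, hv2⟩
  · exact hyX hv
  · exact hv2 hvY

lemma Chain.of_contract {X Z : Finset V} (hy : y ∈ Y) (hY : Y ⊆ G.verts)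
    (h : Chain (contract G Y y) X Z) (hyZ : y ∉ Z) : Chain G X Z := by
  induction h with
  | refl => exact Relation.ReflTransGen.refl
  | @tail C D hC h ih =>
    obtain ⟨hD, hd, v, hv, rfl⟩ := h
    refine Relation.ReflTransGen.tail (ih fun h => hyZ (Finset.mem_insert_of_mem h)) ?_
    refine ⟨hD.trans (contract_verts_subset hy hY), ?_, v, hv, rfl⟩
    rwa [dcut_contract_of_disjoint hy (disjoint_of_subset_contract_verts hy hY hD hyZ)] at hd

lemma Segmented.of_contract (hy : y ∈ Y) (hY : Y ⊆ G.verts) (hd : dcut G Y = 3) {p q : V}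
    (h : Segmented (contract G Y y) p q) :
    ∃ A Z : Finset V, A ⊆ G.verts \ Y ∧ dcut G A = 3 ∧ Chain G A Z ∧ RootFree p q A ∧
      (Z = G.verts \ Y ∨ (Z ⊆ G.verts \ Y ∧ y ≠ p ∧ y ≠ q ∧
        ∀ v ∈ (G.verts \ Y) \ Z, v ≠ p ∧ v ≠ q)) := by
  have hyd : dcut (contract G Y y) {y} = 3 := by
    rw [dcut_contract_of_mem (by simp)]
    rwa [Finset.union_eq_right.2 (by simpa using hy)]
  obtain ⟨A, Z, hA, hdA, hc, h0, h1, hyZ⟩ := h.exists_notMem hyd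
  have hZ : Z ⊆ (contract G Y y).verts := Chain.subset_verts hc hA
  have hyA : y ∉ A := fun h => hyZ (Chain.subset hc h)
  have hsub : ∀ X ⊆ (contract G Y y).verts, y ∉ X → X ⊆ G.verts \ Y := by
    intro X hX hyX v hv
    have := Finset.disjoint_left.1 (disjoint_of_subset_contract_verts hy hY hX hyX) hv
    exact Finset.mem_sdiff.2 ⟨contract_verts_subset hy hY (hX hv), this⟩
  have hcG := Chain.of_contract hy hY hc hyZ
  have hdAG : dcut G A = 3 := by
    rwa [dcut_contract_of_disjoint hy (disjoint_of_subset_contract_verts hy hY hA hyA)] at hdA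
  have hyR : y ∈ (contract G Y y).verts \ Z :=
    Finset.mem_sdiff.2 ⟨(mem_contract_verts hy hY).2 (Or.inl rfl), hyZ⟩
  have hR : (contract G Y y).verts \ Z = insert y ((G.verts \ Y) \ Z) := by
    ext v
    simp only [Finset.mem_sdiff, mem_contract_verts hy hY, Finset.mem_insert]
    constructor
    · tauto
    · rintro (rfl | h) <;> tauto
  have hynot : y ∉ (G.verts \ Y) \ Z := by simp [hy]
  by_cases hcard : 3 ≤ ((contract G Y y).verts \ Z).card
  · refine ⟨A, Z, hsub A hA hyA, hdAG, hcG, h0, Or.inr ⟨hsub Z hZ hyZ, ?_⟩⟩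
    obtain ⟨hp, hq⟩ := h1 hcard
    rw [hR] at hp hq
    simp only [Finset.mem_insert, not_or] at hp hq
    refine ⟨fun h => hp.1 h.symm, fun h => hq.1 h.symm, fun v hv => ⟨?_, ?_⟩⟩
    · rintro rfl; exact hp.2 hv
    · rintro rfl; exact hq.2 hv
  · rw [hR, Finset.card_insert_of_notMem hynot] at hcard
    rcases Nat.lt_or_ge ((G.verts \ Y) \ Z).card 1 with h | h
    · have : (G.verts \ Y) \ Z = ∅ := by
        rw [← Finset.card_eq_zero]; omega
      refine ⟨A, Z, hsub A hA hyA, hdAG, hcG, h0, Or.inl ?_⟩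
      exact Finset.Subset.antisymm (hsub Z hZ hyZ) (Finset.sdiff_eq_empty_iff_subset.1 this)
    · obtain ⟨r, hr⟩ := Finset.card_eq_one.1 (show ((G.verts \ Y) \ Z).card = 1 by omega)
      refine ⟨A, G.verts \ Y, hsub A hA hyA, hdAG, Relation.ReflTransGen.tail hcG ?_, h0,
        Or.inl rfl⟩
      have hr' : r ∈ (G.verts \ Y) \ Z := by rw [hr]; simp
      refine ⟨Finset.sdiff_subset, by rwa [dcut_compl], r, (Finset.mem_sdiff.1 hr').2, ?_⟩
      rw [← Finset.sdiff_union_of_subset (hsub Z hZ hyZ), hr]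
      rfl

end

/-- All smaller `3`-edge-connected graphs with at least four vertices are resolved. -/
def SmallerResolved (G : MG V) : Prop :=
  ∀ (H : MG V) (x0 x1 : V), H.verts.card + H.edges.card < G.verts.card + G.edges.card →
    EdgeConn H 3 → 4 ≤ H.verts.card → x0 ∈ H.verts → x1 ∈ H.verts → x0 ≠ x1 →
    Resolved H x0 x1

/-- One side of a cut of size three with at least two vertices on both sides. -/
lemma exists_chain_of_threeCut {G : MG V} {p q y : V} {Y : Finset V} (ih : SmallerResolved G)
    (h3 : EdgeConn G 3) (hY : Y ⊆ G.verts) (hd : dcut G Y = 3) (hy : y ∈ Y)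
    (hYc : 2 ≤ Y.card) (hX : 3 ≤ (G.verts \ Y).card) (hp : p ∈ G.verts) (hq : q ∈ G.verts)
    (hp' : p ∈ Y → p = y) (hq' : q ∈ Y → q = y) (hpq : p ≠ q)
    (hno : ¬ HasRootedDmImmersion G 3 p q) :
    ∃ A Z : Finset V, A ⊆ G.verts \ Y ∧ dcut G A = 3 ∧ Chain G A Z ∧ RootFree p q A ∧
      (Z = G.verts \ Y ∨ (Z ⊆ G.verts \ Y ∧ y ≠ p ∧ y ≠ q ∧
        ∀ v ∈ (G.verts \ Y) \ Z, v ≠ p ∧ v ≠ q)) := by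
  have hc := card_contract_verts hy hY
  have hsd := Finset.card_sdiff_of_subset hY
  have hmem : ∀ r ∈ G.verts, (r ∈ Y → r = y) → r ∈ (contract G Y y).verts := by
    intro r hr hr'
    rw [mem_contract_verts hy hY]
    tauto
  have hYne : Y ≠ G.verts := by
    rintro rfl
    simp at hX
  have hemb : Emb G.edges (contract G Y y).edges := by
    apply emb_contract hy
    intro Z hZ hyZ
    rw [hd]
    refine h3 Z (hZ.trans hY) ⟨y, hyZ⟩ ?_
    rintro rfl
    exact hYne (Finset.Subset.antisymm hY hZ)
  have := ih (contract G Y y) p q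
    (by have := card_contract_edges_le (G := G) (Y := Y) (y := y); omega)
    (h3.contract hy hY) (by omega) (hmem p hp hp') (hmem q hq hq') hpq
  rcases this with h | h | h
  · exact absurd (h.of_emb (contract_verts_subset hy hY) hemb) hno
  · have h4 := h.2 y ((mem_contract_verts hy hY).2 (Or.inl rfl))
    rw [dcut_contract_of_mem (by simp), Finset.union_eq_right.2 (by simpa using hy), hd] at h4
    omega
  · exact h.of_contract hy hY hd

lemma RootFree.of_card_le {p q : V} {T : Finset V} (h : T.card ≤ 2) : RootFree p q T := by
  intro h'
  omega

lemma resolved_of_threeCut_of_mem {G : MG V} {x0 x1 : V} {X : Finset V} (ih : SmallerResolved G)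
    (h3 : EdgeConn G 3) (hX : X ⊆ G.verts) (hd : dcut G X = 3) (hXc : 2 ≤ X.card)
    (hYc : 2 ≤ (G.verts \ X).card) (hx0 : x0 ∈ X) (hx1 : x1 ∈ X) (hne : x0 ≠ x1) :
    Resolved G x0 x1 := by
  by_cases hno : HasRootedDmImmersion G 3 x0 x1
  · exact Or.inl hno
  refine Or.inr (Or.inr ?_)
  rcases Nat.lt_or_ge X.card 3 with h | h
  · refine ⟨X, X, hX, hd, Relation.ReflTransGen.refl, RootFree.of_card_le (by omega), ?_⟩
    intro _
    simp [hx0, hx1]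
  · obtain ⟨y, hy⟩ := Finset.card_pos.1 (show 0 < (G.verts \ X).card by omega)
    have hXX : G.verts \ (G.verts \ X) = X := Finset.sdiff_sdiff_eq_self hX
    have := exists_chain_of_threeCut (p := x0) (q := x1) ih h3 Finset.sdiff_subset
      (by rwa [dcut_compl]) hy hYc (by rwa [hXX]) (hX hx0) (hX hx1)
      (by simp [hx0]) (by simp [hx1]) hne hno
    rw [hXX] at this
    obtain ⟨A, Z, hA, hdA, hc, hf, hZ⟩ := this
    refine ⟨A, Z, hA.trans hX, hdA, hc, hf, ?_⟩
    intro _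
    rcases hZ with rfl | ⟨hZ, -, -, hr⟩
    · simp [hx0, hx1]
    · constructor
      · intro h
        exact (hr x0 (Finset.mem_sdiff.2 ⟨hx0, (Finset.mem_sdiff.1 h).2⟩)).1 rfl
      · intro h
        exact (hr x1 (Finset.mem_sdiff.2 ⟨hx1, (Finset.mem_sdiff.1 h).2⟩)).2 rfl

/-- A chain ending at a side of a `3`-cut separating the roots. -/
lemma exists_chain_to_side {G : MG V} {p q y : V} {Y : Finset V} (ih : SmallerResolved G)
    (h3 : EdgeConn G 3) (hY : Y ⊆ G.verts) (hd : dcut G Y = 3) (hy : y ∈ Y)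
    (hYc : 2 ≤ Y.card) (hp : p ∈ G.verts) (hq : q ∈ G.verts)
    (hp' : p ∈ Y → p = y) (hq' : q ∈ Y → q = y) (hpq : p ≠ q) (hyr : y = p ∨ y = q)
    (hno : ¬ HasRootedDmImmersion G 3 p q) :
    ∃ A : Finset V, A ⊆ G.verts \ Y ∧ dcut G A = 3 ∧ Chain G A (G.verts \ Y) ∧
      RootFree p q A := by
  rcases Nat.lt_or_ge (G.verts \ Y).card 3 with h | h
  · exact ⟨G.verts \ Y, subset_rfl, by rwa [dcut_compl], Relation.ReflTransGen.refl,
      RootFree.of_card_le (by omega)⟩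
  · obtain ⟨A, Z, hA, hdA, hc, hf, hZ⟩ :=
      exists_chain_of_threeCut ih h3 hY hd hy hYc h hp hq hp' hq' hpq hno
    rcases hZ with rfl | ⟨-, h1, h2, -⟩
    · exact ⟨A, hA, hdA, hc, hf⟩
    · tauto

lemma resolved_of_threeCut_separating {G : MG V} {x0 x1 : V} {X : Finset V}
    (ih : SmallerResolved G) (h3 : EdgeConn G 3) (hX : X ⊆ G.verts) (hd : dcut G X = 3)
    (hXc : 2 ≤ X.card) (hYc : 2 ≤ (G.verts \ X).card) (hx0 : x0 ∈ X) (hx1 : x1 ∈ G.verts \ X) :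
    Resolved G x0 x1 := by
  by_cases hno : HasRootedDmImmersion G 3 x0 x1
  · exact Or.inl hno
  refine Or.inr (Or.inr ?_)
  have hXX : G.verts \ (G.verts \ X) = X := Finset.sdiff_sdiff_eq_self hX
  have hx1' := Finset.mem_sdiff.1 hx1
  have hne : x0 ≠ x1 := by
    rintro rfl
    exact hx1'.2 hx0
  obtain ⟨A, hA, hdA, hcA, hfA⟩ := exists_chain_to_side (p := x0) (q := x1) ih h3
    Finset.sdiff_subset (by rwa [dcut_compl]) hx1 hYc (hX hx0) hx1'.1
    (by simp [hx0]) (fun _ => rfl) hne (Or.inr rfl) hno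
  obtain ⟨B, hB, hdB, hcB, hfB⟩ := exists_chain_to_side (p := x0) (q := x1) ih h3
    hX hd hx0 hXc (hX hx0) hx1'.1 (fun _ => rfl) (fun h => absurd h hx1'.2) hne (Or.inl rfl) hno
  rw [hXX] at hcA hA
  have hcB' := Chain.compl hcB hdB
  rw [hXX] at hcB'
  refine ⟨A, G.verts \ B, hA.trans hX, hdA, hcA.trans hcB', hfA, ?_⟩
  rwa [Finset.sdiff_sdiff_eq_self (hB.trans Finset.sdiff_subset)]

/-- A graph with a `3`-cut having two vertices on both sides is resolved. -/
lemma resolved_of_threeCut {G : MG V} {x0 x1 : V} {X : Finset V}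
    (ih : SmallerResolved G) (h3 : EdgeConn G 3) (hX : X ⊆ G.verts) (hd : dcut G X = 3)
    (hXc : 2 ≤ X.card) (hYc : 2 ≤ (G.verts \ X).card) (hx0 : x0 ∈ G.verts) (hx1 : x1 ∈ G.verts)
    (hne : x0 ≠ x1) : Resolved G x0 x1 := by
  have hXX : G.verts \ (G.verts \ X) = X := Finset.sdiff_sdiff_eq_self hX
  have hX' : G.verts \ X ⊆ G.verts := Finset.sdiff_subset
  have hd' : dcut G (G.verts \ X) = 3 := by rwa [dcut_compl]
  by_cases h0 : x0 ∈ X <;> by_cases h1 : x1 ∈ X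
  · exact resolved_of_threeCut_of_mem ih h3 hX hd hXc hYc h0 h1 hne
  · exact resolved_of_threeCut_separating ih h3 hX hd hXc hYc h0
      (Finset.mem_sdiff.2 ⟨hx1, h1⟩)
  · exact resolved_of_threeCut_separating ih h3 hX' hd' hYc (by rwa [hXX])
      (Finset.mem_sdiff.2 ⟨hx0, h0⟩) (by rwa [hXX])
  · exact resolved_of_threeCut_of_mem ih h3 hX' hd' hYc (by rwa [hXX])
      (Finset.mem_sdiff.2 ⟨hx0, h0⟩) (Finset.mem_sdiff.2 ⟨hx1, h1⟩) hne

end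

section

/-- Multiplicity vectors (in the order `pq, pr, ps, qr, qs, rs`) of graphs on four vertices
`p, q, r, s` which can be turned into `K₄` by splittings and deletions. -/
inductive Routable : ℕ → ℕ → ℕ → ℕ → ℕ → ℕ → Prop
  | base {a b c d e f : ℕ} (ha : 1 ≤ a) (hb : 1 ≤ b) (hc : 1 ≤ c) (hd : 1 ≤ d) (he : 1 ≤ e)
      (hf : 1 ≤ f) : Routable a b c d e f
  | pqr {a b c d e f : ℕ} : Routable (a + 1) b c d e f → Routable a (b + 1) c (d + 1) e f
  | pqs {a b c d e f : ℕ} : Routable (a + 1) b c d e f → Routable a b (c + 1) d (e + 1) f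
  | prq {a b c d e f : ℕ} : Routable a (b + 1) c d e f → Routable (a + 1) b c (d + 1) e f
  | prs {a b c d e f : ℕ} : Routable a (b + 1) c d e f → Routable a b (c + 1) d e (f + 1)
  | psq {a b c d e f : ℕ} : Routable a b (c + 1) d e f → Routable (a + 1) b c d (e + 1) f
  | psr {a b c d e f : ℕ} : Routable a b (c + 1) d e f → Routable a (b + 1) c d e (f + 1)
  | qrp {a b c d e f : ℕ} : Routable a b c (d + 1) e f → Routable (a + 1) (b + 1) c d e f
  | qrs {a b c d e f : ℕ} : Routable a b c (d + 1) e f → Routable a b c d (e + 1) (f + 1)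
  | qsp {a b c d e f : ℕ} : Routable a b c d (e + 1) f → Routable (a + 1) b (c + 1) d e f
  | qsr {a b c d e f : ℕ} : Routable a b c d (e + 1) f → Routable a b c (d + 1) e (f + 1)
  | rsp {a b c d e f : ℕ} : Routable a b c d e (f + 1) → Routable a (b + 1) (c + 1) d e f
  | rsq {a b c d e f : ℕ} : Routable a b c d e (f + 1) → Routable a b c (d + 1) (e + 1) f

namespace Routable

variable {a b c d e f : ℕ}

lemma swap_pq (h : Routable a b c d e f) : Routable a d e b c f := by
  induction h with
  | base ha hb hc hd he hf => exact base ha hd he hb hc hf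
  | pqr _ ih => exact pqr ih
  | pqs _ ih => exact pqs ih
  | prq _ ih => exact qrp ih
  | prs _ ih => exact qrs ih
  | psq _ ih => exact qsp ih
  | psr _ ih => exact qsr ih
  | qrp _ ih => exact prq ih
  | qrs _ ih => exact prs ih
  | qsp _ ih => exact psq ih
  | qsr _ ih => exact psr ih
  | rsp _ ih => exact rsq ih
  | rsq _ ih => exact rsp ih

lemma swap_rs (h : Routable a b c d e f) : Routable a c b e d f := by
  induction h with
  | base ha hb hc hd he hf => exact base ha hc hb he hd hf
  | pqr _ ih => exact pqs ih
  | pqs _ ih => exact pqr ih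
  | prq _ ih => exact psq ih
  | prs _ ih => exact psr ih
  | psq _ ih => exact prq ih
  | psr _ ih => exact prs ih
  | qrp _ ih => exact qsp ih
  | qrs _ ih => exact qsr ih
  | qsp _ ih => exact qrp ih
  | qsr _ ih => exact qrs ih
  | rsp _ ih => exact rsp ih
  | rsq _ ih => exact rsq ih

lemma swap_qr (h : Routable a b c d e f) : Routable b a c d f e := by
  induction h with
  | base ha hb hc hd he hf => exact base hb ha hc hd hf he
  | pqr _ ih => exact prq ih
  | pqs _ ih => exact prs ih
  | prq _ ih => exact pqr ih
  | prs _ ih => exact pqs ih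
  | psq _ ih => exact psr ih
  | psr _ ih => exact psq ih
  | qrp _ ih => exact qrp ih
  | qrs _ ih => exact qrs ih
  | qsp _ ih => exact rsp ih
  | qsr _ ih => exact rsq ih
  | rsp _ ih => exact qsp ih
  | rsq _ ih => exact qsr ih

/-- The edges `pr` and `pq` are missing, but `rs` is present. -/
lemma of_missing_adjacent (hc : 3 ≤ c) (h1 : 3 ≤ d + e) (h2 : 3 ≤ d + f) (h3 : 4 ≤ e + f)
    (hf : 1 ≤ f) : Routable 0 0 c d e f := by
  obtain ⟨c, rfl⟩ := Nat.exists_eq_add_of_le' hc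
  by_cases hd : d = 0
  · subst hd
    obtain ⟨e, rfl⟩ := Nat.exists_eq_add_of_le' (show 3 ≤ e by omega)
    obtain ⟨f, rfl⟩ := Nat.exists_eq_add_of_le' (show 3 ≤ f by omega)
    apply prs; apply pqs; apply qrs
    apply base <;> omega
  by_cases hf1 : f = 1
  · subst hf1
    obtain ⟨e, rfl⟩ := Nat.exists_eq_add_of_le' (show 3 ≤ e by omega)
    obtain ⟨d, rfl⟩ := Nat.exists_eq_add_of_le' (show 2 ≤ d by omega)
    apply pqs; apply pqs; apply prq
    apply base <;> omega
  obtain ⟨f, rfl⟩ := Nat.exists_eq_add_of_le' (show 2 ≤ f by omega)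
  by_cases he : 2 ≤ e
  · obtain ⟨e, rfl⟩ := Nat.exists_eq_add_of_le' he
    apply prs; apply pqs
    apply base <;> omega
  by_cases he0 : e = 0
  · subst he0
    obtain ⟨f, rfl⟩ := Nat.exists_eq_add_of_le' (show 2 ≤ f by omega)
    obtain ⟨d, rfl⟩ := Nat.exists_eq_add_of_le' (show 3 ≤ d by omega)
    apply prs; apply prs; apply qsr; apply pqr
    apply base <;> omega
  · obtain ⟨d, rfl⟩ := Nat.exists_eq_add_of_le' (show 2 ≤ d by omega)
    apply prs; apply prs; apply pqr
    apply base <;> omega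

/-- The edge `pq` is missing, `pr` has multiplicity one and `rs` is present. -/
lemma of_missing_single (hc : 2 ≤ c) (hd : 2 ≤ d) (he : e = 1) (hf : 2 ≤ f) :
    Routable 0 1 c d e f := by
  obtain ⟨c, rfl⟩ := Nat.exists_eq_add_of_le' hc
  obtain ⟨d, rfl⟩ := Nat.exists_eq_add_of_le' hd
  obtain ⟨f, rfl⟩ := Nat.exists_eq_add_of_le' hf
  subst he
  apply prs; apply pqr
  apply base <;> omega

lemma of_missing_of_pos (hp : 3 ≤ b + c) (hq : 3 ≤ d + e) (hr : 3 ≤ b + d + f)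
    (hs : 3 ≤ c + e + f) (h1 : 4 ≤ c + d + f) (h2 : 4 ≤ b + e + f) (hf : 1 ≤ f) :
    Routable 0 b c d e f := by
  by_cases hb0 : b = 0
  · subst hb0
    exact of_missing_adjacent (by omega) hq (by omega) (by omega) hf
  by_cases hc0 : c = 0
  · subst hc0
    exact (of_missing_adjacent (by omega) (by omega) (by omega) (by omega) hf).swap_rs
  by_cases hd0 : d = 0
  · subst hd0
    exact (of_missing_adjacent (by omega) (by omega) (by omega) (by omega) hf).swap_pq
  by_cases he0 : e = 0
  · subst he0
    exact (of_missing_adjacent (by omega) (by omega) (by omega) (by omega) hf).swap_rs.swap_pq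
  by_cases hbd : 2 ≤ b ∧ 2 ≤ d
  · obtain ⟨b, rfl⟩ := Nat.exists_eq_add_of_le' hbd.1
    obtain ⟨d, rfl⟩ := Nat.exists_eq_add_of_le' hbd.2
    apply pqr
    apply base <;> omega
  by_cases hce : 2 ≤ c ∧ 2 ≤ e
  · obtain ⟨c, rfl⟩ := Nat.exists_eq_add_of_le' hce.1
    obtain ⟨e, rfl⟩ := Nat.exists_eq_add_of_le' hce.2
    apply pqs
    apply base <;> omega
  by_cases hb1 : b = 1
  · subst hb1
    exact of_missing_single (by omega) (by omega) (by omega) (by omega)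
  · obtain rfl : d = 1 := by omega
    exact (of_missing_single (by omega) (by omega) (by omega) (by omega)).swap_pq

/-- The edges `pq` and `rs` are missing, and `pr` has multiplicity at most one. -/
lemma of_opposite_missing (hb : b ≤ 1) (hp : 3 ≤ b + c) (hr : 3 ≤ b + d) (h2 : 4 ≤ b + e) :
    Routable 0 b c d e 0 := by
  rcases Nat.le_one_iff_eq_zero_or_eq_one.1 hb with rfl | rfl
  · obtain ⟨c, rfl⟩ := Nat.exists_eq_add_of_le' (show 3 ≤ c by omega)
    obtain ⟨d, rfl⟩ := Nat.exists_eq_add_of_le' (show 3 ≤ d by omega)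
    obtain ⟨e, rfl⟩ := Nat.exists_eq_add_of_le' (show 4 ≤ e by omega)
    apply pqs; apply pqs; apply prq; apply rsq
    apply base <;> omega
  · obtain ⟨c, rfl⟩ := Nat.exists_eq_add_of_le' (show 2 ≤ c by omega)
    obtain ⟨d, rfl⟩ := Nat.exists_eq_add_of_le' (show 2 ≤ d by omega)
    obtain ⟨e, rfl⟩ := Nat.exists_eq_add_of_le' (show 3 ≤ e by omega)
    apply pqs; apply rsq
    apply base <;> omega

/-- The edges `pq` and `rs` are missing, and `pr` has multiplicity at least three. -/
lemma of_opposite_missing' (hb : 3 ≤ b) (hc : 2 ≤ c) (hd : 2 ≤ d) (he : 2 ≤ e) :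
    Routable 0 b c d e 0 := by
  obtain ⟨b, rfl⟩ := Nat.exists_eq_add_of_le' hb
  obtain ⟨c, rfl⟩ := Nat.exists_eq_add_of_le' hc
  obtain ⟨d, rfl⟩ := Nat.exists_eq_add_of_le' hd
  apply pqr; apply rsp
  apply base <;> omega

lemma of_missing (hp : 3 ≤ b + c) (hq : 3 ≤ d + e) (hr : 3 ≤ b + d + f)
    (hs : 3 ≤ c + e + f) (h1 : 4 ≤ c + d + f) (h2 : 4 ≤ b + e + f) :
    Routable 0 b c d e f ∨ (b = 2 ∧ c = 2 ∧ d = 2 ∧ e = 2 ∧ f = 0) := by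
  by_cases hf : 1 ≤ f
  · exact Or.inl (of_missing_of_pos hp hq hr hs h1 h2 hf)
  obtain rfl : f = 0 := by omega
  by_cases hb : b ≤ 1
  · exact Or.inl (of_opposite_missing hb (by omega) (by omega) (by omega))
  by_cases hc : c ≤ 1
  · exact Or.inl (of_opposite_missing hc (by omega) (by omega) (by omega)).swap_rs
  by_cases hd : d ≤ 1
  · exact Or.inl (of_opposite_missing hd (by omega) (by omega) (by omega)).swap_pq
  by_cases he : e ≤ 1
  · exact Or.inl (of_opposite_missing he (by omega) (by omega) (by omega)).swap_rs.swap_pq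
  by_cases hb : 3 ≤ b
  · exact Or.inl (of_opposite_missing' hb (by omega) (by omega) (by omega))
  by_cases hc : 3 ≤ c
  · exact Or.inl (of_opposite_missing' hc (by omega) (by omega) (by omega)).swap_rs
  by_cases hd : 3 ≤ d
  · exact Or.inl (of_opposite_missing' hd (by omega) (by omega) (by omega)).swap_pq
  by_cases he : 3 ≤ e
  · exact Or.inl (of_opposite_missing' he (by omega) (by omega) (by omega)).swap_rs.swap_pq
  omega

lemma of_cuts (hp : 3 ≤ a + b + c) (hq : 3 ≤ a + d + e) (hr : 3 ≤ b + d + f)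
    (hs : 3 ≤ c + e + f) (h0 : 4 ≤ b + c + d + e) (h1 : 4 ≤ a + c + d + f)
    (h2 : 4 ≤ a + b + e + f) :
    Routable a b c d e f ∨ (a = f ∧ b = e ∧ c = d ∧ a + b + c = 4 ∧ (a = 0 ∨ a = 2) ∧
      (b = 0 ∨ b = 2) ∧ (c = 0 ∨ c = 2)) := by
  by_cases ha : a = 0
  · subst ha
    rcases of_missing (b := b) (c := c) (d := d) (e := e) (f := f) (by omega) (by omega)
      (by omega) (by omega) (by omega) (by omega) with h | h
    · exact Or.inl h
    · omega
  by_cases hb : b = 0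
  · subst hb
    rcases of_missing (b := a) (c := c) (d := d) (e := f) (f := e) (by omega) (by omega)
      (by omega) (by omega) (by omega) (by omega) with h | h
    · exact Or.inl h.swap_qr
    · omega
  by_cases hc : c = 0
  · subst hc
    rcases of_missing (b := a) (c := b) (d := e) (e := f) (f := d) (by omega) (by omega)
      (by omega) (by omega) (by omega) (by omega) with h | h
    · exact Or.inl h.swap_qr.swap_rs
    · omega
  by_cases hd : d = 0
  · subst hd
    rcases of_missing (b := a) (c := e) (d := b) (e := f) (f := c) (by omega) (by omega)
      (by omega) (by omega) (by omega) (by omega) with h | h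
    · exact Or.inl h.swap_qr.swap_pq
    · omega
  by_cases he : e = 0
  · subst he
    rcases of_missing (b := a) (c := d) (d := c) (e := f) (f := b) (by omega) (by omega)
      (by omega) (by omega) (by omega) (by omega) with h | h
    · exact Or.inl h.swap_qr.swap_rs.swap_pq
    · omega
  by_cases hf : f = 0
  · subst hf
    rcases of_missing (b := b) (c := d) (d := c) (e := e) (f := a) (by omega) (by omega)
      (by omega) (by omega) (by omega) (by omega) with h | h
    · exact Or.inl h.swap_qr.swap_rs.swap_pq.swap_qr
    · omega
  exact Or.inl (base (by omega) (by omega) (by omega) (by omega) (by omega) (by omega))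

end Routable

/-- The edge multiset on `p, q, r, s` with the given multiplicities. -/
def fourEdges (p q r s : V) (a b c d e f : ℕ) : Multiset (Sym2 V) :=
  Multiset.replicate a s(p, q) + Multiset.replicate b s(p, r) + Multiset.replicate c s(p, s) +
    Multiset.replicate d s(q, r) + Multiset.replicate e s(q, s) + Multiset.replicate f s(r, s)

lemma Emb.split_of_eq {E F : Multiset (Sym2 V)} (x y z : V) (R : Multiset (Sym2 V))
    (hE : E = {s(x, y)} + {s(y, z)} + R) (hF : F = {s(x, z)} + R) : Emb E F := by
  subst hE hF
  rw [add_assoc, Multiset.singleton_add, Multiset.singleton_add, Multiset.singleton_add]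
  exact Emb.split x y z R

lemma replicate_succ_eq (n : ℕ) (e : Sym2 V) :
    Multiset.replicate (n + 1) e = {e} + Multiset.replicate n e := by
  rw [Multiset.replicate_succ, Multiset.singleton_add]

lemma Routable.emb {a b c d e f : ℕ} (h : Routable a b c d e f) (p q r s : V) :
    Emb (fourEdges p q r s a b c d e f) (fourEdges p q r s 1 1 1 1 1 1) := by
  have hqp : s(q, p) = s(p, q) := Sym2.eq_swap
  have hrp : s(r, p) = s(p, r) := Sym2.eq_swap
  have hsp : s(s, p) = s(p, s) := Sym2.eq_swap
  have hrq : s(r, q) = s(q, r) := Sym2.eq_swap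
  have hsq : s(s, q) = s(q, s) := Sym2.eq_swap
  have hsr : s(s, r) = s(r, s) := Sym2.eq_swap
  induction h with
  | base ha hb hc hd he hf =>
    apply Emb.of_le
    unfold fourEdges
    gcongr
  | @pqr a b c d e f _ ih =>
    exact (Emb.split_of_eq p r q (fourEdges p q r s a b c d e f)
      (by simp only [fourEdges, replicate_succ_eq, hrq]; abel)
      (by simp only [fourEdges, replicate_succ_eq]; abel)).trans ih
  | @pqs a b c d e f _ ih =>
    exact (Emb.split_of_eq p s q (fourEdges p q r s a b c d e f)
      (by simp only [fourEdges, replicate_succ_eq, hsq]; abel)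
      (by simp only [fourEdges, replicate_succ_eq]; abel)).trans ih
  | @prq a b c d e f _ ih =>
    exact (Emb.split_of_eq p q r (fourEdges p q r s a b c d e f)
      (by simp only [fourEdges, replicate_succ_eq]; abel)
      (by simp only [fourEdges, replicate_succ_eq]; abel)).trans ih
  | @prs a b c d e f _ ih =>
    exact (Emb.split_of_eq p s r (fourEdges p q r s a b c d e f)
      (by simp only [fourEdges, replicate_succ_eq, hsr]; abel)
      (by simp only [fourEdges, replicate_succ_eq]; abel)).trans ih
  | @psq a b c d e f _ ih =>
    exact (Emb.split_of_eq p q s (fourEdges p q r s a b c d e f)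
      (by simp only [fourEdges, replicate_succ_eq]; abel)
      (by simp only [fourEdges, replicate_succ_eq]; abel)).trans ih
  | @psr a b c d e f _ ih =>
    exact (Emb.split_of_eq p r s (fourEdges p q r s a b c d e f)
      (by simp only [fourEdges, replicate_succ_eq]; abel)
      (by simp only [fourEdges, replicate_succ_eq]; abel)).trans ih
  | @qrp a b c d e f _ ih =>
    exact (Emb.split_of_eq q p r (fourEdges p q r s a b c d e f)
      (by simp only [fourEdges, replicate_succ_eq, hqp]; abel)
      (by simp only [fourEdges, replicate_succ_eq]; abel)).trans ih
  | @qrs a b c d e f _ ih =>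
    exact (Emb.split_of_eq q s r (fourEdges p q r s a b c d e f)
      (by simp only [fourEdges, replicate_succ_eq, hsr]; abel)
      (by simp only [fourEdges, replicate_succ_eq]; abel)).trans ih
  | @qsp a b c d e f _ ih =>
    exact (Emb.split_of_eq q p s (fourEdges p q r s a b c d e f)
      (by simp only [fourEdges, replicate_succ_eq, hqp]; abel)
      (by simp only [fourEdges, replicate_succ_eq]; abel)).trans ih
  | @qsr a b c d e f _ ih =>
    exact (Emb.split_of_eq q r s (fourEdges p q r s a b c d e f)
      (by simp only [fourEdges, replicate_succ_eq]; abel)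
      (by simp only [fourEdges, replicate_succ_eq]; abel)).trans ih
  | @rsp a b c d e f _ ih =>
    exact (Emb.split_of_eq r p s (fourEdges p q r s a b c d e f)
      (by simp only [fourEdges, replicate_succ_eq, hrp]; abel)
      (by simp only [fourEdges, replicate_succ_eq]; abel)).trans ih
  | @rsq a b c d e f _ ih =>
    exact (Emb.split_of_eq r q s (fourEdges p q r s a b c d e f)
      (by simp only [fourEdges, replicate_succ_eq, hrq]; abel)
      (by simp only [fourEdges, replicate_succ_eq]; abel)).trans ih

lemma routes_fourEdges (φ : Fin 4 → V) :
    Routes (fourEdges (φ 0) (φ 1) (φ 2) (φ 3) 1 1 1 1 1 1) (dmEdges 3) φ := by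
  refine ⟨{(s(0, 1), [φ 0, φ 1]), (s(0, 2), [φ 0, φ 2]), (s(0, 3), [φ 0, φ 3]),
    (s(1, 2), [φ 1, φ 2]), (s(1, 3), [φ 1, φ 3]), (s(2, 3), [φ 2, φ 3])}, ?_, ?_, ?_⟩
  · rfl
  · intro x hx
    simp only [Multiset.insert_eq_cons, Multiset.mem_cons, Multiset.mem_singleton] at hx
    rcases hx with rfl | rfl | rfl | rfl | rfl | rfl
    · exact ⟨0, 1, rfl, rfl, rfl⟩
    · exact ⟨0, 2, rfl, rfl, rfl⟩
    · exact ⟨0, 3, rfl, rfl, rfl⟩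
    · exact ⟨1, 2, rfl, rfl, rfl⟩
    · exact ⟨1, 3, rfl, rfl, rfl⟩
    · exact ⟨2, 3, rfl, rfl, rfl⟩
  · exact le_of_eq rfl

end

lemma fourEdges_le (G : MG V) {p q r s : V} (hpq : p ≠ q) (hpr : p ≠ r) (hps : p ≠ s)
    (hqr : q ≠ r) (hqs : q ≠ s) (hrs : r ≠ s) :
    fourEdges p q r s (emult G p q) (emult G p r) (emult G p s) (emult G q r) (emult G q s)
      (emult G r s) ≤ G.edges := by
  rw [Multiset.le_iff_count]
  intro e
  unfold fourEdges emult
  simp only [Multiset.count_add, Multiset.count_replicate]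
  by_cases h1 : s(p, q) = e
  · subst h1; simp [*, Ne.symm]
  by_cases h2 : s(p, r) = e
  · subst h2; simp [*, Ne.symm]
  by_cases h3 : s(p, s) = e
  · subst h3; simp [*, Ne.symm]
  by_cases h4 : s(q, r) = e
  · subst h4; simp [*, Ne.symm]
  by_cases h5 : s(q, s) = e
  · subst h5; simp [*, Ne.symm]
  by_cases h6 : s(r, s) = e
  · subst h6; simp [*]
  simp [*]

lemma injective_four {p q r s : V} (hpq : p ≠ q) (hpr : p ≠ r) (hps : p ≠ s)
    (hqr : q ≠ r) (hqs : q ≠ s) (hrs : r ≠ s) : Function.Injective ![p, q, r, s] := by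
  intro i j hij
  fin_cases i <;> fin_cases j <;> simp_all

/-- Four-vertex graphs. -/
lemma immersion_or_doubledRegular_of_card_eq_four {G : MG V} {x0 x1 : V} (h3 : EdgeConn G 3)
    (h4 : InternallyEdgeConn G 4) (hc : G.verts.card = 4) (hx0 : x0 ∈ G.verts)
    (hx1 : x1 ∈ G.verts) (hne : x0 ≠ x1) :
    HasRootedDmImmersion G 3 x0 x1 ∨ DoubledRegular G := by
  have hcard : ((G.verts.erase x0).erase x1).card = 2 := by
    rw [Finset.card_erase_of_mem (by simp [hx1, hne.symm]), Finset.card_erase_of_mem hx0, hc]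
  obtain ⟨r, s, hrs, hrs'⟩ := Finset.card_eq_two.1 hcard
  have hr : r ∈ (G.verts.erase x0).erase x1 := by rw [hrs']; simp
  have hs : s ∈ (G.verts.erase x0).erase x1 := by rw [hrs']; simp
  simp only [Finset.mem_erase] at hr hs
  obtain ⟨hr1, hr0, hrV⟩ := hr
  obtain ⟨hs1, hs0, hsV⟩ := hs
  have hV : G.verts = {x0, x1, r, s} := by
    rw [← hrs', Finset.insert_erase (by simp [hx1, hne.symm]), Finset.insert_erase hx0]
  have sing : ∀ v ∈ G.verts, 3 ≤ dcut G {v} := by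
    intro v hv
    refine h3 {v} (by simpa using hv) (by simp) ?_
    intro h
    rw [← h] at hc
    simp at hc
  have pair : ∀ u ∈ G.verts, ∀ v ∈ G.verts, u ≠ v → 4 ≤ dcut G {u, v} := by
    intro u hu v hv huv
    have hsub : ({u, v} : Finset V) ⊆ G.verts := by
      intro w hw
      simp only [Finset.mem_insert, Finset.mem_singleton] at hw
      rcases hw with rfl | rfl <;> assumption
    apply h4 _ hsub
    · rw [Finset.card_pair huv]
    · rw [Finset.card_sdiff_of_subset hsub, Finset.card_pair huv, hc]
  have d0 : dcut G {x0} = emult G x0 x1 + emult G x0 r + emult G x0 s := by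
    rw [← sum_emult_eq G hx0]
    have : G.verts.erase x0 = {x1, r, s} := by
      rw [hV]; ext w; simp only [Finset.mem_erase, Finset.mem_insert, Finset.mem_singleton]
      constructor
      · tauto
      · rintro (rfl | rfl | rfl) <;> tauto
    rw [this, Finset.sum_insert (by simp [hr1.symm, hs1.symm]), Finset.sum_pair hrs]
    ring
  have d1 : dcut G {x1} = emult G x0 x1 + emult G x1 r + emult G x1 s := by
    rw [← sum_emult_eq G hx1]
    have : G.verts.erase x1 = {x0, r, s} := by
      rw [hV]; ext w; simp only [Finset.mem_erase, Finset.mem_insert, Finset.mem_singleton]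
      constructor
      · tauto
      · rintro (rfl | rfl | rfl) <;> tauto
    rw [this, Finset.sum_insert (by simp [hr0.symm, hs0.symm]), Finset.sum_pair hrs,
      emult_comm G x1 x0]
    ring
  have d2 : dcut G {r} = emult G x0 r + emult G x1 r + emult G r s := by
    rw [← sum_emult_eq G hrV]
    have : G.verts.erase r = {x0, x1, s} := by
      rw [hV]; ext w; simp only [Finset.mem_erase, Finset.mem_insert, Finset.mem_singleton]
      constructor
      · tauto
      · rintro (rfl | rfl | rfl) <;> tauto
    rw [this, Finset.sum_insert (by simp [hne, hs0.symm]), Finset.sum_pair hs1.symm,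
      emult_comm G r x0, emult_comm G r x1]
    ring
  have d3 : dcut G {s} = emult G x0 s + emult G x1 s + emult G r s := by
    rw [← sum_emult_eq G hsV]
    have : G.verts.erase s = {x0, x1, r} := by
      rw [hV]; ext w; simp only [Finset.mem_erase, Finset.mem_insert, Finset.mem_singleton]
      constructor
      · tauto
      · rintro (rfl | rfl | rfl) <;> tauto
    rw [this, Finset.sum_insert (by simp [hne, hr0.symm]), Finset.sum_pair hr1.symm,
      emult_comm G s x0, emult_comm G s x1, emult_comm G s r]
    ring
  have s0 := sing x0 hx0
  have s1 := sing x1 hx1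
  have s2 := sing r hrV
  have s3 := sing s hsV
  have p01 := pair x0 hx0 x1 hx1 hne
  have p02 := pair x0 hx0 r hrV hr0.symm
  have p03 := pair x0 hx0 s hsV hs0.symm
  have e01 := dcut_pair G hne
  have e02 := dcut_pair G hr0.symm
  have e03 := dcut_pair G hs0.symm
  rcases Routable.of_cuts (a := emult G x0 x1) (b := emult G x0 r) (c := emult G x0 s)
    (d := emult G x1 r) (e := emult G x1 s) (f := emult G r s) (by omega) (by omega) (by omega)
    (by omega) (by omega) (by omega) (by omega) with h | h
  · left
    refine ⟨![x0, x1, r, s], rfl, rfl, ?_, ?_, ?_⟩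
    · exact injective_four hne hr0.symm hs0.symm hr1.symm hs1.symm hrs
    · intro i
      fin_cases i <;> assumption
    · exact Routes.of_emb (E := G.edges) ((Emb.of_le (fourEdges_le G hne hr0.symm hs0.symm hr1.symm
        hs1.symm hrs)).trans (h.emb x0 x1 r s)) (routes_fourEdges ![x0, x1, r, s])
  · right
    obtain ⟨h1, h2, h3, h4, h5, h6, h7⟩ := h
    have hmem : ∀ v ∈ G.verts, v = x0 ∨ v = x1 ∨ v = r ∨ v = s := by
      intro v hv
      rw [hV] at hv
      simpa using hv
    constructor
    · intro u hu v hv huv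
      have c10 := emult_comm G x1 x0
      have c20 := emult_comm G r x0
      have c30 := emult_comm G s x0
      have c21 := emult_comm G r x1
      have c31 := emult_comm G s x1
      have c32 := emult_comm G s r
      rcases hmem u hu with rfl | rfl | rfl | rfl <;> rcases hmem v hv with rfl | rfl | rfl | rfl <;>
        first
        | exact absurd rfl huv
        | omega
    · intro v hv
      rcases hmem v hv with rfl | rfl | rfl | rfl <;> omega

/-- In an internally `4`-edge-connected graph a `3`-cut has a side with at most one vertex. -/
lemma InternallyEdgeConn.card_le_one {G : MG V} (h4 : InternallyEdgeConn G 4) {X : Finset V}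
    (hX : X ⊆ G.verts) (hd : dcut G X = 3) : X.card ≤ 1 ∨ (G.verts \ X).card ≤ 1 := by
  by_contra hcon
  push Not at hcon
  have := h4 X hX hcon.1 hcon.2
  omega

lemma InternallyEdgeConn.not_segmented {G : MG V} {x0 x1 : V} (h4 : InternallyEdgeConn G 4)
    (hc : 4 ≤ G.verts.card) (hx0 : x0 ∈ G.verts) (hx1 : x1 ∈ G.verts) (hne : x0 ≠ x1) :
    ¬ Segmented G x0 x1 := by
  rintro ⟨X, Z, hX, hd, hch, h0, h1⟩
  have small : ∀ T ⊆ G.verts, dcut G T = 3 → RootFree x0 x1 T → T.card ≤ 1 := by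
    intro T hT hdT hf
    rcases h4.card_le_one hT hdT with h | h
    · exact h
    · have hs := Finset.card_sdiff_of_subset hT
      obtain ⟨h2, h3⟩ := hf (by omega)
      have : 1 < (G.verts \ T).card := Finset.one_lt_card.2
        ⟨x0, Finset.mem_sdiff.2 ⟨hx0, h2⟩, x1, Finset.mem_sdiff.2 ⟨hx1, h3⟩, hne⟩
      omega
  have hX1 := small X hX hd h0
  have hdZ := Chain.dcut_eq hch hd
  have hZ1 := small _ Finset.sdiff_subset (by rwa [dcut_compl]) h1
  have hZ := Chain.subset_verts hch hX
  rw [Finset.card_sdiff_of_subset hZ] at hZ1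
  have : Z.card ≤ 1 := by
    clear hZ1 hdZ hZ h1
    induction hch with
    | refl => exact hX1
    | tail _ h ih =>
      obtain ⟨hD, hdD, v, hv, rfl⟩ := h
      have hcd := Finset.card_insert_of_notMem hv
      rcases h4.card_le_one hD hdD with h | h
      · exact h
      · rw [Finset.card_sdiff_of_subset hD] at h
        omega
  omega

lemma InternallyEdgeConn.contract {G : MG V} {k : ℕ} {Y : Finset V} {y : V}
    (h : InternallyEdgeConn G k) (hy : y ∈ Y) (hY : Y ⊆ G.verts) :
    InternallyEdgeConn (contract G Y y) k := by
  intro X hX hX1 hX2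
  by_cases hyX : y ∈ X
  · rw [dcut_contract_of_mem hyX]
    refine h _ (Finset.union_subset (hX.trans (contract_verts_subset hy hY)) hY)
      (hX1.trans (Finset.card_le_card Finset.subset_union_left)) (hX2.trans ?_)
    apply Finset.card_le_card
    intro v hv
    rw [Finset.mem_sdiff] at hv ⊢
    rcases (mem_contract_verts hy hY).1 hv.1 with rfl | h
    · exact absurd hyX hv.2
    · exact ⟨h.1, by simp [hv.2, h.2]⟩
  · rw [dcut_contract_of_disjoint hy (disjoint_of_subset_contract_verts hy hY hX hyX)]
    exact h _ (hX.trans (contract_verts_subset hy hY)) hX1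
      (hX2.trans (Finset.card_le_card (Finset.sdiff_subset_sdiff
        (contract_verts_subset hy hY) subset_rfl)))

lemma immersion_or_doubledRegular_contract {G : MG V} {x0 x1 u v : V} (ih : SmallerResolved G)
    (h3 : EdgeConn G 3) (h4 : InternallyEdgeConn G 4) (hc : 5 ≤ G.verts.card)
    (hx0 : x0 ∈ G.verts) (hx1 : x1 ∈ G.verts) (hne : x0 ≠ x1) (hu : u ∈ G.verts)
    (hv : v ∈ G.verts) (hv0 : v ≠ x0) (hv1 : v ≠ x1) (huv : u ≠ v)
    (hhalf : dcut G {v} ≤ 2 * emult G u v) :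
    HasRootedDmImmersion G 3 x0 x1 ∨ DoubledRegular (contract G {u, v} u) := by
  have hy : u ∈ ({u, v} : Finset V) := by simp
  have hY : ({u, v} : Finset V) ⊆ G.verts := by
    intro w hw
    simp only [Finset.mem_insert, Finset.mem_singleton] at hw
    rcases hw with rfl | rfl <;> assumption
  have hcard := card_contract_verts hy hY
  rw [Finset.card_pair huv] at hcard
  have hemb : Emb G.edges (contract G {u, v} u).edges := by
    apply emb_contract hy
    intro Z hZ huZ
    have hp := dcut_pair G huv
    by_cases hvZ : v ∈ Z
    · have : Z = {u, v} := by
        apply Finset.Subset.antisymm hZ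
        intro w hw
        simp only [Finset.mem_insert, Finset.mem_singleton] at hw
        rcases hw with rfl | rfl <;> assumption
      rw [this]
    · have : Z = {u} := by
        ext w
        rw [Finset.mem_singleton]
        constructor
        · intro hw
          have := hZ hw
          simp only [Finset.mem_insert, Finset.mem_singleton] at this
          rcases this with rfl | rfl
          · rfl
          · exact absurd hw hvZ
        · rintro rfl
          exact huZ
      rw [this]
      omega
  have hmem : ∀ r ∈ G.verts, v ≠ r → r ∈ (contract G {u, v} u).verts := by
    intro r hr hvr
    rw [mem_contract_verts hy hY]
    simp only [Finset.mem_insert, Finset.mem_singleton]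
    tauto
  rcases ih (contract G {u, v} u) x0 x1
    (by have := card_contract_edges_le (G := G) (Y := {u, v}) (y := u); omega)
    (h3.contract hy hY) (by omega) (hmem x0 hx0 hv0) (hmem x1 hx1 hv1) hne with h | h | h
  · exact Or.inl (h.of_emb (contract_verts_subset hy hY) hemb)
  · exact Or.inr h
  · exact absurd h ((h4.contract hy hY).not_segmented (by omega) (hmem x0 hx0 hv0)
      (hmem x1 hx1 hv1) hne)

lemma DoubledRegular.exists_doubled {G : MG V} (h : DoubledRegular G) {v u : V}
    (hv : v ∈ G.verts) (hu : u ∈ G.verts) (huv : u ≠ v) :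
    ∃ w ∈ G.verts, w ≠ v ∧ w ≠ u ∧ emult G v w = 2 := by
  by_contra hcon
  push Not at hcon
  have h1 := sum_emult_eq G hv
  rw [h.2 v hv, ← Finset.add_sum_erase _ _ (Finset.mem_erase.2 ⟨huv, hu⟩),
    Finset.sum_eq_zero] at h1
  · have := h.1 v hv u hu huv.symm
    omega
  · intro w hw
    simp only [Finset.mem_erase] at hw
    have h2 := h.1 v hv w hw.2.2 hw.2.1.symm
    have h3 := hcon w hw.2.2 hw.2.1 hw.1
    tauto

/-- A graph is resolved when some nonroot vertex sends at least half of its edges to one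
neighbour. -/
lemma resolved_of_half {G : MG V} {x0 x1 u v : V} (ih : SmallerResolved G)
    (h3 : EdgeConn G 3) (h4 : InternallyEdgeConn G 4) (hc : 5 ≤ G.verts.card)
    (hx0 : x0 ∈ G.verts) (hx1 : x1 ∈ G.verts) (hne : x0 ≠ x1) (hu : u ∈ G.verts)
    (hv : v ∈ G.verts) (hv0 : v ≠ x0) (hv1 : v ≠ x1) (huv : u ≠ v)
    (hhalf : dcut G {v} ≤ 2 * emult G u v) : Resolved G x0 x1 := by
  rcases immersion_or_doubledRegular_contract ih h3 h4 hc hx0 hx1 hne hu hv hv0 hv1 huv hhalf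
    with h | hD
  · exact Or.inl h
  obtain ⟨v', hv', hv'n⟩ : ∃ v' ∈ G.verts, v' ∉ ({u, v, x0, x1} : Finset V) := by
    by_contra hcon
    push Not at hcon
    have := Finset.card_le_card (show G.verts ⊆ {u, v, x0, x1} from hcon)
    have := Finset.card_le_four (a := u) (b := v) (c := x0) (d := x1)
    omega
  simp only [Finset.mem_insert, Finset.mem_singleton, not_or] at hv'n
  obtain ⟨hv'u, hv'v, hv'0, hv'1⟩ := hv'n
  have hy : u ∈ ({u, v} : Finset V) := by simp
  have hY : ({u, v} : Finset V) ⊆ G.verts := by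
    intro w hw
    simp only [Finset.mem_insert, Finset.mem_singleton] at hw
    rcases hw with rfl | rfl <;> assumption
  have hmem : ∀ r, r ∈ (contract G {u, v} u).verts ↔ r ∈ G.verts ∧ r ≠ v := by
    intro r
    rw [mem_contract_verts hy hY]
    simp only [Finset.mem_insert, Finset.mem_singleton, not_or]
    constructor
    · rintro (rfl | h)
      · exact ⟨hu, huv⟩
      · exact ⟨h.1, h.2.2⟩
    · rintro ⟨h1, h2⟩
      tauto
  have hv'H : v' ∈ (contract G {u, v} u).verts := (hmem v').2 ⟨hv', hv'v⟩
  have huH : u ∈ (contract G {u, v} u).verts := (hmem u).2 ⟨hu, huv⟩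
  obtain ⟨u', hu'H, hu'v', hu'u, he⟩ := hD.exists_doubled hv'H huH (Ne.symm hv'u)
  obtain ⟨hu', hu'v⟩ := (hmem u').1 hu'H
  have heH := he
  rw [emult_contract hy (by simp [hv'u, hv'v]) (by simp [hu'u, hu'v])] at he
  have hd1 : ∀ w ∈ G.verts, w ≠ u → w ≠ v → dcut G {w} = 4 := by
    intro w hw hwu hwv
    rw [← hD.2 w ((hmem w).2 ⟨hw, hwv⟩), dcut_contract_of_disjoint hy (by simp [hwu, hwv])]
  have hm1 : ∀ a ∈ G.verts, ∀ b ∈ G.verts, a ≠ u → a ≠ v → b ≠ u → b ≠ v → a ≠ b →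
      emult G a b = 0 ∨ emult G a b = 2 := by
    intro a ha b hb hau hav hbu hbv hab
    rw [← emult_contract (Y := {u, v}) (y := u) hy (by simp [hau, hav]) (by simp [hbu, hbv])]
    exact hD.1 a ((hmem a).2 ⟨ha, hav⟩) b ((hmem b).2 ⟨hb, hbv⟩) hab
  have hr1 : ∀ b ∈ G.verts, b ≠ u → b ≠ v →
      emult G b u + emult G b v = 0 ∨ emult G b u + emult G b v = 2 := by
    intro b hb hbu hbv
    have := hD.1 b ((hmem b).2 ⟨hb, hbv⟩) u huH hbu
    rwa [emult_contract_right hy (by simp [hbu, hbv]), Finset.sum_pair huv] at this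
  rcases immersion_or_doubledRegular_contract ih h3 h4 hc hx0 hx1 hne hu' hv' hv'0 hv'1 hu'v'
    (by rw [hd1 v' hv' hv'u hv'v, emult_comm, he]) with h | hD'
  · exact Or.inl h
  have hy' : u' ∈ ({u', v'} : Finset V) := by simp
  have hY' : ({u', v'} : Finset V) ⊆ G.verts := by
    intro w hw
    simp only [Finset.mem_insert, Finset.mem_singleton] at hw
    rcases hw with rfl | rfl <;> assumption
  have hmem' : ∀ r ∈ G.verts, r ≠ v' → r ∈ (contract G {u', v'} u').verts := by
    intro r hr hrv
    rw [mem_contract_verts hy' hY']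
    simp only [Finset.mem_insert, Finset.mem_singleton, not_or]
    tauto
  have hd2 : ∀ w ∈ G.verts, w ≠ u' → w ≠ v' → dcut G {w} = 4 := by
    intro w hw hwu hwv
    rw [← hD'.2 w (hmem' w hw hwv), dcut_contract_of_disjoint hy' (by simp [hwu, hwv])]
  have hm2 : ∀ a ∈ G.verts, ∀ b ∈ G.verts, a ≠ u' → a ≠ v' → b ≠ u' → b ≠ v' → a ≠ b →
      emult G a b = 0 ∨ emult G a b = 2 := by
    intro a ha b hb hau hav hbu hbv hab
    rw [← emult_contract (Y := {u', v'}) (y := u') hy' (by simp [hau, hav]) (by simp [hbu, hbv])]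
    exact hD'.1 a (hmem' a ha hav) b (hmem' b hb hbv) hab
  have hr2 : ∀ b ∈ G.verts, b ≠ u' → b ≠ v' →
      emult G b u' + emult G b v' = 0 ∨ emult G b u' + emult G b v' = 2 := by
    intro b hb hbu hbv
    have := hD'.1 b (hmem' b hb hbv) u' (hmem' u' hu' hu'v') hbu
    rwa [emult_contract_right hy' (by simp [hbu, hbv]), Finset.sum_pair hu'v'] at this
  have r1 := hr1 u' hu' hu'u hu'v
  have r2 := hr1 v' hv' hv'u hv'v
  have r3 := hr2 u hu (Ne.symm hu'u) (Ne.symm hv'u)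
  have r4 := hr2 v hv (Ne.symm hu'v) (Ne.symm hv'v)
  rw [emult_comm G u' u, emult_comm G u' v] at r1
  rw [emult_comm G v' u, emult_comm G v' v] at r2
  have hnot1 : emult G u u' ≠ 1 := by
    intro h1
    have k1 : emult (contract G {u, v} u) u' u = 2 := by
      rw [emult_contract_right hy (by simp [hu'u, hu'v]), Finset.sum_pair huv,
        emult_comm G u' u, emult_comm G u' v]
      omega
    have k2 : emult (contract G {u, v} u) v' u = 2 := by
      rw [emult_contract_right hy (by simp [hv'u, hv'v]), Finset.sum_pair huv,
        emult_comm G v' u, emult_comm G v' v]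
      omega
    have c1 := dcut_pair (contract G {u, v} u) (a := u') (b := v') hu'v'
    rw [emult_comm, heH, hD.2 u' hu'H, hD.2 v' hv'H] at c1
    have c2 := dcut_insert (contract G {u, v} u) (C := {u', v'}) (a := u)
      (by simp [Ne.symm hu'u, Ne.symm hv'u])
    rw [Finset.sum_pair hu'v', hD.2 u huH, emult_comm _ u u', emult_comm _ u v', k1, k2] at c2
    have hsub : ({u, u', v'} : Finset V) ⊆ (contract G {u, v} u).verts := by
      intro w hw
      simp only [Finset.mem_insert, Finset.mem_singleton] at hw
      rcases hw with rfl | rfl | rfl <;> assumption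
    have := (h3.contract hy hY) {u, u', v'} hsub (by simp) (by
      intro heq
      have h5 := card_contract_verts hy hY
      rw [← heq, Finset.card_pair huv] at h5
      have := Finset.card_le_three (a := u) (b := u') (c := v')
      omega)
    omega
  have m1 : emult G u u' = 0 ∨ emult G u u' = 2 := by omega
  have m2 : emult G u v' = 0 ∨ emult G u v' = 2 := by omega
  have m3 : emult G v u' = 0 ∨ emult G v u' = 2 := by omega
  have m4 : emult G v v' = 0 ∨ emult G v v' = 2 := by omega
  refine Or.inr (Or.inl ⟨?_, ?_⟩)
  · have cross : ∀ a b, (a = u ∨ a = v) → (b = u' ∨ b = v') →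
        emult G a b = 0 ∨ emult G a b = 2 := by
      rintro a b (rfl | rfl) (rfl | rfl) <;> assumption
    intro a ha b hb hab
    by_cases ha1 : a = u ∨ a = v
    · by_cases hb2 : b = u' ∨ b = v'
      · exact cross a b ha1 hb2
      · have ha2 : a ≠ u' ∧ a ≠ v' := by
          rcases ha1 with rfl | rfl
          · exact ⟨Ne.symm hu'u, Ne.symm hv'u⟩
          · exact ⟨Ne.symm hu'v, Ne.symm hv'v⟩
        push Not at hb2
        exact hm2 a ha b hb ha2.1 ha2.2 hb2.1 hb2.2 hab
    · push Not at ha1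
      by_cases hb1 : b = u ∨ b = v
      · by_cases ha2 : a = u' ∨ a = v'
        · rw [emult_comm]
          exact cross b a hb1 ha2
        · have hb2 : b ≠ u' ∧ b ≠ v' := by
            rcases hb1 with rfl | rfl
            · exact ⟨Ne.symm hu'u, Ne.symm hv'u⟩
            · exact ⟨Ne.symm hu'v, Ne.symm hv'v⟩
          push Not at ha2
          exact hm2 a ha b hb ha2.1 ha2.2 hb2.1 hb2.2 hab
      · push Not at hb1
        exact hm1 a ha b hb ha1.1 ha1.2 hb1.1 hb1.2 hab
  · intro w hw
    by_cases h : w = u ∨ w = v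
    · rcases h with rfl | rfl
      · exact hd2 _ hw (Ne.symm hu'u) (Ne.symm hv'u)
      · exact hd2 _ hw (Ne.symm hu'v) (Ne.symm hv'v)
    · push Not at h
      exact hd1 w hw h.1 h.2

/-- `H` arises from `K` by suppressing the vertices in `S`: its cuts are the smallest cuts of `K`
extending the given partition of the remaining vertices. -/
structure Suppresses (K : MG V) (S : Finset V) (H : MG V) : Prop where
  verts : H.verts = K.verts \ S
  emb : Emb K.edges H.edges
  card : H.edges.card ≤ K.edges.card
  cut_le : ∀ X ⊆ H.verts, ∀ T ⊆ S, dcut H X ≤ dcut K (X ∪ T)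
  cut_eq : ∀ X ⊆ H.verts, ∃ T ⊆ S, dcut H X = dcut K (X ∪ T)

lemma Suppresses.refl (K : MG V) : Suppresses K ∅ K where
  verts := by simp
  emb := Emb.refl _
  card := le_rfl
  cut_le := by
    intro X _ T hT
    rw [Finset.subset_empty.1 hT, Finset.union_empty]
  cut_eq := by
    intro X _
    exact ⟨∅, subset_rfl, by simp⟩

lemma exists_edges_of_dcut_eq_two {K : MG V} {a : V} (h : dcut K {a} = 2) :
    ∃ (p q : V) (R : Multiset (Sym2 V)), p ≠ a ∧ q ≠ a ∧
      K.edges = s(p, a) ::ₘ s(a, q) ::ₘ R ∧ cutSize R {a} = 0 := by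
  obtain ⟨e, f, hef⟩ := Multiset.card_eq_two.1 h
  have hmem : ∀ g ∈ cutEdges K {a}, ∃ p, p ≠ a ∧ g = s(a, p) := by
    intro g hg
    obtain ⟨-, u, v, rfl, hu, hv⟩ := Multiset.mem_filter.1 hg
    rw [Finset.mem_singleton] at hu hv
    exact ⟨v, hv, by rw [hu]⟩
  obtain ⟨p, hp, rfl⟩ := hmem e (by rw [hef]; simp)
  obtain ⟨q, hq, rfl⟩ := hmem f (by rw [hef]; simp)
  refine ⟨p, q, K.edges.filter fun e => ¬ Crosses {a} e, hp, hq, ?_, ?_⟩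
  · conv_lhs => rw [← Multiset.filter_add_not (Crosses {a}) K.edges]
    have : K.edges.filter (Crosses {a}) = s(a, p) ::ₘ s(a, q) ::ₘ 0 := hef
    rw [this, Sym2.eq_swap (a := p)]
    simp
  · rw [cutSize, Multiset.countP_eq_zero]
    intro e he
    exact (Multiset.mem_filter.1 he).2

lemma exists_suppresses_singleton {K : MG V} {a : V} (h : dcut K {a} = 2) :
    ∃ H, Suppresses K {a} H := by
  obtain ⟨p, q, R, hp, hq, hE, hR⟩ := exists_edges_of_dcut_eq_two h
  have hsub : ∀ e, e ∈ R → ∀ v ∈ e, v ∈ K.verts.erase a := by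
    intro e he v hv
    have heK : e ∈ K.edges := by rw [hE]; simp [he]
    refine Finset.mem_erase.2 ⟨?_, K.edge_support e heK v hv⟩
    rintro rfl
    rw [cutSize, Multiset.countP_eq_zero] at hR
    obtain ⟨w, rfl⟩ := hv
    refine hR _ he ((crosses_mk _ _ _).2 ?_)
    have := K.loopless _ heK
    rw [Sym2.mk_isDiag_iff] at this
    simp [Ne.symm this]
  have hpv : p ∈ K.verts := K.edge_support s(p, a) (by rw [hE]; simp) p (by simp)
  have hqv : q ∈ K.verts := K.edge_support s(a, q) (by rw [hE]; simp) q (by simp)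
  have hRi : ∀ X : Finset V, a ∉ X → cutSize R (insert a X) = cutSize R X := by
    intro X hX
    have h1 := cutSize_insert R hX
    have h2 := sum_count_le_cutSize R hX
    omega
  let F : Multiset (Sym2 V) := (if p = q then 0 else {s(p, q)}) + R
  have hcut : ∀ X : Finset V, cutSize F X = cutSize R X + if (p ∈ X ↔ q ∈ X) then 0 else 1 := by
    intro X
    simp only [F]
    by_cases hpq : p = q
    · simp [hpq]
    · rw [if_neg hpq, Multiset.singleton_add, cutSize_cons]
  have hK : ∀ X : Finset V, cutSize K.edges X = cutSize R X +
      (if (p ∈ X ↔ a ∈ X) then 0 else 1) + (if (a ∈ X ↔ q ∈ X) then 0 else 1) := by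
    intro X
    rw [hE, cutSize_cons, cutSize_cons]
    omega
  have hemb : Emb K.edges F := by
    rw [hE]
    refine (Emb.split p a q R).trans (Emb.of_le ?_)
    simp only [F]
    by_cases hpq : p = q
    · rw [if_pos hpq, zero_add]
      exact Multiset.le_cons_self _ _
    · rw [if_neg hpq, Multiset.singleton_add]
  refine ⟨⟨K.verts.erase a, F, ?_, ?_⟩, ?_, hemb, ?_, ?_, ?_⟩
  · intro e he v hv
    simp only [F] at he
    rw [Multiset.mem_add] at he
    rcases he with he | he
    · split_ifs at he with hpq
      · simp at he
      · rw [Multiset.mem_singleton] at he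
        subst he
        rw [Sym2.mem_iff] at hv
        rcases hv with rfl | rfl <;> simp [*]
    · exact hsub e he v hv
  · intro e he
    simp only [F] at he
    rw [Multiset.mem_add] at he
    rcases he with he | he
    · split_ifs at he with hpq
      · simp at he
      · rw [Multiset.mem_singleton] at he
        subst he
        simpa using hpq
    · exact K.loopless e (by rw [hE]; simp [he])
  · ext v
    simp [and_comm]
  · have hc := congrArg Multiset.card hE
    simp only [F, hc]
    split_ifs <;> simp <;> omega
  · intro X hX T hT
    have haX : a ∉ X := fun h => (Finset.mem_erase.1 (hX h)).1 rfl
    rw [dcut_eq_cutSize, dcut_eq_cutSize]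
    change cutSize F X ≤ _
    rcases Finset.subset_singleton_iff.1 hT with rfl | rfl
    · rw [Finset.union_empty, hcut, hK]
      simp only [haX, iff_false, false_iff]
      split_ifs <;> first | omega | tauto
    · rw [Finset.union_comm, ← Finset.insert_eq, hcut, hK, hRi X haX]
      simp only [Finset.mem_insert, hp, hq, false_or, true_or, iff_true, true_iff]
      split_ifs <;> first | omega | tauto
  · intro X hX
    have haX : a ∉ X := fun h => (Finset.mem_erase.1 (hX h)).1 rfl
    by_cases hpX : p ∈ X ∧ q ∈ X
    · refine ⟨{a}, subset_rfl, ?_⟩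
      rw [dcut_eq_cutSize, dcut_eq_cutSize]
      change cutSize F X = _
      rw [Finset.union_comm, ← Finset.insert_eq, hcut, hK, hRi X haX]
      simp [hpX.1, hpX.2]
    · refine ⟨∅, by simp, ?_⟩
      rw [dcut_eq_cutSize, dcut_eq_cutSize]
      change cutSize F X = _
      rw [Finset.union_empty, hcut, hK]
      simp only [haX, iff_false, false_iff]
      split_ifs <;> first | omega | tauto

lemma Suppresses.insert {K H : MG V} {S : Finset V} {c : V} (h : Suppresses K S H)
    (hc : dcut H {c} = 2) : ∃ H', Suppresses K (insert c S) H' := by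
  obtain ⟨H', h'⟩ := exists_suppresses_singleton hc
  have hsub : H'.verts ⊆ H.verts := by rw [h'.verts]; exact Finset.sdiff_subset
  have hcH : c ∈ H.verts := by
    obtain ⟨p, q, R, -, -, hE, -⟩ := exists_edges_of_dcut_eq_two hc
    exact H.edge_support s(p, c) (by rw [hE]; simp) c (by simp)
  have hun : ∀ X ⊆ H'.verts, ∀ T ⊆ ({c} : Finset V), X ∪ T ⊆ H.verts := by
    intro X hX T hT
    refine Finset.union_subset (hX.trans hsub) (hT.trans ?_)
    simpa using hcH
  refine ⟨H', ?_, h.emb.trans h'.emb, h'.card.trans h.card, ?_, ?_⟩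
  · rw [h'.verts, h.verts]
    ext v
    simp only [Finset.mem_sdiff, Finset.mem_singleton, Finset.mem_insert]
    tauto
  · intro X hX T hT
    have h1 := h'.cut_le X hX (T ∩ {c}) Finset.inter_subset_right
    have h2 := h.cut_le (X ∪ (T ∩ {c})) (hun X hX _ Finset.inter_subset_right) (T \ {c}) (by
      intro v hv
      rw [Finset.mem_sdiff, Finset.mem_singleton] at hv
      exact (Finset.mem_insert.1 (hT hv.1)).resolve_left hv.2)
    refine h1.trans (h2.trans (le_of_eq ?_))
    congr 1
    ext v
    simp only [Finset.mem_union, Finset.mem_inter, Finset.mem_sdiff]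
    tauto
  · intro X hX
    obtain ⟨T, hT, h1⟩ := h'.cut_eq X hX
    obtain ⟨T', hT', h2⟩ := h.cut_eq (X ∪ T) (hun X hX T hT)
    refine ⟨T ∪ T', ?_, by rw [h1, h2, Finset.union_assoc]⟩
    refine Finset.union_subset (hT.trans (by simp)) (hT'.trans (Finset.subset_insert _ _))

section

lemma dcut_deleteEdge {G : MG V} {a b : V} (h : 0 < emult G a b) (X : Finset V) :
    dcut G X = dcut (deleteEdge G s(a, b)) X + if (a ∈ X ↔ b ∈ X) then 0 else 1 := by
  have he : s(a, b) ∈ G.edges := Multiset.count_pos.1 h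
  rw [dcut_eq_cutSize, dcut_eq_cutSize]
  conv_lhs => rw [← Multiset.cons_erase he, cutSize_cons]
  rfl

lemma emult_deleteEdge_self (G : MG V) (a b : V) :
    emult (deleteEdge G s(a, b)) a b = emult G a b - 1 :=
  Multiset.count_erase_self _ _

lemma emult_deleteEdge_of_ne {G : MG V} {a b u v : V} (h : s(u, v) ≠ s(a, b)) :
    emult (deleteEdge G s(a, b)) u v = emult G u v :=
  Multiset.count_erase_of_ne h _

/-- A hypothetical graph with no `D₃` immersion to which no earlier reduction applies. -/
structure Stuck (G : MG V) (x0 x1 : V) : Prop where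
  conn : EdgeConn G 3
  internal : InternallyEdgeConn G 4
  card : 5 ≤ G.verts.card
  mem0 : x0 ∈ G.verts
  mem1 : x1 ∈ G.verts
  ne : x0 ≠ x1
  noImm : ¬ HasRootedDmImmersion G 3 x0 x1
  lt_half : ∀ v ∈ G.verts, v ≠ x0 → v ≠ x1 → ∀ u, u ≠ v → 2 * emult G v u < dcut G {v}
  smaller : SmallerResolved G

variable {G : MG V} {x0 x1 : V}

lemma Stuck.three_le (h : Stuck G x0 x1) {v : V} (hv : v ∈ G.verts) : 3 ≤ dcut G {v} := by
  refine h.conn _ (by simpa using hv) (by simp) fun he => ?_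
  have := h.card
  rw [← he] at this
  simp at this

lemma Stuck.emult_le_one (h : Stuck G x0 x1) {v u : V} (hv : v ∈ G.verts) (h0 : v ≠ x0)
    (h1 : v ≠ x1) (hu : u ≠ v) (hd : dcut G {v} = 3) : emult G v u ≤ 1 := by
  have := h.lt_half v hv h0 h1 u hu
  omega

lemma Stuck.exists_suppresses (h : Stuck G x0 x1) {a b : V} (hab : 0 < emult G a b)
    (ha : dcut G {a} = 3 → a ≠ x0 ∧ a ≠ x1) :
    ∃ H, Suppresses (deleteEdge G s(a, b)) (({a, b} : Finset V).filter fun v => dcut G {v} = 3)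
      H := by
  obtain ⟨hav, hbv, hne⟩ := emult_pos_mem hab
  have ka := dcut_deleteEdge hab {a}
  have kb := dcut_deleteEdge hab {b}
  rw [if_neg (by simp [hne.symm])] at ka
  rw [if_neg (by simp [hne])] at kb
  by_cases ha3 : dcut G {a} = 3
  · obtain ⟨H1, hH1⟩ := exists_suppresses_singleton (K := deleteEdge G s(a, b)) (a := a) (by omega)
    by_cases hb3 : dcut G {b} = 3
    · rw [Finset.filter_true_of_mem (by simp [ha3, hb3]), Finset.pair_comm]
      apply hH1.insert
      have hsub : ({b} : Finset V) ⊆ H1.verts := by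
        rw [hH1.verts]
        simp only [Finset.singleton_subset_iff, Finset.mem_sdiff, Finset.mem_singleton]
        exact ⟨hbv, hne.symm⟩
      have h1 := hH1.cut_le {b} hsub ∅ (by simp)
      obtain ⟨T, hT, h2⟩ := hH1.cut_eq {b} hsub
      rw [Finset.union_empty] at h1
      rcases Finset.subset_singleton_iff.1 hT with rfl | rfl
      · rw [Finset.union_empty] at h2
        omega
      · have h3 := dcut_pair (deleteEdge G s(a, b)) hne
        rw [Finset.union_comm, ← Finset.insert_eq] at h2
        have h4 := emult_deleteEdge_self G a b
        have h5 := h.emult_le_one hav (ha ha3).1 (ha ha3).2 hne.symm ha3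
        omega
    · rw [Finset.filter_insert, if_pos ha3, Finset.filter_singleton, if_neg hb3]
      exact ⟨H1, hH1⟩
  · by_cases hb3 : dcut G {b} = 3
    · rw [Finset.filter_insert, if_neg ha3, Finset.filter_singleton, if_pos hb3]
      exact exists_suppresses_singleton (by omega)
    · rw [Finset.filter_insert, if_neg ha3, Finset.filter_singleton, if_neg hb3]
      exact ⟨_, Suppresses.refl _⟩

lemma Suppresses.exists_cut_eq {K H : MG V} {S X : Finset V} (h : Suppresses K S H)
    (hSK : S ⊆ K.verts) (hX : X ⊆ H.verts) :
    ∃ T ⊆ S, dcut H X = dcut K (X ∪ T) ∧ X ∪ T ⊆ K.verts ∧ H.verts \ X ⊆ K.verts \ (X ∪ T) := by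
  obtain ⟨T, hT, hd⟩ := h.cut_eq X hX
  have hHK : H.verts ⊆ K.verts := by rw [h.verts]; exact Finset.sdiff_subset
  refine ⟨T, hT, hd, Finset.union_subset (hX.trans hHK) (hT.trans hSK), ?_⟩
  intro v hv
  rw [Finset.mem_sdiff] at hv ⊢
  refine ⟨hHK hv.1, ?_⟩
  rw [Finset.mem_union]
  rintro (h1 | h1)
  · exact hv.2 h1
  · have := hv.1
    rw [h.verts, Finset.mem_sdiff] at this
    exact this.2 (hT h1)

variable {a b : V} {H : MG V}

/-- The cubic ends of an edge, which are suppressed on deleting it. -/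
def cubicEnds (G : MG V) (a b : V) : Finset V := ({a, b} : Finset V).filter fun v => dcut G {v} = 3

lemma cubicEnds_subset (hab : 0 < emult G a b) : cubicEnds G a b ⊆ G.verts := by
  obtain ⟨hav, hbv, hne⟩ := emult_pos_mem hab
  intro v hv
  simp only [cubicEnds, Finset.mem_filter, Finset.mem_insert, Finset.mem_singleton] at hv
  rcases hv.1 with rfl | rfl <;> assumption

lemma Stuck.edgeConn_of_suppresses (h : Stuck G x0 x1) (hab : 0 < emult G a b)
    (hH : Suppresses (deleteEdge G s(a, b)) (cubicEnds G a b) H) : EdgeConn H 3 := by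
  have key : ∀ v ∈ H.verts, ∀ T ⊆ cubicEnds G a b, ({v} : Finset V) = {v} ∪ T →
      3 ≤ dcut (deleteEdge G s(a, b)) {v} := by
    intro v hv T hT hvT
    rw [hH.verts, Finset.mem_sdiff] at hv
    have h1 := dcut_deleteEdge hab {v}
    have h2 := h.three_le (v := v) hv.1
    by_cases hva : v = a ∨ v = b
    · have : dcut G {v} ≠ 3 := fun h3 => hv.2 (by
        simp only [cubicEnds, Finset.mem_filter, Finset.mem_insert, Finset.mem_singleton]
        exact ⟨hva, h3⟩)
      split_ifs at h1 <;> omega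
    · push Not at hva
      rw [if_pos (by simp [Ne.symm hva.1, Ne.symm hva.2])] at h1
      omega
  intro X hX hX0 hXv
  obtain ⟨T, hT, hd, hsub, hc⟩ := hH.exists_cut_eq (cubicEnds_subset hab) hX
  change X ∪ T ⊆ G.verts at hsub
  change _ ⊆ G.verts \ (X ∪ T) at hc
  rw [hd]
  have hc0 : (H.verts \ X).Nonempty := Finset.sdiff_nonempty.2 fun h' => hXv (hX.antisymm h')
  by_cases h1 : (X ∪ T).card ≤ 1
  · obtain ⟨v, hv⟩ := hX0
    have : X ∪ T = {v} := by
      apply Finset.eq_singleton_iff_unique_mem.2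
      refine ⟨by simp [hv], fun w hw => Finset.card_le_one.1 h1 _ hw _ (by simp [hv])⟩
    rw [this]
    refine key v (hX hv) ∅ (by simp) (by simp)
  by_cases h2 : (G.verts \ (X ∪ T)).card ≤ 1
  · obtain ⟨v, hv⟩ := hc0
    have : G.verts \ (X ∪ T) = {v} := by
      apply Finset.eq_singleton_iff_unique_mem.2
      refine ⟨hc hv, fun w hw => Finset.card_le_one.1 h2 _ hw _ (hc hv)⟩
    rw [← dcut_compl, show (deleteEdge G s(a, b)).verts = G.verts from rfl, this]
    refine key v (Finset.mem_sdiff.1 hv).1 ∅ (by simp) (by simp)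
  have h4 := h.internal _ hsub (by omega) (by omega)
  have h5 := dcut_deleteEdge hab (X ∪ T)
  split_ifs at h5 <;> omega

lemma Stuck.exists_four_cut (h : Stuck G x0 x1) (hab : 0 < emult G a b)
    (hH : Suppresses (deleteEdge G s(a, b)) (cubicEnds G a b) H) {X : Finset V}
    (hX : X ⊆ H.verts) (hd : dcut H X = 3) (h2 : 2 ≤ X.card) (h2' : 2 ≤ (H.verts \ X).card) :
    ∃ T ⊆ cubicEnds G a b, dcut G (X ∪ T) = 4 ∧ ¬ (a ∈ X ∪ T ↔ b ∈ X ∪ T) := by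
  obtain ⟨T, hT, hd', hsub, hc⟩ := hH.exists_cut_eq (cubicEnds_subset hab) hX
  have h4 := h.internal _ hsub (h2.trans (Finset.card_le_card Finset.subset_union_left))
    (h2'.trans (Finset.card_le_card hc))
  have h5 := dcut_deleteEdge hab (X ∪ T)
  refine ⟨T, hT, ?_, ?_⟩
  · split_ifs at h5 <;> omega
  · intro h6
    rw [if_pos h6] at h5
    omega

/-- Deleting an edge and suppressing its cubic ends gives a smaller graph, to which induction
applies. -/
lemma Stuck.exists_reduction (h : Stuck G x0 x1) (hab : 0 < emult G a b)
    (ha : dcut G {a} = 3 → a ≠ x0 ∧ a ≠ x1) (hb : dcut G {b} = 3 → b ≠ x0 ∧ b ≠ x1)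
    (hc : 4 ≤ (G.verts \ cubicEnds G a b).card) :
    ∃ H, Suppresses (deleteEdge G s(a, b)) (cubicEnds G a b) H ∧ EdgeConn H 3 ∧
      (DoubledRegular H ∨ Segmented H x0 x1) := by
  obtain ⟨H, hH⟩ := h.exists_suppresses hab ha
  refine ⟨H, hH, h.edgeConn_of_suppresses hab hH, ?_⟩
  have hroot : ∀ r ∈ G.verts, (r = x0 ∨ r = x1) → r ∈ H.verts := by
    intro r hr hr'
    rw [hH.verts]
    refine Finset.mem_sdiff.2 ⟨hr, ?_⟩
    simp only [Finset.mem_filter, Finset.mem_insert, Finset.mem_singleton]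
    rintro ⟨rfl | rfl, h3⟩
    · have := ha h3
      tauto
    · have := hb h3
      tauto
  have hverts : H.verts ⊆ G.verts := by rw [hH.verts]; exact Finset.sdiff_subset
  have he : s(a, b) ∈ G.edges := Multiset.count_pos.1 hab
  have hE : Emb G.edges H.edges :=
    (Emb.of_le (Multiset.erase_le s(a, b) G.edges)).trans hH.emb
  have h1 := Finset.card_le_card hverts
  have h2 : (G.edges.erase s(a, b)).card < G.edges.card := Multiset.card_erase_lt_of_mem he
  have h3 : H.edges.card ≤ (G.edges.erase s(a, b)).card := hH.card
  rcases h.smaller H x0 x1 (by omega) (h.edgeConn_of_suppresses hab hH)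
    (by rw [hH.verts]; exact hc) (hroot x0 h.mem0 (Or.inl rfl)) (hroot x1 h.mem1 (Or.inr rfl)) h.ne
    with h' | h'
  · exact absurd (h'.of_emb hverts hE) h.noImm
  · exact h'

end

section

lemma HasRootedDmImmersion.symm {G : MG V} {x0 x1 : V} (h : HasRootedDmImmersion G 3 x0 x1) :
    HasRootedDmImmersion G 3 x1 x0 := by
  obtain ⟨φ, rfl, rfl, hinj, hv, P, hP, hw, hE⟩ := h
  refine ⟨φ ∘ Equiv.swap 0 1, by simp, by simp, hinj.comp (Equiv.injective _), fun w => hv _,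
    P.map fun p => (Sym2.map (Equiv.swap 0 1) p.1, p.2), ?_, ?_, ?_⟩
  · rw [Multiset.map_map]
    have : (dmEdges 3).map (Sym2.map (Equiv.swap (0 : Fin 4) 1)) = dmEdges 3 := by decide
    rw [← this, ← hP, Multiset.map_map]
    rfl
  · intro p hp
    obtain ⟨q, hq, rfl⟩ := Multiset.mem_map.1 hp
    obtain ⟨u, v, h1, h2⟩ := hw q hq
    refine ⟨Equiv.swap 0 1 u, Equiv.swap 0 1 v, ?_, ?_⟩
    · rw [h1, Sym2.map_mk]
    · simpa using h2
  · rw [Multiset.map_map]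
    exact hE

variable {G H : MG V} {x0 x1 : V}

lemma RootFree.symm {T : Finset V} (h : RootFree x0 x1 T) : RootFree x1 x0 T :=
  fun hT => (h hT).symm

lemma Segmented.symm (h : Segmented H x0 x1) : Segmented H x1 x0 := by
  obtain ⟨X, Z, hX, hd, hch, h0, h1⟩ := h
  exact ⟨X, Z, hX, hd, hch, h0.symm, h1.symm⟩

lemma Stuck.symm (h : Stuck G x0 x1) : Stuck G x1 x0 where
  conn := h.conn
  internal := h.internal
  card := h.card
  mem0 := h.mem1
  mem1 := h.mem0
  ne := h.ne.symm
  noImm := fun h' => h.noImm h'.symm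
  lt_half := fun v hv h0 h1 => h.lt_half v hv h1 h0
  smaller := h.smaller

lemma Chain.exists_pair {X Z : Finset V} (hc : 4 ≤ H.verts.card)
    (hx1 : x1 ∈ H.verts) (hne : x0 ≠ x1) (hX : X ⊆ H.verts)
    (hd : dcut H X = 3) (hch : Chain H X Z) (h0 : RootFree x0 x1 X)
    (h1 : RootFree x0 x1 (H.verts \ Z)) (hxX : x0 ∈ X) :
    ∃ w ∈ H.verts, w ≠ x0 ∧ dcut H {x0, w} = 3 := by
  have hX2 : X.card ≤ 2 := by
    by_contra h
    exact (h0 (by omega)).1 hxX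
  have hX0 : 0 < X.card := Finset.card_pos.2 ⟨x0, hxX⟩
  obtain hX1 | hX1 : X.card = 1 ∨ X.card = 2 := by omega
  · obtain ⟨v, rfl⟩ := Finset.card_eq_one.1 hX1
    obtain rfl := Finset.mem_singleton.1 hxX
    rcases Relation.ReflTransGen.cases_head hch with rfl | ⟨D, ⟨hD, hdD, v, hv, rfl⟩, -⟩
    · refine absurd (Finset.mem_sdiff.2 ⟨hx1, by simpa using hne.symm⟩) (h1 ?_).2
      rw [Finset.card_sdiff_of_subset hX, hX1]
      omega
    · refine ⟨v, hD (by simp), by simpa using hv, ?_⟩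
      rw [Finset.pair_comm]
      exact hdD
  · obtain ⟨u, v, huv, rfl⟩ := Finset.card_eq_two.1 hX1
    rw [Finset.mem_insert, Finset.mem_singleton] at hxX
    rcases hxX with rfl | rfl
    · exact ⟨v, hX (by simp), huv.symm, hd⟩
    · exact ⟨u, hX (by simp), huv, by rw [Finset.pair_comm]; exact hd⟩

lemma Chain.exists_step {X Z : Finset V} {y : V} (h : Chain H X Z) (hX : X ⊆ H.verts)
    (hd : dcut H X = 3) (hyX : y ∉ X) (hyZ : y ∈ Z) :
    ∃ C ⊆ H.verts, y ∉ C ∧ dcut H C = 3 ∧ dcut H (insert y C) = 3 ∧ insert y C ⊆ H.verts := by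
  induction h with
  | refl => exact absurd hyZ hyX
  | @tail C D hC hD ih =>
    by_cases hyC : y ∈ C
    · exact ih hyC
    · obtain ⟨hDv, hdD, v, hv, rfl⟩ := hD
      obtain rfl := (Finset.mem_insert.1 hyZ).resolve_right hyC
      exact ⟨C, Chain.subset_verts hC hX, hyC, Chain.dcut_eq hC hd, hdD, hDv⟩

/-- If no root lies strictly inside a segmentation, it forms a cut of size three together with
another vertex. -/
lemma Segmented.exists_pair (h : Segmented H x0 x1) (hc : 4 ≤ H.verts.card)
    (hx0 : x0 ∈ H.verts) (hx1 : x1 ∈ H.verts) (hne : x0 ≠ x1)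
    (hmid : ∀ C ⊆ H.verts, x0 ∉ C → dcut H C = 3 → dcut H (insert x0 C) = 3 → 2 ≤ C.card →
      2 ≤ (H.verts \ insert x0 C).card → False) :
    ∃ w ∈ H.verts, w ≠ x0 ∧ dcut H {x0, w} = 3 := by
  obtain ⟨X, Z, hX, hd, hch, h0, h1⟩ := h
  by_cases hxX : x0 ∈ X
  · exact Chain.exists_pair hc hx1 hne hX hd hch h0 h1 hxX
  by_cases hxZ : x0 ∉ Z
  · refine Chain.exists_pair hc hx1 hne Finset.sdiff_subset
      (by rw [dcut_compl, Chain.dcut_eq hch hd]) (Chain.compl hch hd) h1 ?_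
      (Finset.mem_sdiff.2 ⟨hx0, hxZ⟩)
    rwa [Finset.sdiff_sdiff_eq_self hX]
  push Not at hxZ
  obtain ⟨C, hC, hxC, hdC, hdx, hxCv⟩ := Chain.exists_step hch hX hd hxX hxZ
  by_cases hC2 : 2 ≤ C.card
  · by_cases hC3 : 2 ≤ (H.verts \ insert x0 C).card
    · exact (hmid C hC hxC hdC hdx hC2 hC3).elim
    · have hne0 : (H.verts \ insert x0 C).card ≠ 0 := by
        intro h0
        rw [Finset.card_eq_zero] at h0
        rw [← dcut_compl, h0, dcut_empty] at hdx
        omega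
      obtain ⟨w, hw⟩ := Finset.card_eq_one.1
        (show (H.verts \ insert x0 C).card = 1 by omega)
      have hwm : w ∈ H.verts \ insert x0 C := by simp [hw]
      simp only [Finset.mem_sdiff, Finset.mem_insert, not_or] at hwm
      refine ⟨w, hwm.1, hwm.2.1, ?_⟩
      rw [← hdC, ← dcut_compl H C]
      congr 1
      ext v
      have hv := Finset.ext_iff.1 hw v
      simp only [Finset.mem_sdiff, Finset.mem_insert, Finset.mem_singleton, not_or] at hv ⊢
      constructor
      · rintro (rfl | rfl)
        · exact ⟨hx0, hxC⟩
        · exact ⟨hwm.1, hwm.2.2⟩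
      · rintro ⟨hv1, hv2⟩
        by_cases hvx : v = x0
        · exact Or.inl hvx
        · exact Or.inr (hv.1 ⟨hv1, hvx, hv2⟩)
  · have hne0 : C.card ≠ 0 := by
      intro h0
      rw [Finset.card_eq_zero] at h0
      rw [h0, dcut_empty] at hdC
      omega
    obtain ⟨w, rfl⟩ := Finset.card_eq_one.1 (show C.card = 1 by omega)
    exact ⟨w, hC (by simp), fun h => hxC (by simp [h]), hdx⟩

variable {a b : V}

lemma Suppresses.dcut_eq_of_forall {K : MG V} {S : Finset V} (h : Suppresses K S H) {X : Finset V}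
    (hX : X ⊆ H.verts) (hle : ∀ T ⊆ S, dcut K X ≤ dcut K (X ∪ T)) : dcut H X = dcut K X := by
  obtain ⟨T, hT, hd⟩ := h.cut_eq X hX
  have h1 := h.cut_le X hX ∅ (by simp)
  rw [Finset.union_empty] at h1
  have := hle T hT
  omega

/-- Deleting an edge and suppressing its cubic ends does not change the degree of other
vertices. -/
lemma Stuck.dcut_reduction (h : Stuck G x0 x1) (hab : 0 < emult G a b)
    (ha : dcut G {a} = 3 → a ≠ x0 ∧ a ≠ x1) (hb : dcut G {b} = 3 → b ≠ x0 ∧ b ≠ x1)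
    (hH : Suppresses (deleteEdge G s(a, b)) (cubicEnds G a b) H) {x : V}
    (hx : x ∈ H.verts) (hxa : x ≠ a) (hxb : x ≠ b) : dcut H {x} = dcut G {x} := by
  obtain ⟨hav, hbv, hne⟩ := emult_pos_mem hab
  have hx' := dcut_deleteEdge hab {x}
  rw [if_pos (by simp [hxa.symm, hxb.symm])] at hx'
  rw [hx', add_zero]
  apply hH.dcut_eq_of_forall (by simpa using hx)
  have da := dcut_deleteEdge hab {a}
  rw [if_neg (by simp [hne.symm])] at da
  have db := dcut_deleteEdge hab {b}
  rw [if_neg (by simp [hne])] at db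
  have pa := dcut_pair (deleteEdge G s(a, b)) hxa.symm
  have pb := dcut_pair (deleteEdge G s(a, b)) hxb.symm
  rw [emult_deleteEdge_of_ne (by simp [hxa, hxb])] at pa pb
  have ea : dcut G {a} = 3 → emult G a x ≤ 1 := fun h3 =>
    h.emult_le_one hav (ha h3).1 (ha h3).2 hxa h3
  have eb : dcut G {b} = 3 → emult G b x ≤ 1 := fun h3 =>
    h.emult_le_one hbv (hb h3).1 (hb h3).2 hxb h3
  have eab : dcut G {a} = 3 → emult G a b ≤ 1 := fun h3 =>
    h.emult_le_one hav (ha h3).1 (ha h3).2 hne.symm h3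
  have pab := dcut_insert (deleteEdge G s(a, b)) (C := {b, x}) (a := a) (by simp [hne, hxa.symm])
  rw [Finset.sum_pair hxb.symm, emult_deleteEdge_self,
    emult_deleteEdge_of_ne (by simp [hxa, hxb])] at pab
  intro T hT
  have hT' : ∀ v ∈ T, (v = a ∨ v = b) ∧ dcut G {v} = 3 := by
    intro v hv
    simpa [cubicEnds] using hT hv
  by_cases haT : a ∈ T
  · have ha3 := (hT' a haT).2
    by_cases hbT : b ∈ T
    · have hb3 := (hT' b hbT).2
      have : {x} ∪ T = {a, b, x} := by
        ext v
        have := hT' v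
        simp only [Finset.mem_union, Finset.mem_singleton, Finset.mem_insert]
        constructor
        · rintro (h | h)
          · exact Or.inr (Or.inr h)
          · have := (this h).1
            tauto
        · rintro (rfl | rfl | rfl) <;> simp [*]
      rw [this]
      have := ea ha3
      have := eb hb3
      have := eab ha3
      omega
    · have : {x} ∪ T = {a, x} := by
        ext v
        have := hT' v
        simp only [Finset.mem_union, Finset.mem_singleton, Finset.mem_insert]
        constructor
        · rintro (h | h)
          · exact Or.inr h
          · rcases (this h).1 with rfl | rfl
            · exact Or.inl rfl
            · exact absurd h hbT
        · rintro (rfl | rfl) <;> simp [*]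
      rw [this]
      have := ea ha3
      omega
  · by_cases hbT : b ∈ T
    · have hb3 := (hT' b hbT).2
      have : {x} ∪ T = {b, x} := by
        ext v
        have := hT' v
        simp only [Finset.mem_union, Finset.mem_singleton, Finset.mem_insert]
        constructor
        · rintro (h | h)
          · exact Or.inr h
          · rcases (this h).1 with rfl | rfl
            · exact absurd h haT
            · exact Or.inl rfl
        · rintro (rfl | rfl) <;> simp [*]
      rw [this]
      have := eb hb3
      omega
    · have : T = ∅ := by
        rw [Finset.eq_empty_iff_forall_notMem]
        intro v hv
        rcases (hT' v hv).1 with rfl | rfl <;> contradiction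
      rw [this, Finset.union_empty]

end

section

variable {G H : MG V} {x0 x1 a b : V}

/-- The local structure at the end `a` of an edge `ab` forced by a cubic root `x`. -/
def EndStructure (G : MG V) (x a b : V) : Prop :=
  (4 ≤ dcut G {a} ∧ dcut G {a} = 2 * emult G x a + 1) ∨
  (dcut G {a} = 3 ∧ ∃ w ∈ G.verts, w ≠ x ∧ w ≠ a ∧ w ≠ b ∧ emult G a x = 1 ∧ emult G a w = 1 ∧
    dcut G {w} = 2 * emult G x w + 2)

lemma card_sdiff_pair {S : Finset V} {u v : V} (hc : 4 ≤ S.card) :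
    2 ≤ (S \ {u, v}).card := by
  have h1 := Finset.le_card_sdiff {u, v} S
  have := Finset.card_le_two (a := u) (b := v)
  omega

lemma Stuck.endStructure_of_fourCut (h : Stuck G x0 x1) (hd : dcut G {x0} = 3)
    (hab : 0 < emult G a b) (ha0 : a ≠ x0) (ha1 : a ≠ x1) (hb0 : b ≠ x0)
    {w : V} (hw : w ∈ G.verts) (hwx : w ≠ x0) (hw3 : w ∉ cubicEnds G a b) {T : Finset V}
    (hT : T ⊆ cubicEnds G a b) (h4 : dcut G ({x0, w} ∪ T) = 4) (haT : a ∈ ({x0, w} : Finset V) ∪ T)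
    (hbT : b ∉ ({x0, w} : Finset V) ∪ T) : EndStructure G x0 a b := by
  obtain ⟨hav, hbv, hne⟩ := emult_pos_mem hab
  have hT' : ∀ v ∈ T, v = a ∧ dcut G {v} = 3 := by
    intro v hv
    have h1 := hT hv
    simp only [cubicEnds, Finset.mem_filter, Finset.mem_insert, Finset.mem_singleton] at h1
    refine ⟨h1.1.resolve_right ?_, h1.2⟩
    rintro rfl
    exact hbT (by simp [hv])
  simp only [Finset.mem_union, Finset.mem_insert, Finset.mem_singleton, not_or] at haT hbT
  have hpair := dcut_pair G hwx.symm
  rcases haT with (haT | haT) | haT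
  · exact absurd haT ha0
  · subst haT
    have hTe : T = ∅ := by
      rw [Finset.eq_empty_iff_forall_notMem]
      intro v hv
      obtain ⟨rfl, -⟩ := hT' v hv
      exact hw3 (hT hv)
    rw [hTe, Finset.union_empty] at h4
    have h3 : dcut G {a} ≠ 3 := fun h3 => hw3 (by simp [cubicEnds, h3])
    have h5 := h.three_le hav
    left
    omega
  · have ha3 := (hT' a haT).2
    have hTe : T = {a} := Finset.eq_singleton_iff_unique_mem.2 ⟨haT, fun v hv => (hT' v hv).1⟩
    have hwa : w ≠ a := by
      rintro rfl
      exact hw3 (hT haT)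
    rw [hTe, Finset.union_comm, ← Finset.insert_eq] at h4
    have hins := dcut_insert G (C := {x0, w}) (a := a) (by simp [ha0, hwa.symm])
    rw [Finset.sum_pair hwx.symm] at hins
    have e1 := h.emult_le_one hav ha0 ha1 ha0.symm ha3
    have e2 := h.emult_le_one hav ha0 ha1 hwa ha3
    have h4' := h.internal {x0, w} (by
      intro v hv
      rw [Finset.mem_insert, Finset.mem_singleton] at hv
      rcases hv with rfl | rfl
      · exact h.mem0
      · exact hw) (by rw [Finset.card_pair hwx.symm]) (card_sdiff_pair (by have := h.card; omega))
    right
    refine ⟨ha3, w, hw, hwx, hwa, fun h => hbT.1.2 h.symm, by omega, by omega, by omega⟩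

lemma Stuck.endStructure (h : Stuck G x0 x1) (hd : dcut G {x0} = 3)
    (hab : 0 < emult G a b) (ha0 : a ≠ x0) (ha1 : a ≠ x1) (hb0 : b ≠ x0) (hb1 : b ≠ x1)
    (hc : 4 ≤ (G.verts \ cubicEnds G a b).card) :
    EndStructure G x0 a b ∨ EndStructure G x0 b a := by
  obtain ⟨hav, hbv, hne⟩ := emult_pos_mem hab
  obtain ⟨H, hH, h3, hout⟩ := h.exists_reduction hab (fun _ => ⟨ha0, ha1⟩) (fun _ => ⟨hb0, hb1⟩) hc
  have hcH : 4 ≤ H.verts.card := by rw [hH.verts]; exact hc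
  have hmem : ∀ r ∈ G.verts, r ≠ a → r ≠ b → r ∈ H.verts := by
    intro r hr hra hrb
    rw [hH.verts]
    exact Finset.mem_sdiff.2 ⟨hr, by simp [cubicEnds, hra, hrb]⟩
  have hx0 := hmem x0 h.mem0 ha0.symm hb0.symm
  have hdx := h.dcut_reduction hab (fun _ => ⟨ha0, ha1⟩) (fun _ => ⟨hb0, hb1⟩) hH hx0
    ha0.symm hb0.symm
  rcases hout with hD | hS
  · have := hD.2 x0 hx0
    omega
  obtain ⟨w, hw, hwx, hdw⟩ := hS.exists_pair hcH hx0 (hmem x1 h.mem1 ha1.symm hb1.symm) h.ne (by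
    intro C _ hxC hdC hdC' _ _
    have := dcut_insert H hxC
    omega)
  obtain ⟨T, hT, h4, hsep⟩ := h.exists_four_cut hab hH (X := {x0, w}) (by
      intro v hv
      rw [Finset.mem_insert, Finset.mem_singleton] at hv
      rcases hv with rfl | rfl
      · exact hx0
      · exact hw) hdw (by rw [Finset.card_pair hwx.symm]) (card_sdiff_pair hcH)
  rw [hH.verts, Finset.mem_sdiff] at hw
  by_cases haT : a ∈ ({x0, w} : Finset V) ∪ T
  · exact Or.inl (h.endStructure_of_fourCut hd hab ha0 ha1 hb0 hw.1 hwx hw.2 hT h4 haT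
      (by tauto))
  · have hcomm : cubicEnds G a b = cubicEnds G b a := by rw [cubicEnds, Finset.pair_comm]; rfl
    rw [hcomm] at hw hT
    rw [emult_comm] at hab
    exact Or.inr (h.endStructure_of_fourCut hd hab hb0 hb1 ha0 hw.1 hwx hw.2 hT h4 (by tauto)
      haT)

lemma Stuck.exists_fourCut_pair (h : Stuck G x0 x1) (hd : 4 ≤ dcut G {x0})
    (hxb : 0 < emult G x0 b) (hb : dcut G {b} = 3 → b ≠ x1) :
    ∃ w ∈ G.verts, w ≠ x0 ∧ w ≠ b ∧ dcut G {x0, w} = 4 := by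
  obtain ⟨-, hbv, hne⟩ := emult_pos_mem hxb
  have hcub : ∀ v ∈ cubicEnds G x0 b, v = b ∧ dcut G {v} = 3 := by
    intro v hv
    simp only [cubicEnds, Finset.mem_filter, Finset.mem_insert, Finset.mem_singleton] at hv
    obtain ⟨rfl | rfl, h3⟩ := hv
    · omega
    · exact ⟨rfl, h3⟩
  have hcuble : (cubicEnds G x0 b).card ≤ 1 :=
    Finset.card_le_one.2 fun u hu v hv => (hcub u hu).1.trans (hcub v hv).1.symm
  have hc : 4 ≤ (G.verts \ cubicEnds G x0 b).card := by
    have := Finset.le_card_sdiff (cubicEnds G x0 b) G.verts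
    have := h.card
    omega
  have hx3 : dcut G {x0} = 3 → x0 ≠ x0 ∧ x0 ≠ x1 := fun h3 => by omega
  have hb3 : dcut G {b} = 3 → b ≠ x0 ∧ b ≠ x1 := fun h3 => ⟨hne.symm, hb h3⟩
  obtain ⟨H, hH, h3, hout⟩ := h.exists_reduction hxb hx3 hb3 hc
  have hcH : 4 ≤ H.verts.card := by rw [hH.verts]; exact hc
  have hHG : H.verts ⊆ G.verts := by rw [hH.verts]; exact Finset.sdiff_subset
  have hmem : ∀ r ∈ G.verts, r ∉ cubicEnds G x0 b → r ∈ H.verts := by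
    intro r hr hr'
    rw [hH.verts]
    exact Finset.mem_sdiff.2 ⟨hr, hr'⟩
  have hx0 : x0 ∈ H.verts := hmem x0 h.mem0 fun h' => hne (hcub _ h').1
  have hx1 : x1 ∈ H.verts := hmem x1 h.mem1 fun h' => by
    have := hcub _ h'
    exact hb (this.1 ▸ this.2) this.1.symm
  have hbH : b ∈ cubicEnds G x0 b → b ∉ H.verts := by
    intro hb' hbH
    rw [hH.verts] at hbH
    exact (Finset.mem_sdiff.1 hbH).2 hb'
  have hsubT : ∀ T ⊆ cubicEnds G x0 b, b ∉ T → T = ∅ := by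
    intro T hT hbT
    rw [Finset.eq_empty_iff_forall_notMem]
    intro v hv
    obtain ⟨rfl, -⟩ := hcub v (hT hv)
    exact hbT hv
  have hsubT' : ∀ T ⊆ cubicEnds G x0 b, b ∈ T → T = {b} := fun T hT hbT =>
    Finset.eq_singleton_iff_unique_mem.2 ⟨hbT, fun v hv => (hcub v (hT hv)).1⟩
  rcases hout with hD | hS
  · exfalso
    obtain ⟨v, hv, hvn⟩ : ∃ v ∈ G.verts, v ∉ ({x0, x1, b} : Finset V) := by
      by_contra hcon
      push Not at hcon
      have := Finset.card_le_card (show G.verts ⊆ {x0, x1, b} from hcon)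
      have := Finset.card_le_three (a := x0) (b := x1) (c := b)
      have := h.card
      omega
    simp only [Finset.mem_insert, Finset.mem_singleton, not_or] at hvn
    obtain ⟨hv0, hv1, hvb⟩ := hvn
    have hvH : v ∈ H.verts := hmem v hv fun h' => hvb (hcub _ h').1
    have hdv := h.dcut_reduction hxb hx3 hb3 hH hvH hv0 hvb
    rw [hD.2 v hvH] at hdv
    have hdK := dcut_deleteEdge hxb {v}
    rw [if_pos (by simp [Ne.symm hv0, Ne.symm hvb])] at hdK
    have key : ∀ w ∈ H.verts, w ≠ v → emult H v w = 2 → dcut G {b} = 3 ∧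
        0 < emult (deleteEdge G s(x0, b)) b v ∧ 0 < emult (deleteEdge G s(x0, b)) b w ∧ w ≠ b := by
      intro w hw hwv he
      have hpH := dcut_pair H hwv.symm
      rw [he, hD.2 v hvH, hD.2 w hw] at hpH
      have hpK := dcut_pair (deleteEdge G s(x0, b)) hwv.symm
      have hwK := hH.cut_le {w} (by simpa using hw) ∅ (by simp)
      rw [Finset.union_empty, hD.2 w hw] at hwK
      have hlt := h.lt_half v hv hv0 hv1 w hwv
      rw [← hdv] at hlt
      rw [emult_deleteEdge_of_ne (by simp [hv0, hvb])] at hpK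
      have hvw : ({v, w} : Finset V) ⊆ H.verts := by
        intro u hu
        rw [Finset.mem_insert, Finset.mem_singleton] at hu
        rcases hu with rfl | rfl <;> assumption
      obtain ⟨T, hT, hdT⟩ := hH.cut_eq _ hvw
      by_cases hbT : b ∈ T
      · have hb3' := (hcub b (hT hbT)).2
        have hwb : w ≠ b := by
          rintro rfl
          exact hbH (hT hbT) hw
        rw [hsubT' T hT hbT, Finset.union_comm, ← Finset.insert_eq] at hdT
        have hins := dcut_insert (deleteEdge G s(x0, b)) (C := {v, w}) (a := b)
          (by simp [Ne.symm hvb, hwb.symm])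
        rw [Finset.sum_pair hwv.symm] at hins
        have hbK := dcut_deleteEdge hxb {b}
        rw [if_neg (by simp [hne])] at hbK
        have e1 := h.emult_le_one hbv (hb3 hb3').1 (hb3 hb3').2 hvb hb3'
        have e2 := h.emult_le_one hbv (hb3 hb3').1 (hb3 hb3').2 hwb hb3'
        have e3 : emult (deleteEdge G s(x0, b)) b v ≤ emult G b v :=
          Multiset.count_le_of_le _ (Multiset.erase_le _ _)
        have e4 : emult (deleteEdge G s(x0, b)) b w ≤ emult G b w :=
          Multiset.count_le_of_le _ (Multiset.erase_le _ _)
        exact ⟨hb3', by omega, by omega, hwb⟩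
      · rw [hsubT T hT hbT, Finset.union_empty] at hdT
        omega
    obtain ⟨w1, hw1, hw1v, -, he1⟩ := hD.exists_doubled hvH hx0 (Ne.symm hv0)
    obtain ⟨w2, hw2, hw2v, hw21, he2⟩ := hD.exists_doubled hvH hw1 hw1v
    obtain ⟨hb3', k1, k2, k3⟩ := key w1 hw1 hw1v he1
    obtain ⟨-, -, k4, k5⟩ := key w2 hw2 hw2v he2
    have hsum := sum_emult_le (deleteEdge G s(x0, b)) (C := {v, w1, w2}) (a := b)
      (by simp [Ne.symm hvb, k3.symm, k5.symm])
    rw [Finset.sum_insert (by simp [hw1v.symm, hw2v.symm]), Finset.sum_pair hw21.symm] at hsum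
    have hbK := dcut_deleteEdge hxb {b}
    rw [if_neg (by simp [hne])] at hbK
    omega
  · have hmid : ∀ C ⊆ H.verts, x0 ∉ C → dcut H C = 3 → dcut H (insert x0 C) = 3 → 2 ≤ C.card →
        2 ≤ (H.verts \ insert x0 C).card → False := by
      intro C hC hxC hdC hdx hC2 hC3
      have hins : insert x0 C ⊆ H.verts := Finset.insert_subset hx0 hC
      have hle : (H.verts \ insert x0 C).card ≤ (H.verts \ C).card :=
        Finset.card_le_card (Finset.sdiff_subset_sdiff subset_rfl (Finset.subset_insert _ _))
      obtain ⟨T, hT, h4, hs⟩ := h.exists_four_cut hxb hH hC hdC hC2 (hC3.trans hle)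
      obtain ⟨T', hT', h4', hs'⟩ := h.exists_four_cut hxb hH hins hdx
        (hC2.trans (Finset.card_le_card (Finset.subset_insert _ _))) hC3
      have hxT : x0 ∉ C ∪ T := by
        rw [Finset.mem_union]
        rintro (h' | h')
        · exact hxC h'
        · exact hne (hcub _ (hT h')).1
      have hbT : b ∈ C ∪ T := by tauto
      have hbT' : b ∉ insert x0 C ∪ T' := fun h' => hs' (iff_of_true (by simp) h')
      simp only [Finset.mem_union, Finset.mem_insert, not_or] at hbT hbT'
      have hbT := hbT.resolve_left hbT'.1.2
      rw [hsubT' T hT hbT, Finset.union_comm, ← Finset.insert_eq] at h4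
      rw [hsubT T' hT' hbT'.2, Finset.union_empty] at h4'
      have hbd := (hcub b (hT hbT)).2
      have hbnH := hbH (hT hbT)
      have hcl : H.verts \ insert x0 C ⊆ G.verts \ insert b (insert x0 C) := by
        intro v hv
        rw [Finset.mem_sdiff] at hv ⊢
        refine ⟨hHG hv.1, ?_⟩
        rw [Finset.mem_insert]
        rintro (rfl | h')
        · exact hbnH hv.1
        · exact hv.2 h'
      have c1 := h.internal C (hC.trans hHG) hC2
        ((hC3.trans hle).trans (Finset.card_le_card (Finset.sdiff_subset_sdiff hHG subset_rfl)))
      have c2 := h.internal (insert b (insert x0 C))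
        (Finset.insert_subset hbv (hins.trans hHG))
        (hC2.trans (Finset.card_le_card
          ((Finset.subset_insert _ _).trans (Finset.subset_insert _ _))))
        (hC3.trans (Finset.card_le_card hcl))
      have d1 := dcut_insert G (C := C) (a := b) hbT'.1.2
      have d2 := dcut_insert G (C := insert x0 C) (a := b) (by simp [hbT'.1])
      rw [Finset.sum_insert hxC] at d2
      omega
    obtain ⟨w, hw, hwx, hdw⟩ := hS.exists_pair hcH hx0 hx1 h.ne hmid
    obtain ⟨T, hT, h4, hsep⟩ := h.exists_four_cut hxb hH (X := {x0, w}) (by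
      intro v hv
      rw [Finset.mem_insert, Finset.mem_singleton] at hv
      rcases hv with rfl | rfl
      · exact hx0
      · exact hw) hdw (by rw [Finset.card_pair hwx.symm]) (card_sdiff_pair hcH)
    have hbT : b ∉ ({x0, w} : Finset V) ∪ T := fun h' => hsep (iff_of_true (by simp) h')
    simp only [Finset.mem_union, Finset.mem_insert, Finset.mem_singleton, not_or] at hbT
    rw [hsubT T hT hbT.2, Finset.union_empty] at h4
    exact ⟨w, hHG hw, hwx, fun h' => hbT.1.2 h'.symm, h4⟩

end

section

variable {G H : MG V} {x0 x1 a b : V}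

lemma sdiff_cubicEnds_card (h : Stuck G x0 x1)
    (hv : 6 ≤ G.verts.card ∨ dcut G {a} ≠ 3 ∨ dcut G {b} ≠ 3) :
    4 ≤ (G.verts \ cubicEnds G a b).card := by
  have h1 := Finset.le_card_sdiff (cubicEnds G a b) G.verts
  have h5 := h.card
  rcases hv with hv | hv
  · have : (cubicEnds G a b).card ≤ 2 := (Finset.card_filter_le _ _).trans Finset.card_le_two
    omega
  · have : (cubicEnds G a b).card ≤ 1 := by
      rw [Finset.card_le_one]
      intro u hu v hv
      simp only [cubicEnds, Finset.mem_filter, Finset.mem_insert, Finset.mem_singleton] at hu hv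
      obtain ⟨rfl | rfl, hu⟩ := hu <;> obtain ⟨rfl | rfl, hv⟩ := hv <;> tauto
    omega

lemma exists_emult_pos {v : V} {S : Finset V} (hv : v ∈ G.verts)
    (hS : ∑ u ∈ S, emult G v u < dcut G {v}) :
    ∃ u ∈ G.verts, u ≠ v ∧ u ∉ S ∧ 0 < emult G v u := by
  by_contra hcon
  push Not at hcon
  have h1 := sum_emult_eq G hv
  have h2 : ∑ c ∈ G.verts.erase v, emult G v c ≤ ∑ u ∈ S, emult G v u := by
    rw [← Finset.sum_filter_add_sum_filter_not (G.verts.erase v) (· ∈ S)]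
    have h3 : ∑ c ∈ (G.verts.erase v).filter (fun c => ¬ c ∈ S), emult G v c = 0 := by
      apply Finset.sum_eq_zero
      intro c hc
      rw [Finset.mem_filter, Finset.mem_erase] at hc
      have := hcon c hc.1.2 hc.1.1 hc.2
      omega
    rw [h3, add_zero]
    apply Finset.sum_le_sum_of_subset
    intro c hc
    exact (Finset.mem_filter.1 hc).2
  omega

lemma Stuck.exists_nonroot_neighbour (h : Stuck G x0 x1) {v : V} (hv : v ∈ G.verts)
    (h0 : v ≠ x0) (h1 : v ≠ x1) : ∃ u ∈ G.verts, u ≠ v ∧ u ≠ x0 ∧ u ≠ x1 ∧ 0 < emult G v u := by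
  obtain ⟨u, hu, huv, huS, hp⟩ := exists_emult_pos (S := {x0, x1}) hv (by
    rw [Finset.sum_pair h.ne]
    have := h.lt_half v hv h0 h1 x0 h0.symm
    have := h.lt_half v hv h0 h1 x1 h1.symm
    omega)
  simp only [Finset.mem_insert, Finset.mem_singleton, not_or] at huS
  exact ⟨u, hu, huv, huS.1, huS.2, hp⟩

lemma Stuck.exists_reducible_edge (h : Stuck G x0 x1) (heven : Even (dcut G {x0, x1})) :
    ∃ a b, a ≠ x0 ∧ a ≠ x1 ∧ b ≠ x0 ∧ b ≠ x1 ∧ 0 < emult G a b ∧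
      4 ≤ (G.verts \ cubicEnds G a b).card := by
  by_contra hcon
  push Not at hcon
  have hsub : ({x0, x1} : Finset V) ⊆ G.verts := by
    intro v hv
    rw [Finset.mem_insert, Finset.mem_singleton] at hv
    rcases hv with rfl | rfl
    · exact h.mem0
    · exact h.mem1
  have hcub : ∀ v ∈ G.verts \ {x0, x1}, dcut G {v} = 3 ∧ ¬ 6 ≤ G.verts.card := by
    intro v hv
    simp only [Finset.mem_sdiff, Finset.mem_insert, Finset.mem_singleton, not_or] at hv
    obtain ⟨u, hu, huv, hu0, hu1, hp⟩ := h.exists_nonroot_neighbour hv.1 hv.2.1 hv.2.2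
    have h1 := hcon v u hv.2.1 hv.2.2 hu0 hu1 hp
    by_contra h2
    have := sdiff_cubicEnds_card (a := v) (b := u) h (by tauto)
    omega
  have hcS := Finset.card_sdiff_of_subset hsub
  rw [Finset.card_pair h.ne] at hcS
  have h5 := h.card
  obtain ⟨v, hv⟩ := Finset.card_pos.1 (show 0 < (G.verts \ {x0, x1}).card by omega)
  have h6 := (hcub v hv).2
  obtain ⟨p, q, r, hpq, hpr, hqr, hS⟩ := Finset.card_eq_three.1
    (show (G.verts \ {x0, x1}).card = 3 by omega)
  rw [hS] at hcub
  rw [← dcut_compl, hS] at heven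
  have dp := (hcub p (by simp)).1
  have dq := (hcub q (by simp)).1
  have dr := (hcub r (by simp)).1
  have e1 := dcut_insert G (C := {q, r}) (a := p) (by simp [hpq, hpr])
  have e2 := dcut_pair G hqr
  obtain ⟨m, hm⟩ := heven
  omega

lemma emult_add_le {u v w : V} (huv : u ≠ v) (huw : u ≠ w) (hvw : v ≠ w) :
    emult G u v + emult G u w ≤ dcut G {u} := by
  have := sum_emult_le G (C := {v, w}) (a := u) (by simp [huv, huw])
  rwa [Finset.sum_pair hvw] at this

lemma Stuck.dcut_root_eq (h : Stuck G x0 x1) : dcut G {x0} = 3 := by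
  by_contra hd
  have hd4 : 4 ≤ dcut G {x0} := by
    have := h.three_le h.mem0
    omega
  have key : ∀ b, 0 < emult G x0 b → (dcut G {b} = 3 → b ≠ x1) →
      b ≠ x1 ∧ 4 + 2 * emult G x0 x1 = dcut G {x0} + dcut G {x1} := by
    intro b hb hb3
    obtain ⟨w, hw, hwx, hwb, h4⟩ := h.exists_fourCut_pair hd4 hb hb3
    have hp := dcut_pair G hwx.symm
    by_cases hw1 : w = x1
    · subst hw1
      exact ⟨hwb.symm, by omega⟩
    · have := h.lt_half w hw hwx hw1 x0 hwx.symm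
      rw [emult_comm] at this
      omega
  have hd1 := h.three_le h.mem1
  have hle1 : emult G x0 x1 ≤ dcut G {x1} := by
    rw [emult_comm]
    exact emult_le_dcut G h.ne.symm
  by_cases hd13 : dcut G {x1} = 3
  · obtain ⟨b, hb, hbx, hbS, hp⟩ := exists_emult_pos (S := {x1}) h.mem0 (by
      rw [Finset.sum_singleton]
      omega)
    have hk := (key b hp fun _ => by simpa using hbS).2
    have h0 := dcut_pair G h.ne
    obtain ⟨a, b, ha0, ha1, hb0, hb1, hab, hc⟩ := h.exists_reducible_edge
      (show Even (dcut G {x0, x1}) from ⟨2, by omega⟩)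
    have hno : ∀ a b, a ≠ x0 → a ≠ x1 → ¬ EndStructure G x1 a b := by
      rintro a b ha0 ha1 (⟨h1, h2⟩ | ⟨h1, w, hw, hwx, hwa, hwb, e1, e2, h2⟩)
      · have := emult_add_le (G := G) (u := x1) ha1.symm h.ne.symm ha0
        rw [emult_comm G x1 x0] at this
        omega
      · by_cases hw0 : w = x0
        · subst hw0
          rw [emult_comm G x1 w] at h2
          omega
        · have := sum_emult_le G (C := {a, x0, w}) (a := x1) (by simp [ha1.symm, h.ne.symm, hwx.symm])
          rw [Finset.sum_insert (by simp [ha0, hwa.symm]), Finset.sum_pair (Ne.symm hw0),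
            emult_comm G x1 a, emult_comm G x1 x0] at this
          have := h.three_le hw
          omega
    rcases h.symm.endStructure hd13 hab ha1 ha0 hb1 hb0 hc with h' | h'
    · exact hno a b ha0 ha1 h'
    · exact hno b a hb0 hb1 h'
  · by_cases hp : 0 < emult G x0 x1
    · exact (key x1 hp fun h3 => absurd h3 hd13).1 rfl
    · obtain ⟨b, hb, hbx, -, hp⟩ := exists_emult_pos (S := ∅) h.mem0 (by
        rw [Finset.sum_empty]
        omega)
      have hbx1 : b ≠ x1 := by
        rintro rfl
        omega
      have := (key b hp fun _ => hbx1).2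
      omega

lemma Stuck.endStructure_eq (h : Stuck G x0 x1) (hab : 0 < emult G a b) (ha0 : a ≠ x0)
    (ha1 : a ≠ x1) (h' : EndStructure G x0 a b) :
    4 ≤ dcut G {a} ∧ dcut G {a} = 2 * emult G x0 a + 1 := by
  rcases h' with h' | ⟨ha3, w, hw, hwx, hwa, hwb, e1, e2, h2⟩
  · exact h'
  exfalso
  have hd0 := h.dcut_root_eq
  have hd1 := h.symm.dcut_root_eq
  have hw1 : w ≠ x1 := by
    rintro rfl
    omega
  have hw3 := h.three_le hw
  obtain ⟨hav, hbv, hne⟩ := emult_pos_mem hab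
  rcases h.symm.endStructure hd1 (by omega : 0 < emult G a w) ha1 ha0 hw1 hwx
    (sdiff_cubicEnds_card h (Or.inr (Or.inr (by omega)))) with
    (⟨h3, -⟩ | ⟨-, u, hu, hux, hua, huw, f1, f2, h4⟩) | (⟨-, h3⟩ | ⟨h3, -⟩)
  · omega
  · by_cases hu0 : u = x0
    · subst hu0
      omega
    · have := sum_emult_le G (C := {x0, w, x1, u}) (a := a) (by simp [ha0, ha1, hwa.symm, hua.symm])
      rw [Finset.sum_insert (by simp [hwx.symm, h.ne, Ne.symm hu0]),
        Finset.sum_insert (by simp [hw1, huw.symm]), Finset.sum_pair hux.symm] at this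
      omega
  · omega
  · omega

/-- No graph escapes all the reductions. -/
lemma Stuck.false (h : Stuck G x0 x1) : False := by
  have hd0 := h.dcut_root_eq
  have hd1 := h.symm.dcut_root_eq
  have hp := dcut_pair G h.ne
  have hk : emult G x0 x1 ≤ 3 := hd0 ▸ emult_le_dcut G h.ne
  have key : ∀ a b, a ≠ x0 → a ≠ x1 → b ≠ x0 → b ≠ x1 → 0 < emult G a b →
      4 ≤ (G.verts \ cubicEnds G a b).card →
      (∃ c, (c = a ∨ c = b) ∧ 4 ≤ dcut G {c} ∧ dcut G {c} = 2 * emult G x0 c + 1) ∧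
      (∃ c, (c = a ∨ c = b) ∧ 4 ≤ dcut G {c} ∧ dcut G {c} = 2 * emult G x1 c + 1) := by
    intro a b ha0 ha1 hb0 hb1 hab hc
    have hba := hab
    rw [emult_comm] at hba
    constructor
    · rcases h.endStructure hd0 hab ha0 ha1 hb0 hb1 hc with h' | h'
      · exact ⟨a, Or.inl rfl, h.endStructure_eq hab ha0 ha1 h'⟩
      · exact ⟨b, Or.inr rfl, h.endStructure_eq hba hb0 hb1 h'⟩
    · rcases h.symm.endStructure hd1 hab ha1 ha0 hb1 hb0 hc with h' | h'
      · exact ⟨a, Or.inl rfl, h.symm.endStructure_eq hab ha1 ha0 h'⟩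
      · exact ⟨b, Or.inr rfl, h.symm.endStructure_eq hba hb1 hb0 h'⟩
  obtain ⟨a, b, ha0, ha1, hb0, hb1, hab, hc⟩ := h.exists_reducible_edge
    (show Even (dcut G {x0, x1}) from ⟨3 - emult G x0 x1, by omega⟩)
  obtain ⟨⟨c0, hc0, h40, hj0⟩, ⟨c1, hc1, h41, hj1⟩⟩ := key a b ha0 ha1 hb0 hb1 hab hc
  obtain ⟨hav, hbv, hne⟩ := emult_pos_mem hab
  have hroot : ∀ c, (c = a ∨ c = b) → c ∈ G.verts ∧ c ≠ x0 ∧ c ≠ x1 := by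
    rintro c (rfl | rfl)
    · exact ⟨hav, ha0, ha1⟩
    · exact ⟨hbv, hb0, hb1⟩
  obtain ⟨hc0v, hc00, hc01⟩ := hroot c0 hc0
  obtain ⟨hc1v, hc10, hc11⟩ := hroot c1 hc1
  have h5 := h.card
  by_cases hcc : c0 = c1
  · subst hcc
    have hins := dcut_insert G (C := {x0, x1}) (a := c0) (by simp [hc00, hc01])
    rw [Finset.sum_pair h.ne, emult_comm G c0 x0, emult_comm G c0 x1] at hins
    have hsub : ({c0, x0, x1} : Finset V) ⊆ G.verts := by
      intro v hv
      simp only [Finset.mem_insert, Finset.mem_singleton] at hv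
      rcases hv with rfl | rfl | rfl
      · exact hc0v
      · exact h.mem0
      · exact h.mem1
    have hcard : ({c0, x0, x1} : Finset V).card = 3 := by
      rw [Finset.card_insert_of_notMem (by simp [hc00, hc01]), Finset.card_pair h.ne]
    have := h.internal _ hsub (by omega) (by rw [Finset.card_sdiff_of_subset hsub]; omega)
    omega
  · obtain ⟨v, hv, hvn⟩ : ∃ v ∈ G.verts, v ∉ ({x0, x1, c0, c1} : Finset V) := by
      by_contra hcon
      push Not at hcon
      have := Finset.card_le_card (show G.verts ⊆ {x0, x1, c0, c1} from hcon)
      have := Finset.card_le_four (a := x0) (b := x1) (c := c0) (d := c1)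
      omega
    simp only [Finset.mem_insert, Finset.mem_singleton, not_or] at hvn
    obtain ⟨hv0, hv1, hvc0, hvc1⟩ := hvn
    obtain ⟨u, hu, huv, hu0, hu1, hvu⟩ := h.exists_nonroot_neighbour hv hv0 hv1
    have hvalid : 6 ≤ G.verts.card ∨ dcut G {v} ≠ 3 ∨ dcut G {u} ≠ 3 := by
      by_contra hcon
      push Not at hcon
      obtain ⟨h6, -, hu3⟩ := hcon
      have huc0 : u ≠ c0 := by
        rintro rfl
        omega
      have huc1 : u ≠ c1 := by
        rintro rfl
        omega
      have hsub : ({x0, x1, c0, c1, v, u} : Finset V) ⊆ G.verts := by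
        intro w hw
        simp only [Finset.mem_insert, Finset.mem_singleton] at hw
        rcases hw with rfl | rfl | rfl | rfl | rfl | rfl
        exacts [h.mem0, h.mem1, hc0v, hc1v, hv, hu]
      have hcard := Finset.card_le_card hsub
      rw [Finset.card_insert_of_notMem (by simp [h.ne, hc00.symm, hc10.symm, Ne.symm hv0, hu0.symm]),
        Finset.card_insert_of_notMem (by simp [hc01.symm, hc11.symm, Ne.symm hv1, hu1.symm]),
        Finset.card_insert_of_notMem (by simp [hcc, Ne.symm hvc0, huc0.symm]),
        Finset.card_insert_of_notMem (by simp [Ne.symm hvc1, huc1.symm]),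
        Finset.card_pair huv.symm] at hcard
      omega
    obtain ⟨⟨d0, hd0', h40', hj0'⟩, ⟨d1, hd1', h41', hj1'⟩⟩ :=
      key v u hv0 hv1 hu0 hu1 hvu (sdiff_cubicEnds_card h hvalid)
    have hdr : ∀ d, (d = v ∨ d = u) → d ≠ x0 ∧ d ≠ x1 := by
      rintro d (rfl | rfl)
      · exact ⟨hv0, hv1⟩
      · exact ⟨hu0, hu1⟩
    have e0 : d0 = c0 := by
      by_contra hne0
      have := emult_add_le (G := G) (hdr d0 hd0').1.symm hc00.symm hne0
      omega
    have e1 : d1 = c1 := by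
      by_contra hne1
      have := emult_add_le (G := G) (hdr d1 hd1').2.symm hc11.symm hne1
      omega
    subst e0 e1
    have := hd0'.resolve_left (Ne.symm hvc0)
    have := hd1'.resolve_left (Ne.symm hvc1)
    apply hcc
    simp [*]

/-- Every `3`-edge-connected graph with at least four vertices and two roots is resolved. -/
lemma resolved (n : ℕ) : ∀ (G : MG V) (x0 x1 : V), G.verts.card + G.edges.card = n →
    EdgeConn G 3 → 4 ≤ G.verts.card → x0 ∈ G.verts → x1 ∈ G.verts → x0 ≠ x1 →
    Resolved G x0 x1 := by
  induction n using Nat.strong_induction_on with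
  | _ n ih =>
    intro G x0 x1 hn h3 hc hx0 hx1 hne
    have hs : SmallerResolved G := by
      intro H y0 y1 hlt
      exact ih _ (hn ▸ hlt) H y0 y1 rfl
    by_cases h4 : InternallyEdgeConn G 4
    · by_cases hc4 : G.verts.card = 4
      · rcases immersion_or_doubledRegular_of_card_eq_four h3 h4 hc4 hx0 hx1 hne with h | h
        · exact Or.inl h
        · exact Or.inr (Or.inl h)
      by_cases hhalf : ∃ v ∈ G.verts, v ≠ x0 ∧ v ≠ x1 ∧ ∃ u ∈ G.verts, u ≠ v ∧
          dcut G {v} ≤ 2 * emult G u v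
      · obtain ⟨v, hv, hv0, hv1, u, hu, huv, hle⟩ := hhalf
        exact resolved_of_half hs h3 h4 (by omega) hx0 hx1 hne hu hv hv0 hv1 huv hle
      by_cases hI : HasRootedDmImmersion G 3 x0 x1
      · exact Or.inl hI
      push Not at hhalf
      have hstuck : Stuck G x0 x1 := by
        refine ⟨h3, h4, by omega, hx0, hx1, hne, hI, ?_, hs⟩
        intro v hv hv0 hv1 u huv
        rw [emult_comm]
        by_cases hu : u ∈ G.verts
        · exact hhalf v hv hv0 hv1 u hu huv
        · have h0 : emult G u v = 0 := by
            by_contra h'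
            exact hu (emult_pos_mem (Nat.pos_of_ne_zero h')).1
          have := h3 {v} (by simpa using hv) (by simp) (by
            intro he
            rw [← he] at hc
            simp at hc)
          omega
      exact hstuck.false.elim
    · simp only [InternallyEdgeConn] at h4
      push Not at h4
      obtain ⟨X, hX, h2, h2', hd⟩ := h4
      have := h3 X hX (Finset.card_pos.1 (by omega)) (by
        rintro rfl
        simp at h2')
      exact resolved_of_threeCut hs h3 hX (by omega) h2 h2' hx0 hx1 hne

end

/-- A walk crosses a cut an odd number of times exactly when it separates the ends. -/
lemma cutSize_walkEdges_mod_two (X : Finset V) : ∀ (l : List V) {u v : V}, IsWalk l u v →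
    cutSize (walkEdges l) X % 2 = if (u ∈ X ↔ v ∈ X) then 0 else 1
  | [], _, _, h => by simp [IsWalk] at h
  | [a], u, v, h => by
    obtain ⟨h1, h2⟩ := h
    simp only [List.head?_cons, Option.some.injEq, List.getLast?_singleton] at h1 h2
    subst h1 h2
    simp [walkEdges_singleton, cutSize_zero]
  | a :: b :: l, u, v, h => by
    obtain ⟨h1, h2⟩ := h
    simp only [List.head?_cons, Option.some.injEq] at h1
    subst h1
    rw [List.getLast?_cons_cons] at h2
    have ih := cutSize_walkEdges_mod_two X (b :: l) (u := b) (v := v) ⟨rfl, h2⟩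
    rw [walkEdges_cons_cons, cutSize_cons]
    by_cases ha : a ∈ X <;> by_cases hb : b ∈ X <;> by_cases hv : v ∈ X <;>
      simp only [ha, hb, hv, iff_true, iff_false, not_true, if_true, if_false] at ih ⊢ <;>
      omega

/-- Edge-disjoint walks modelled on the edges of `H` meet a cut at least as often as `H` does. -/
lemma cutSize_le_of_walks {φ : W → V} {X : Finset V} {S : Finset W} (hS : ∀ w, w ∈ S ↔ φ w ∈ X)
    (P : Multiset (Sym2 W × List V))
    (hP : ∀ p ∈ P, ∃ u v : W, p.1 = s(u, v) ∧ IsWalk p.2 (φ u) (φ v)) :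
    cutSize (P.map Prod.fst) S ≤ cutSize (P.map fun p => walkEdges p.2).sum X := by
  induction P using Multiset.induction with
  | empty => simp [cutSize_zero]
  | cons p P ih =>
    have ih := ih fun q hq => hP q (Multiset.mem_cons_of_mem hq)
    obtain ⟨u, v, h1, h2⟩ := hP p (Multiset.mem_cons_self p P)
    have h3 := cutSize_walkEdges_mod_two X _ h2
    rw [Multiset.map_cons, Multiset.map_cons, Multiset.sum_cons, cutSize_add, h1, cutSize_cons]
    simp only [hS]
    split_ifs at h3 ⊢ <;> omega

lemma ImmersionVia.cutSize_le {G : MG V} {H : Multiset (Sym2 W)} {φ : W → V}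
    (h : ImmersionVia G H φ) {X : Finset V} {S : Finset W} (hS : ∀ w, w ∈ S ↔ φ w ∈ X) :
    cutSize H S ≤ dcut G X := by
  obtain ⟨-, -, P, rfl, hP, hle⟩ := h
  rw [dcut_eq_cutSize]
  exact (cutSize_le_of_walks hS P hP).trans (cutSize_mono hle X)

lemma cutSize_dmEdges_three {S : Finset (Fin 4)} (hS : S.card = 2) : cutSize (dmEdges 3) S = 4 := by
  have h : dmEdges 3 = s(0, 1) ::ₘ s(0, 2) ::ₘ s(0, 3) ::ₘ s(1, 2) ::ₘ s(1, 3) ::ₘ s(2, 3) ::ₘ 0 :=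
    rfl
  have hc : S.card = ∑ w, if w ∈ S then 1 else 0 := by simp
  rw [hS, Fin.sum_univ_four] at hc
  simp only [h, cutSize_cons, cutSize_zero]
  by_cases h0 : (0 : Fin 4) ∈ S <;> by_cases h1 : (1 : Fin 4) ∈ S <;>
    by_cases h2 : (2 : Fin 4) ∈ S <;> by_cases h3 : (3 : Fin 4) ∈ S <;>
    simp [h0, h1, h2, h3] at hc ⊢

/-- The terminals of an immersion of `D_3` in a set. -/
def terminalsIn (φ : Fin 4 → V) (X : Finset V) : Finset (Fin 4) := Finset.univ.filter fun w => φ w ∈ X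

lemma card_terminalsIn_ne_two {G : MG V} {φ : Fin 4 → V} (h : ImmersionVia G (dmEdges 3) φ)
    {X : Finset V} (hX : dcut G X = 3) : (terminalsIn φ X).card ≠ 2 := by
  intro h2
  have h4 := h.cutSize_le (X := X) (S := terminalsIn φ X) (by simp [terminalsIn])
  rw [cutSize_dmEdges_three h2] at h4
  omega

lemma card_terminalsIn_insert_le {φ : Fin 4 → V} (hφ : Function.Injective φ) (X : Finset V) (v : V) :
    (terminalsIn φ (insert v X)).card ≤ (terminalsIn φ X).card + 1 := by
  have : terminalsIn φ (insert v X) ⊆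
      (Finset.univ.filter fun w => φ w = v) ∪ terminalsIn φ X := by
    intro w
    simp [terminalsIn]
  have h1 : (Finset.univ.filter fun w => φ w = v).card ≤ 1 :=
    Finset.card_le_one.2 fun a ha b hb => hφ (by simp at ha hb; rw [ha, hb])
  have := (Finset.card_le_card this).trans (Finset.card_union_le _ _)
  omega

lemma Chain.card_terminalsIn_le_one {G : MG V} {φ : Fin 4 → V} (h : ImmersionVia G (dmEdges 3) φ)
    {X Z : Finset V} (hc : Chain G X Z) (hX : (terminalsIn φ X).card ≤ 1) :
    (terminalsIn φ Z).card ≤ 1 := by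
  induction hc with
  | refl => exact hX
  | tail _ hs ih =>
    obtain ⟨-, hd, v, -, rfl⟩ := hs
    have := card_terminalsIn_insert_le h.1 ‹Finset V› v
    have := card_terminalsIn_ne_two h hd
    omega

lemma card_terminalsIn_add_compl {G : MG V} {φ : Fin 4 → V} (hφ : ∀ w, φ w ∈ G.verts)
    (X : Finset V) : (terminalsIn φ X).card + (terminalsIn φ (G.verts \ X)).card = 4 := by
  have : terminalsIn φ (G.verts \ X) = (terminalsIn φ X)ᶜ := by
    ext w
    simp [terminalsIn, hφ]
  rw [this, Finset.card_compl, Fintype.card_fin]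
  have := Finset.card_le_univ (terminalsIn φ X)
  simp at this
  omega

lemma exists_root_of_two_lt_card_terminalsIn {φ : Fin 4 → V} (hφ : Function.Injective φ)
    {X : Finset V} (h : 2 < (terminalsIn φ X).card) : 3 ≤ X.card ∧ (φ 0 ∈ X ∨ φ 1 ∈ X) := by
  constructor
  · have : (terminalsIn φ X).image φ ⊆ X := by
      intro v
      simp only [terminalsIn, Finset.mem_image, Finset.mem_filter]
      rintro ⟨w, ⟨-, hw⟩, rfl⟩
      exact hw
    have := Finset.card_le_card this
    rw [Finset.card_image_of_injective _ hφ] at this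
    omega
  · by_contra! hn
    have : terminalsIn φ X ⊆ {2, 3} := by
      intro w hw
      simp only [terminalsIn, Finset.mem_filter] at hw
      fin_cases w <;> simp_all
    have := Finset.card_le_card this
    simp at this
    omega

lemma HasSegmentation.not_immersion {G : MG V} {x0 x1 : V} {X0 X1 : Finset V}
    (h : HasSegmentation G X0 X1 3) (h0 : 3 ≤ X0.card → x0 ∉ X0 ∧ x1 ∉ X0)
    (h1 : 3 ≤ X1.card → x0 ∉ X1 ∧ x1 ∉ X1) : ¬ HasRootedDmImmersion G 3 x0 x1 := by
  rintro ⟨φ, rfl, rfl, hφ⟩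
  obtain ⟨Z, -, hd, hc, rfl⟩ := h.exists_chain
  by_cases hX : (terminalsIn φ X0).card ≤ 1
  · have hZ := hc.card_terminalsIn_le_one hφ hX
    have := card_terminalsIn_add_compl hφ.2.1 Z
    obtain ⟨h3, h4⟩ := exists_root_of_two_lt_card_terminalsIn hφ.1
      (X := G.verts \ Z) (by omega)
    have := h1 h3
    tauto
  · have := card_terminalsIn_ne_two hφ hd
    obtain ⟨h3, h4⟩ := exists_root_of_two_lt_card_terminalsIn hφ.1 (X := X0) (by omega)
    have := h0 h3
    tauto

lemma sum_count_walkEdges_mod_two {l : List (Fin 4)} {a b : Fin 4}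
    (h : ∃ u v, s(a, b) = s(u, v) ∧ IsWalk l u v) (w : Fin 4) :
    (∑ c ∈ Finset.univ.erase w, (walkEdges l).count s(w, c)) % 2 =
      if (a = w ↔ b = w) then 0 else 1 := by
  obtain ⟨u, v, huv, hl⟩ := h
  have h := sum_count_eq_cutSize (E := walkEdges l) (fun _ _ v _ => Finset.mem_univ v)
    (Finset.mem_univ w)
  have h' := cutSize_walkEdges_mod_two {w} _ hl
  rw [← h] at h'
  simp only [Finset.mem_singleton] at h'
  trans (if (u = w ↔ v = w) then 0 else 1)
  · convert h' using 2
    exact Finset.sum_congr (by congr!) fun _ _ => by congr!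
  rcases Sym2.eq_iff.1 huv with ⟨rfl, rfl⟩ | ⟨rfl, rfl⟩
  · rfl
  · simp only [iff_comm]

/-- The parities of the usage, by a walk with given ends, of the four edges of a four-cycle
`0, 1, 2, 3` (possibly with loops). -/
lemma count_walkEdges_fourCycle {l : List (Fin 4)} {a b : Fin 4}
    (h : ∃ u v, s(a, b) = s(u, v) ∧ IsWalk l u v)
    (h02 : (walkEdges l).count s(0, 2) = 0) (h13 : (walkEdges l).count s(1, 3) = 0) :
    ((walkEdges l).count s(0, 1) + (walkEdges l).count s(0, 3)) % 2 =
        (if (a = 0 ↔ b = 0) then 0 else 1) ∧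
      ((walkEdges l).count s(0, 1) + (walkEdges l).count s(1, 2)) % 2 =
        (if (a = 1 ↔ b = 1) then 0 else 1) ∧
      ((walkEdges l).count s(1, 2) + (walkEdges l).count s(2, 3)) % 2 =
        (if (a = 2 ↔ b = 2) then 0 else 1) ∧
      ((walkEdges l).count s(2, 3) + (walkEdges l).count s(0, 3)) % 2 =
        (if (a = 3 ↔ b = 3) then 0 else 1) := by
  have e0 : (Finset.univ.erase (0 : Fin 4)) = {1, 2, 3} := by ext i; fin_cases i <;> simp
  have e1 : (Finset.univ.erase (1 : Fin 4)) = {0, 2, 3} := by ext i; fin_cases i <;> simp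
  have e2 : (Finset.univ.erase (2 : Fin 4)) = {0, 1, 3} := by ext i; fin_cases i <;> simp
  have e3 : (Finset.univ.erase (3 : Fin 4)) = {0, 1, 2} := by ext i; fin_cases i <;> simp
  have k0 := sum_count_walkEdges_mod_two h 0
  have k1 := sum_count_walkEdges_mod_two h 1
  have k2 := sum_count_walkEdges_mod_two h 2
  have k3 := sum_count_walkEdges_mod_two h 3
  rw [e0, Finset.sum_insert (by simp), Finset.sum_pair (by simp)] at k0
  rw [e1, Finset.sum_insert (by simp), Finset.sum_pair (by simp)] at k1
  rw [e2, Finset.sum_insert (by simp), Finset.sum_pair (by simp)] at k2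
  rw [e3, Finset.sum_insert (by simp), Finset.sum_pair (by simp)] at k3
  rw [Sym2.eq_swap (a := 1) (b := 0)] at k1
  rw [Sym2.eq_swap (a := 2) (b := 0), Sym2.eq_swap (a := 2) (b := 1)] at k2
  rw [Sym2.eq_swap (a := 3) (b := 0), Sym2.eq_swap (a := 3) (b := 1),
    Sym2.eq_swap (a := 3) (b := 2)] at k3
  rw [← k0, ← k1, ← k2, ← k3, h02, h13]
  refine ⟨?_, ?_, ?_, ?_⟩ <;> congr 1 <;> omega

lemma exists_of_map_fst_eq_cons {α β : Type} {P : Multiset (α × β)} {a : α} {H : Multiset α}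
    (h : P.map Prod.fst = a ::ₘ H) : ∃ l P', P = (a, l) ::ₘ P' ∧ P'.map Prod.fst = H := by
  obtain ⟨⟨a', l⟩, hm, rfl, he⟩ := (Multiset.map_eq_cons _ _ _ _).2 h
  exact ⟨l, P.erase (a', l), (Multiset.cons_erase hm).symm, he⟩

lemma one_le_of_adjacent {p q r s : ℕ} (h : (p + q) % 2 = 1) (h' : (p + r) % 2 = 1)
    (h'' : (r + s) % 2 = 0) : 1 ≤ p ∨ (1 ≤ q ∧ 1 ≤ r ∧ 1 ≤ s) := by omega

lemma one_le_of_opposite {p q r s : ℕ} (h : (p + q) % 2 = 1) (h' : (p + r) % 2 = 0)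
    (h'' : (r + s) % 2 = 1) : (1 ≤ p ∧ 1 ≤ r) ∨ (1 ≤ q ∧ 1 ≤ s) := by omega

lemma fourCycle_usage {a1 a2 a3 a4 b1 b2 b3 b4 c1 c2 c3 c4 d1 d2 d3 d4 e1 e2 e3 e4 f1 f2 f3 f4 : ℕ}
    (pa : (a1 + a4) % 2 = 1 ∧ (a1 + a2) % 2 = 1 ∧ (a2 + a3) % 2 = 0 ∧
      (a3 + a4) % 2 = 0)
    (pb : (b1 + b4) % 2 = 1 ∧ (b1 + b2) % 2 = 0 ∧ (b2 + b3) % 2 = 1 ∧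
      (b3 + b4) % 2 = 0)
    (pc : (c1 + c4) % 2 = 1 ∧ (c1 + c2) % 2 = 0 ∧ (c2 + c3) % 2 = 0 ∧
      (c3 + c4) % 2 = 1)
    (pd : (d1 + d4) % 2 = 0 ∧ (d1 + d2) % 2 = 1 ∧ (d2 + d3) % 2 = 1 ∧
      (d3 + d4) % 2 = 0)
    (pe : (e1 + e4) % 2 = 0 ∧ (e1 + e2) % 2 = 1 ∧ (e2 + e3) % 2 = 0 ∧
      (e3 + e4) % 2 = 1)
    (pf : (f1 + f4) % 2 = 0 ∧ (f1 + f2) % 2 = 0 ∧ (f2 + f3) % 2 = 1 ∧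
      (f3 + f4) % 2 = 1)
    (h1 : a1 + (b1 + (c1 + (d1 + (e1 + (f1))))) ≤ 2)
    (h2 : a2 + (b2 + (c2 + (d2 + (e2 + (f2))))) ≤ 2)
    (h3 : a3 + (b3 + (c3 + (d3 + (e3 + (f3))))) ≤ 2)
    (h4 : a4 + (b4 + (c4 + (d4 + (e4 + (f4))))) ≤ 2) : False := by
  have comm := fun p q : ℕ => Nat.add_comm p q
  have qa := one_le_of_adjacent pa.1 pa.2.1 pa.2.2.1
  have qb := one_le_of_opposite pb.1 pb.2.1 pb.2.2.1
  have qc := one_le_of_adjacent (comm c1 c4 ▸ pc.1) (comm c3 c4 ▸ pc.2.2.2) (comm c2 c3 ▸ pc.2.2.1)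
  have qd := one_le_of_adjacent (comm d1 d2 ▸ pd.2.1) pd.2.2.1 pd.2.2.2
  have qe := one_le_of_opposite pe.2.1 pe.1 (comm e3 e4 ▸ pe.2.2.2)
  have qf := one_le_of_adjacent (comm f2 f3 ▸ pf.2.2.1) pf.2.2.2 (comm f1 f4 ▸ pf.1)
  clear comm pa pb pc pd pe pf
  rcases qa with qa | qa <;> rcases qb with qb | qb <;> rcases qc with qc | qc <;>
    rcases qd with qd | qd <;> rcases qe with qe | qe <;> rcases qf with qf | qf <;> omega

/-- A doubled four-cycle, possibly with loops, contains no spanning immersion of `K_4`. -/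
lemma no_walks_in_doubled_fourCycle {E : Multiset (Sym2 (Fin 4))}
    (h01 : E.count s(0, 1) ≤ 2) (h12 : E.count s(1, 2) ≤ 2) (h23 : E.count s(2, 3) ≤ 2)
    (h03 : E.count s(0, 3) ≤ 2) (h02 : E.count s(0, 2) = 0) (h13 : E.count s(1, 3) = 0)
    {P : Multiset (Sym2 (Fin 4) × List (Fin 4))} (hP : P.map Prod.fst = dmEdges 3)
    (hw : ∀ p ∈ P, ∃ u v, p.1 = s(u, v) ∧ IsWalk p.2 u v)
    (hle : (P.map fun p => walkEdges p.2).sum ≤ E) : False := by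
  have h : dmEdges 3 = s(0, 1) ::ₘ s(0, 2) ::ₘ s(0, 3) ::ₘ s(1, 2) ::ₘ s(1, 3) ::ₘ s(2, 3) ::ₘ 0 :=
    rfl
  rw [h] at hP
  obtain ⟨a, P, rfl, hP1⟩ := exists_of_map_fst_eq_cons hP
  obtain ⟨b, P, rfl, hP2⟩ := exists_of_map_fst_eq_cons hP1
  obtain ⟨c, P, rfl, hP3⟩ := exists_of_map_fst_eq_cons hP2
  obtain ⟨d, P, rfl, hP4⟩ := exists_of_map_fst_eq_cons hP3
  obtain ⟨e, P, rfl, hP5⟩ := exists_of_map_fst_eq_cons hP4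
  obtain ⟨f, P, rfl, hP6⟩ := exists_of_map_fst_eq_cons hP5
  obtain rfl := Multiset.map_eq_zero.1 hP6
  have hc := fun x => Multiset.count_le_of_le x hle
  simp only [Multiset.map_cons, Multiset.map_zero, Multiset.sum_cons, Multiset.sum_zero,
    Multiset.count_add, Multiset.count_zero] at hc
  simp only [Multiset.mem_cons, Multiset.notMem_zero, or_false, forall_eq_or_imp, forall_eq] at hw
  obtain ⟨wa, wb, wc, wd, we, wf⟩ := hw
  have c01 := (hc s(0, 1)).trans h01
  have c12 := (hc s(1, 2)).trans h12
  have c23 := (hc s(2, 3)).trans h23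
  have c03 := (hc s(0, 3)).trans h03
  have c02 := (hc s(0, 2)).trans h02.le
  have c13 := (hc s(1, 3)).trans h13.le
  simp only [Nat.le_zero, Nat.add_eq_zero_iff, and_true] at c02 c13
  have pa := count_walkEdges_fourCycle wa c02.1 c13.1
  have pb := count_walkEdges_fourCycle wb c02.2.1 c13.2.1
  have pc := count_walkEdges_fourCycle wc c02.2.2.1 c13.2.2.1
  have pd := count_walkEdges_fourCycle wd c02.2.2.2.1 c13.2.2.2.1
  have pe := count_walkEdges_fourCycle we c02.2.2.2.2.1 c13.2.2.2.2.1
  have pf := count_walkEdges_fourCycle wf c02.2.2.2.2.2 c13.2.2.2.2.2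
  exact fourCycle_usage pa pb pc pd pe pf c01 c12 c23 c03

lemma walkEdges_map {U : Type} (ψ : V → U) : ∀ l : List V,
    walkEdges (l.map ψ) = (walkEdges l).map (Sym2.map ψ)
  | [] => rfl
  | [_] => rfl
  | a :: b :: l => by
    have ih := walkEdges_map ψ (b :: l)
    rw [walkEdges_cons_cons, Multiset.map_cons, ← ih]
    rfl

lemma IsWalk.map {U : Type} (ψ : V → U) {l : List V} {u v : V} (h : IsWalk l u v) :
    IsWalk (l.map ψ) (ψ u) (ψ v) := by
  constructor
  · rw [List.head?_map, h.1, Option.map_some]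
  · rw [List.getLast?_map, h.2, Option.map_some]

lemma dmEdges_three_map (σ : Equiv.Perm (Fin 4)) : (dmEdges 3).map (Sym2.map σ) = dmEdges 3 := by
  revert σ
  decide

/-- Which of the four intervals cut out by `t 1`, `t 2`, `t 3` contains `i`. -/
def arcIndex {n : ℕ} (t : Fin 4 → Fin n) (i : Fin n) : Fin 4 :=
  if i < t 1 then 0 else if i < t 2 then 1 else if i < t 3 then 2 else 3

lemma arcIndex_eq_iff {n : ℕ} {t : Fin 4 → Fin n} (ht : StrictMono t) (i : Fin n) :
    (arcIndex t i = 0 ↔ i < t 1) ∧ (arcIndex t i = 1 ↔ t 1 ≤ i ∧ i < t 2) ∧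
      (arcIndex t i = 2 ↔ t 2 ≤ i ∧ i < t 3) ∧ (arcIndex t i = 3 ↔ t 3 ≤ i) := by
  have h12 : t 1 < t 2 := ht (by decide)
  have h23 : t 2 < t 3 := ht (by decide)
  unfold arcIndex
  split_ifs <;> simp only [Fin.lt_def, Fin.le_def] at * <;> refine ⟨?_, ?_, ?_, ?_⟩ <;>
    simp <;> omega

lemma arcIndex_apply {n : ℕ} {t : Fin 4 → Fin n} (ht : StrictMono t) (k : Fin 4) :
    arcIndex t (t k) = k := by
  obtain ⟨h0, h1, h2, h3⟩ := arcIndex_eq_iff ht (t k)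
  fin_cases k
  · exact h0.2 (ht (by decide))
  · exact h1.2 ⟨le_rfl, ht (by decide)⟩
  · exact h2.2 ⟨le_rfl, ht (by decide)⟩
  · exact h3.2 le_rfl

lemma count_cycleEdges_arcIndex {n : ℕ} {t : Fin 4 → Fin n} (ht : StrictMono t) :
    (cycleEdges n (arcIndex t)).count s(0, 1) ≤ 1 ∧ (cycleEdges n (arcIndex t)).count s(1, 2) ≤ 1 ∧
    (cycleEdges n (arcIndex t)).count s(2, 3) ≤ 1 ∧ (cycleEdges n (arcIndex t)).count s(0, 3) ≤ 1 ∧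
    (cycleEdges n (arcIndex t)).count s(0, 2) = 0 ∧
    (cycleEdges n (arcIndex t)).count s(1, 3) = 0 := by
  have h01 : (t 0).val < (t 1).val := ht (by decide)
  have h12 : (t 1).val < (t 2).val := ht (by decide)
  have h23 : (t 2).val < (t 3).val := ht (by decide)
  have hs : ∀ i : Fin n, (i.val + 1 < n ∧ (i.val + 1) % n = i.val + 1) ∨
      (i.val + 1 = n ∧ (i.val + 1) % n = 0) := by
    intro i
    rcases Nat.lt_or_ge (i.val + 1) n with h | h
    · exact .inl ⟨h, Nat.mod_eq_of_lt h⟩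
    · have : i.val + 1 = n := by omega
      exact .inr ⟨this, by rw [this, Nat.mod_self]⟩
  have one : ∀ (x : Sym2 (Fin 4)) (m : ℕ), (∀ i : Fin n, x = s(arcIndex t i,
      arcIndex t ⟨(i.val + 1) % n, Nat.mod_lt _ i.pos⟩) → i.val = m) →
      (cycleEdges n (arcIndex t)).count x ≤ 1 := by
    intro x m h
    unfold cycleEdges
    rw [Multiset.count_map]
    refine Finset.card_le_one (s := Finset.univ.filter fun i : Fin n => x = s(arcIndex t i,
      arcIndex t ⟨(i.val + 1) % n, Nat.mod_lt _ i.pos⟩)) |>.2 fun a ha b hb =>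
        Fin.ext ((h a (Finset.mem_filter.1 ha).2).trans (h b (Finset.mem_filter.1 hb).2).symm)
  have none : ∀ x : Sym2 (Fin 4), (∀ i : Fin n, x ≠ s(arcIndex t i,
      arcIndex t ⟨(i.val + 1) % n, Nat.mod_lt _ i.pos⟩)) →
      (cycleEdges n (arcIndex t)).count x = 0 := by
    intro x h
    rw [Multiset.count_eq_zero]
    unfold cycleEdges
    rw [Multiset.mem_map]
    rintro ⟨i, -, hi⟩
    exact h i hi.symm
  have hn := (t 3).isLt
  refine ⟨one _ ((t 1).val - 1) ?_, one _ ((t 2).val - 1) ?_, one _ ((t 3).val - 1) ?_,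
    one _ (n - 1) ?_, none _ ?_, none _ ?_⟩ <;> intro i hi <;>
  · have hsi := hs i
    have hi1 := arcIndex_eq_iff ht i
    have hi2 := arcIndex_eq_iff ht ⟨(i.val + 1) % n, Nat.mod_lt _ i.pos⟩
    simp only [Fin.lt_def, Fin.le_def] at hi1 hi2
    rcases Sym2.eq_iff.1 hi with ⟨ha, hb⟩ | ⟨ha, hb⟩
    · rw [← ha] at hi1
      rw [← hb] at hi2
      simp at hi1 hi2
      omega
    · rw [← hb] at hi1
      rw [← ha] at hi2
      simp at hi1 hi2
      omega

lemma IsDoubledCycle.not_immersion {G : MG V} (h : IsDoubledCycle G) (φ : Fin 4 → V) :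
    ¬ ImmersionVia G (dmEdges 3) φ := by
  rintro ⟨hφ, hmem, P, hP, hw, hle⟩
  obtain ⟨n, -, f, hf, hv, he⟩ := h
  have hq : ∀ w, ∃ i, f i = φ w := by
    intro w
    have := hmem w
    rw [← hv] at this
    simpa using this
  choose q hq using hq
  have hqi : Function.Injective q := fun a b hab => hφ (by rw [← hq, ← hq, hab])
  obtain ⟨σ, hσ⟩ : ∃ σ : Equiv.Perm (Fin 4), StrictMono (q ∘ σ) :=
    ⟨Tuple.sort q, (Tuple.monotone_sort q).strictMono_of_injective (hqi.comp (Equiv.injective _))⟩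
  have : Nonempty (Fin n) := ⟨q 0⟩
  set ψ : V → Fin 4 := fun v => arcIndex (q ∘ σ) (Function.invFun f v) with hψ
  have hψf : ∀ i, ψ (f i) = arcIndex (q ∘ σ) i := fun i => by
    simp only [hψ, Function.leftInverse_invFun hf i]
  have hψφ : ∀ w, ψ (φ w) = σ.symm w := fun w => by
    rw [← hq, hψf]
    have := arcIndex_apply hσ (σ.symm w)
    simpa using this
  have hE : G.edges.map (Sym2.map ψ) = 2 • cycleEdges n (arcIndex (q ∘ σ)) := by
    rw [he, Multiset.map_nsmul]
    unfold cycleEdges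
    rw [Multiset.map_map]
    simp only [Function.comp_def, Sym2.map_mk, hψf]
  obtain ⟨c1, c2, c3, c4, c5, c6⟩ := count_cycleEdges_arcIndex hσ
  refine no_walks_in_doubled_fourCycle (E := G.edges.map (Sym2.map ψ))
    (P := P.map fun p => (Sym2.map σ.symm p.1, p.2.map ψ)) ?_ ?_ ?_ ?_ ?_ ?_ ?_ ?_ ?_
  iterate 6 rw [hE, Multiset.count_nsmul]; omega
  · rw [Multiset.map_map, ← dmEdges_three_map σ.symm, ← hP, Multiset.map_map]
    rfl
  · intro p hp
    obtain ⟨p, hpP, rfl⟩ := Multiset.mem_map.1 hp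
    obtain ⟨u, v, h1, h2⟩ := hw p hpP
    refine ⟨σ.symm u, σ.symm v, by simp [h1], ?_⟩
    have := h2.map ψ
    rwa [hψφ, hψφ] at this
  · refine le_trans (le_of_eq ?_) (Multiset.map_le_map hle)
    rw [Multiset.map_map]
    simp only [Function.comp_def, walkEdges_map]
    have := map_multiset_sum (Multiset.mapAddMonoidHom (Sym2.map ψ)) (P.map fun p => walkEdges p.2)
    rw [Multiset.map_map] at this
    exact this.symm

/-- The simple graph joining the vertices of `G` connected by two parallel edges. -/
def doubleGraph (G : MG V) : SimpleGraph G.verts where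
  Adj v w := emult G v w = 2
  symm := ⟨fun v w h => by rw [emult_comm]; exact h⟩
  loopless := ⟨fun v h => by
    have : s(v.1, v.1) ∈ G.edges := Multiset.count_pos.1 (by unfold emult at h; omega)
    exact G.loopless _ this (by simp)⟩

lemma DoubledRegular.ncard_neighborSet {G : MG V} (h : DoubledRegular G) (v : G.verts) :
    ((doubleGraph G).neighborSet v).ncard = 2 := by
  have h1 := sum_emult_eq G v.2
  rw [h.2 v v.2] at h1
  have h2 : ∑ c ∈ G.verts.erase v.1, emult G v c =
      ∑ c ∈ G.verts.erase v.1, if emult G v c = 2 then 2 else 0 := by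
    refine Finset.sum_congr rfl fun c hc => ?_
    rw [Finset.mem_erase] at hc
    rcases h.1 v v.2 c hc.2 (Ne.symm hc.1) with h | h <;> simp [h]
  rw [h2, ← Finset.sum_filter, Finset.sum_const, smul_eq_mul] at h1
  have h3 : Subtype.val '' ((doubleGraph G).neighborSet v) =
      ((G.verts.erase v.1).filter fun c => emult G v c = 2 : Finset V) := by
    ext c
    simp only [Set.mem_image, SimpleGraph.mem_neighborSet, Finset.coe_filter, Finset.mem_erase,
      Set.mem_ofPred_eq, Subtype.exists, exists_and_right, exists_eq_right]
    constructor
    · rintro ⟨hc, ha⟩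
      exact ⟨⟨fun hcv => (doubleGraph G).loopless.irrefl v (by subst hcv; exact ha), hc⟩, ha⟩
    · rintro ⟨⟨-, hc⟩, ha⟩
      exact ⟨hc, ha⟩
  rw [← Set.ncard_image_of_injective _ Subtype.val_injective, h3, Set.ncard_coe_finset]
  omega

lemma DoubledRegular.reachable {G : MG V} (h : DoubledRegular G) (h3 : EdgeConn G 3)
    (u v : G.verts) : (doubleGraph G).Reachable u v := by
  by_contra hr
  set X : Finset V := G.verts.filter fun w => ∃ hw : w ∈ G.verts, (doubleGraph G).Reachable u ⟨w, hw⟩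
    with hX
  have hc := h3 X (Finset.filter_subset _ _) ⟨u, by simp [hX]⟩ (by
    intro he
    have hvX : v.1 ∈ X := by rw [he]; exact v.2
    exact hr (Finset.mem_filter.1 hvX).2.2)
  have : 0 < (cutEdges G X).card := by unfold dcut at hc; omega
  obtain ⟨e, he⟩ := Multiset.card_pos_iff_exists_mem.1 this
  obtain ⟨heG, a, b, rfl, ha, hb⟩ := Multiset.mem_filter.1 he
  have haV := G.edge_support _ heG a (by simp)
  have hbV := G.edge_support _ heG b (by simp)
  have hab : a ≠ b := fun h => hb (h ▸ ha)
  have hpos : 0 < emult G a b := Multiset.count_pos.2 heG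
  have hadj : (doubleGraph G).Adj ⟨a, haV⟩ ⟨b, hbV⟩ := by
    rcases h.1 a haV b hbV hab with h | h
    · omega
    · exact h
  obtain ⟨-, _, har⟩ := Finset.mem_filter.1 ha
  exact hb (Finset.mem_filter.2 ⟨hbV, hbV, har.trans hadj.reachable⟩)

lemma DoubledRegular.isDoubledCycle {G : MG V} (h : DoubledRegular G) (h3 : EdgeConn G 3)
    (hne : G.verts.Nonempty) : IsDoubledCycle G := by
  obtain ⟨v, hv⟩ := hne
  have hcyc : (doubleGraph G).IsCycles := fun v _ => h.ncard_neighborSet v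
  obtain ⟨p, hp, hsupp⟩ := hcyc.exists_cycle_toSubgraph_verts_eq_connectedComponentSupp
    (c := (doubleGraph G).connectedComponentMk ⟨v, hv⟩) (v := ⟨v, hv⟩) rfl
    (Set.nonempty_of_ncard_ne_zero (by rw [h.ncard_neighborSet]; omega))
  have hall : ∀ w, w ∈ p.support := by
    intro w
    rw [← SimpleGraph.Walk.mem_verts_toSubgraph, hsupp]
    exact SimpleGraph.ConnectedComponent.sound (h.reachable h3 _ _)
  have hlen := hp.three_le_length
  have hadj : ∀ a b, (doubleGraph G).Adj a b ↔ s(a, b) ∈ p.edges := by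
    intro a b
    rw [← SimpleGraph.Walk.adj_toSubgraph_iff_mem_edges]
    refine ⟨fun hab => ?_, fun hab => hab.adj_sub⟩
    have hs : p.toSubgraph.neighborSet a = (doubleGraph G).neighborSet a :=
      Set.eq_of_subset_of_ncard_le (SimpleGraph.Subgraph.neighborSet_subset _ _) (by
        rw [h.ncard_neighborSet, hp.ncard_neighborSet_toSubgraph_eq_two (hall a)])
        (Set.toFinite _)
    have : b ∈ p.toSubgraph.neighborSet a := hs ▸ hab
    exact this
  set f : Fin p.length → V := fun i => (p.getVert i).1 with hf
  have hinj : Function.Injective f := fun i j hij =>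
    Fin.ext (hp.getVert_injOn' (by simp; omega) (by simp; omega) (Subtype.ext hij))
  have hce : cycleEdges p.length f = (p.edges : Multiset (Sym2 G.verts)).map (Sym2.map Subtype.val) := by
    have : p.edges = List.ofFn fun i : Fin p.length => s(p.getVert i, p.getVert (i + 1)) := by
      apply List.ext_getElem
      · simp
      · intro i h1 h2
        simp [SimpleGraph.Walk.getElem_edges]
    unfold cycleEdges
    rw [this, List.ofFn_eq_map, ← Multiset.map_coe, Multiset.map_map]
    refine Multiset.map_congr rfl fun i _ => ?_
    simp only [hf, Function.comp, Sym2.map_mk]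
    congr 2
    rcases Nat.lt_or_ge (i.val + 1) p.length with h | h
    · rw [Nat.mod_eq_of_lt h]
    · have : i.val + 1 = p.length := by omega
      rw [this, Nat.mod_self, p.getVert_zero, p.getVert_length]
  refine ⟨p.length, hlen, f, hinj, ?_, ?_⟩
  · ext w
    simp only [Finset.mem_image, Finset.mem_univ, true_and]
    constructor
    · rintro ⟨i, rfl⟩
      exact (p.getVert i).2
    · intro hw
      obtain ⟨i, hi, hle⟩ := SimpleGraph.Walk.mem_support_iff_exists_getVert.1 (hall ⟨w, hw⟩)
      rcases hle.lt_or_eq with hlt | rfl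
      · exact ⟨⟨i, hlt⟩, by simp [hf, hi]⟩
      · refine ⟨⟨0, by omega⟩, ?_⟩
        rw [p.getVert_length] at hi
        simp [hf, hi]
  · have hnd : (cycleEdges p.length f).Nodup := by
      rw [hce]
      exact Multiset.Nodup.map (Sym2.map.injective Subtype.val_injective)
        (Multiset.coe_nodup.2 hp.edges_nodup)
    ext e
    rw [Multiset.count_nsmul]
    induction e with
    | _ a b =>
      by_cases hm : s(a, b) ∈ cycleEdges p.length f
      · rw [Multiset.count_eq_one_of_mem hnd hm]
        rw [hce] at hm
        obtain ⟨e', he', hh⟩ := Multiset.mem_map.1 hm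
        induction e' with
        | _ c d =>
          have := (hadj c d).2 he'
          rw [← hh]
          exact this
      · rw [Multiset.count_eq_zero_of_notMem hm, mul_zero]
        by_contra hc
        have hpos : 0 < emult G a b := Nat.pos_of_ne_zero hc
        have hmem : s(a, b) ∈ G.edges := Multiset.count_pos.1 hpos
        have ha := G.edge_support _ hmem a (by simp)
        have hb := G.edge_support _ hmem b (by simp)
        have hab : a ≠ b := fun h => G.loopless _ hmem (by simp [h])
        rcases h.1 a ha b hb hab with h0 | h2
        · omega
        · apply hm
          rw [hce]
          exact Multiset.mem_map.2 ⟨s(⟨a, ha⟩, ⟨b, hb⟩), (hadj ⟨a, ha⟩ ⟨b, hb⟩).1 h2, rfl⟩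

/-- Let `G` be a `3`-edge-connected graph with `|V(G)| ≥ 4` and two
root vertices.  Then `G` has no rooted immersion of `D₃` (that is, of `K₄` with two
roots) if and only if either `G` is a doubled cycle, or `G` has a segmentation of
width `3` relative to some `(X0, X1)` with the property that for each `i`, if
`|X_i| ≥ 3` then `X_i` contains no root vertex. -/
theorem statement_8 {V : Type} (G : MG V) (x0 x1 : V)
    (hconn : Connected G)
    (hx0 : x0 ∈ G.verts) (hx1 : x1 ∈ G.verts) (hne : x0 ≠ x1)
    (h3 : EdgeConn G 3) (hcard : 4 ≤ G.verts.card) :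
    ¬ HasRootedDmImmersion G 3 x0 x1 ↔
      (IsDoubledCycle G ∨
        ∃ X0 X1 : Finset V, HasSegmentation G X0 X1 3 ∧
          (3 ≤ X0.card → x0 ∉ X0 ∧ x1 ∉ X0) ∧
          (3 ≤ X1.card → x0 ∉ X1 ∧ x1 ∉ X1)) := by
  constructor
  · intro h
    rcases resolved _ G x0 x1 rfl h3 hcard hx0 hx1 hne with h' | h' | h'
    · exact absurd h' h
    · exact .inl (h'.isDoubledCycle h3 ⟨x0, hx0⟩)
    · exact .inr h'.exists_hasSegmentation
  · rintro (h | ⟨X0, X1, h, h0, h1⟩)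
    · rintro ⟨φ, -, -, hφ⟩
      exact h.not_immersion φ hφ
    · exact h.not_immersion h0 h1

end PaperW4
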